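/- Let 1/2 < p < 1. There are positive constants c₁(p), c₂(p), α(p) such that for all n ≥ 1, with ℙ_p-probability at least 1 − c₁·exp(−c₂·log²n), every Cheeger optimizer G ∈ 𝒢_n satisfies |G| ≥ α·n². -/

import Mathlib

open MeasureTheory Set Filter

noncomputable section

/-- Vertices of the square lattice `ℤ²`. -/
abbrev Vert : Type := ℤ × ℤ

/-- Edges of `ℤ²`, encoded as a base vertex together with a direction:
`false` for the horizontal edge to `x + (1,0)`, `true` for the vertical edge to `x + (0,1)`. -/
abbrev Edge : Type := Vert × Bool

/-- Percolation configurations: each edge is open (`true`) or closed (`false`). -/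
abbrev Config : Type := Edge → Bool

/-- The second endpoint of an edge. -/
def edgeTip (e : Edge) : Vert := e.1 + (if e.2 then (0, 1) else (1, 0))

/-- `x` and `y` are joined by an open edge in the configuration `ω`. -/
def openAdj (ω : Config) (x y : Vert) : Prop :=
  ∃ e : Edge, ω e = true ∧ ((e.1 = x ∧ edgeTip e = y) ∨ (e.1 = y ∧ edgeTip e = x))

/-- The open cluster of a vertex `x`: all vertices joined to `x` by an open path. -/
def cluster (ω : Config) (x : Vert) : Set Vert :=
  {y | Relation.ReflTransGen (openAdj ω) x y}

/-- The union of the infinite open clusters (a.s. the unique infinite cluster `C∞`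
in the supercritical regime). -/
def Cinf (ω : Config) : Set Vert := {x | (cluster ω x).Infinite}

/-- The box `[-n,n]²` of the lattice. -/
def latBox (n : ℕ) : Set Vert := {x | |x.1| ≤ (n : ℤ) ∧ |x.2| ≤ (n : ℤ)}

/-- The vertex set `C̃ₙ = C∞ ∩ [-n,n]²`. -/
def Ctilde (ω : Config) (n : ℕ) : Set Vert := Cinf ω ∩ latBox n

/-- Adjacency by an open edge within `C̃ₙ`. -/
def adjIn (ω : Config) (n : ℕ) (x y : Vert) : Prop :=
  openAdj ω x y ∧ x ∈ Ctilde ω n ∧ y ∈ Ctilde ω n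

/-- The connected component of `x` in the graph `C̃ₙ`. -/
def compIn (ω : Config) (n : ℕ) (x : Vert) : Set Vert :=
  {y | Relation.ReflTransGen (adjIn ω n) x y} ∩ Ctilde ω n

/-- The giant component `Cₙ`: a connected component of `C̃ₙ` of maximal cardinality. -/
def giant (ω : Config) (n : ℕ) : Set Vert :=
  compIn ω n (Classical.epsilon fun x =>
    x ∈ Ctilde ω n ∧ ∀ y ∈ Ctilde ω n, (compIn ω n y).ncard ≤ (compIn ω n x).ncard)

/-- The set of open edges of the graph induced on `G` having exactly one endpoint in `H`. -/
def edgeBdry (ω : Config) (G H : Set Vert) : Set Edge :=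
  {e | ω e = true ∧ e.1 ∈ G ∧ edgeTip e ∈ G ∧
    ((e.1 ∈ H ∧ edgeTip e ∉ H) ∨ (e.1 ∉ H ∧ edgeTip e ∈ H))}

/-- The Cheeger constant of the open subgraph of `ω` induced on the vertex set `G`:
the minimum of `|∂H|/|H|` over vertex sets `H ⊆ G` with `0 < |H| ≤ |G|/2`. -/
def cheeger (ω : Config) (G : Set Vert) : ℝ :=
  sInf {r : ℝ | ∃ H : Set Vert, H ⊆ G ∧ 0 < H.ncard ∧ 2 * H.ncard ≤ G.ncard ∧
    r = ((edgeBdry ω G H).ncard : ℝ) / (H.ncard : ℝ)}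

/-- `Φₙ`, the Cheeger constant of the giant component. -/
def Phi (ω : Config) (n : ℕ) : ℝ := cheeger ω (giant ω n)

/-- The set `𝒢ₙ` of Cheeger optimizers of the giant component. -/
def optimizers (ω : Config) (n : ℕ) : Set (Set Vert) :=
  {H | H ⊆ giant ω n ∧ 0 < H.ncard ∧ 2 * H.ncard ≤ (giant ω n).ncard ∧
    ((edgeBdry ω (giant ω n) H).ncard : ℝ) / (H.ncard : ℝ) = Phi ω n}

/-- `P` is the Bernoulli bond percolation measure with parameter `p`: a probability
measure under which the states of the edges are i.i.d. Bernoulli(`p`). -/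
def IsBernoulli (P : Measure Config) (p : ℝ) : Prop :=
  IsProbabilityMeasure P ∧
    ∀ (s : Finset Edge) (f : Edge → Bool),
      P {ω : Config | ∀ e ∈ s, ω e = f e} =
        ∏ e ∈ s, (if f e then ENNReal.ofReal p else ENNReal.ofReal (1 - p))

end

open MeasureTheory Set Filter

namespace Perc
section FiniteProb
variable {ι : Type*} [DecidableEq ι]

/-- Expectation of `f` under independent Bernoulli(p) on the finite set `F` (all other
coordinates closed). -/
noncomputable def E (p : ℝ) (F : Finset ι) (f : Set ι → ℝ) : ℝ :=
  ∑ S ∈ F.powerset, p ^ S.card * (1 - p) ^ (F \ S).card * f (S : Set ι)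

lemma E_empty (p : ℝ) (f : Set ι → ℝ) : E p ∅ f = f ∅ := by simp [E]

lemma E_insert (p : ℝ) {e : ι} {F : Finset ι} (he : e ∉ F) (f : Set ι → ℝ) :
    E p (insert e F) f = (1 - p) * E p F f + p * E p F (fun S => f (insert e S)) := by
  unfold E
  rw [Finset.sum_powerset_insert he, Finset.mul_sum, Finset.mul_sum]
  congr 1
  · refine Finset.sum_congr rfl fun S hS => ?_
    have hS' : S ⊆ F := Finset.mem_powerset.1 hS
    have heS : e ∉ S := fun h => he (hS' h)
    rw [Finset.insert_sdiff_of_notMem _ heS, Finset.card_insert_of_notMem (by simp [he])]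
    ring
  · refine Finset.sum_congr rfl fun S hS => ?_
    have hS' : S ⊆ F := Finset.mem_powerset.1 hS
    have heS : e ∉ S := fun h => he (hS' h)
    rw [Finset.card_insert_of_notMem heS]
    have : insert e F \ insert e S = F \ S := by
      ext x; simp only [Finset.mem_sdiff, Finset.mem_insert]
      constructor
      · rintro ⟨h | h, h2⟩ <;> tauto
      · rintro ⟨h, h2⟩
        refine ⟨Or.inr h, ?_⟩
        rintro (rfl | h3)
        · exact he h
        · exact h2 h3
    rw [this]; push_cast; ring

lemma E_add (p : ℝ) (F : Finset ι) (f g : Set ι → ℝ) :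
    E p F (fun S => f S + g S) = E p F f + E p F g := by
  simp [E, mul_add, Finset.sum_add_distrib]

lemma E_sub (p : ℝ) (F : Finset ι) (f g : Set ι → ℝ) :
    E p F (fun S => f S - g S) = E p F f - E p F g := by
  simp [E, mul_sub, Finset.sum_sub_distrib]

lemma E_smul (p : ℝ) (F : Finset ι) (c : ℝ) (f : Set ι → ℝ) :
    E p F (fun S => c * f S) = c * E p F f := by
  simp only [E, Finset.mul_sum]; exact Finset.sum_congr rfl fun _ _ => by ring

lemma E_mul_right (p : ℝ) (F : Finset ι) (c : ℝ) (f : Set ι → ℝ) :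
    E p F (fun S => f S * c) = E p F f * c := by
  simp only [E, Finset.sum_mul]; exact Finset.sum_congr rfl fun _ _ => by ring

lemma E_sum {κ : Type*} (p : ℝ) (F : Finset ι) (s : Finset κ) (f : κ → Set ι → ℝ) :
    E p F (fun S => ∑ k ∈ s, f k S) = ∑ k ∈ s, E p F (f k) := by
  simp only [E, Finset.mul_sum]; rw [Finset.sum_comm]

lemma E_const (p : ℝ) (F : Finset ι) (c : ℝ) : E p F (fun _ => c) = c := by
  induction F using Finset.induction_on with
  | empty => simp [E_empty]
  | insert e F he ih => rw [E_insert p he, ih]; ring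

lemma E_congr {p : ℝ} {F : Finset ι} {f g : Set ι → ℝ}
    (h : ∀ S : Set ι, S ⊆ F → f S = g S) : E p F f = E p F g := by
  unfold E
  refine Finset.sum_congr rfl fun S hS => ?_
  rw [h S (by simpa using hS)]

lemma E_mono {p : ℝ} (h0 : 0 ≤ p) (h1 : p ≤ 1) {F : Finset ι} {f g : Set ι → ℝ}
    (h : ∀ S : Set ι, S ⊆ F → f S ≤ g S) : E p F f ≤ E p F g := by
  unfold E
  refine Finset.sum_le_sum fun S hS => ?_
  have : (0:ℝ) ≤ 1 - p := by linarith
  exact mul_le_mul_of_nonneg_left (h S (by simpa using hS)) (by positivity)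

lemma E_nonneg {p : ℝ} (h0 : 0 ≤ p) (h1 : p ≤ 1) {F : Finset ι} {f : Set ι → ℝ}
    (h : ∀ S : Set ι, S ⊆ F → 0 ≤ f S) : 0 ≤ E p F f := by
  have := E_mono h0 h1 h
  rwa [E_const] at this

/-- Russo's formula. -/
lemma E_hasDerivAt (F : Finset ι) (f : Set ι → ℝ) (p : ℝ) :
    HasDerivAt (fun p => E p F f)
      (∑ e ∈ F, E p F (fun S => f (insert e S) - f (S \ {e}))) p := by
  induction F using Finset.induction_on generalizing f with
  | empty => simp [E_empty]; exact hasDerivAt_const _ _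
  | insert a F ha ih =>
    have h1 := ih f
    have h2 := ih (fun S => f (insert a S))
    have h3 := ((hasDerivAt_id p).const_sub 1).mul h1
    have h4 := (hasDerivAt_id p).mul h2
    have h5 := h3.add h4
    have e1 : (fun p => E p (insert a F) f) =
      ((((fun x => 1 - id x) * fun p => E p F f)) + (id * fun p => E p F fun S => f (insert a S))) := by
      funext p; rw [E_insert p ha]; rfl
    rw [e1]
    refine h5.congr_deriv (Eq.symm ?_)
    rw [Finset.sum_insert ha]
    have e2 : E p (insert a F) (fun S => f (insert a S) - f (S \ {a})) =
        E p F (fun S => f (insert a S)) - E p F f := by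
      rw [E_insert p ha]
      have : E p F (fun S => f (insert a S) - f (S \ {a})) =
          E p F (fun S => f (insert a S) - f S) := by
        refine E_congr fun S hS => ?_
        have : a ∉ S := fun h => ha (by simpa using hS h)
        rw [sdiff_singleton_eq_self this]
      rw [this]
      have : E p F (fun S => f (insert a (insert a S)) - f (insert a S \ {a})) =
          E p F (fun S => f (insert a S) - f S) := by
        refine E_congr fun S hS => ?_
        have h : a ∉ S := fun h => ha (by simpa using hS h)
        have : insert a S \ {a} = S := by
          ext x; simp; rintro h' rfl; exact h h'
        rw [this]; simp
      rw [this, E_sub]; ring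
    rw [e2]
    have e3 : ∀ e ∈ F, E p (insert a F) (fun S => f (insert e S) - f (S \ {e})) =
       (1 - p) * E p F (fun S => f (insert e S) - f (S \ {e})) +
       p * E p F (fun S => f (insert a (insert e S)) - f (insert a (S \ {e}))) := by
      intro e he
      rw [E_insert p ha]
      congr 2
      refine E_congr fun S hS => ?_
      have hne : a ≠ e := by rintro rfl; exact ha he
      rw [insert_comm]
      rw [insert_sdiff_of_notMem _ (by simpa using hne)]
    rw [Finset.sum_congr rfl e3, Finset.sum_add_distrib, ← Finset.mul_sum, ← Finset.mul_sum]
    simp; ring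

/-- Thinning. -/
lemma E_thin (p r : ℝ) (F : Finset ι) (f : Set ι → ℝ) :
    E (p * r) F f = E p F (fun S => E r F (fun T => f (S ∩ T))) := by
  induction F using Finset.induction_on generalizing f with
  | empty => simp [E_empty]
  | insert a F ha ih =>
    rw [E_insert _ ha, E_insert _ ha, ih, ih]
    have e1 : E p F (fun S => E r (insert a F) (fun T => f (S ∩ T))) =
        E p F (fun S => E r F (fun T => f (S ∩ T))) := by
      refine E_congr fun S hS => ?_
      have h : a ∉ S := fun h => ha (by simpa using hS h)
      rw [E_insert _ ha]
      have : ∀ T : Set ι, S ∩ insert a T = S ∩ T := by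
        intro T; ext x; simp only [mem_inter_iff, mem_insert_iff]
        constructor
        · rintro ⟨h1, rfl | h2⟩
          · exact absurd h1 h
          · exact ⟨h1, h2⟩
        · tauto
      simp only [this]; ring
    have e2 : E p F (fun S => E r (insert a F) (fun T => f (insert a S ∩ T))) =
        (1 - r) * E p F (fun S => E r F (fun T => f (S ∩ T))) +
        r * E p F (fun S => E r F (fun T => f (insert a (S ∩ T)))) := by
      rw [← E_smul, ← E_smul, ← E_add]
      refine E_congr fun S hS => ?_
      have h : a ∉ S := fun h => ha (by simpa using hS h)
      rw [E_insert _ ha]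
      congr 2
      · refine E_congr fun T hT => ?_
        have h : a ∉ T := fun h => ha (by simpa using hT h)
        congr 1
        ext x; simp only [mem_inter_iff, mem_insert_iff]
        constructor
        · rintro ⟨rfl | h1, h2⟩
          · exact absurd h2 h
          · exact ⟨h1, h2⟩
        · tauto
      · congr 1; funext T; congr 1
        ext x; simp only [mem_inter_iff, mem_insert_iff]; tauto
    rw [e1, e2]; ring

lemma E_union (p : ℝ) {F G : Finset ι} (h : Disjoint F G) (f : Set ι → ℝ) :
    E p (F ∪ G) f = E p F (fun S => E p G (fun T => f (S ∪ T))) := by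
  induction F using Finset.induction_on generalizing f with
  | empty => simp [E_empty]
  | insert a F ha ih =>
    rw [Finset.disjoint_insert_left] at h
    rw [Finset.insert_union, E_insert _ (by simp [ha, h.1]), E_insert _ ha, ih h.2, ih h.2]
    simp only [insert_union]

lemma E_compl (p : ℝ) (F : Finset ι) (f : Set ι → ℝ) :
    E p F (fun S => f (F \ S)) = E (1 - p) F f := by
  induction F using Finset.induction_on generalizing f with
  | empty => simp [E_empty]
  | insert a F ha ih =>
    rw [E_insert _ ha, E_insert _ ha, ← ih, ← ih]
    have e1 : E p F (fun S => f (↑(insert a F) \ S)) = E p F (fun S => f (insert a (↑F \ S))) := by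
      refine E_congr fun S hS => ?_
      have h : a ∉ S := fun h => ha (by simpa using hS h)
      congr 1
      push_cast; rw [insert_sdiff_of_notMem _ h]
    have e2 : E p F (fun S => f (↑(insert a F) \ insert a S)) = E p F (fun S => f (↑F \ S)) := by
      refine E_congr fun S hS => ?_
      congr 1
      ext x; simp only [Finset.coe_insert, Set.mem_sdiff, mem_insert_iff, Finset.mem_coe]
      constructor
      · tauto
      · rintro ⟨h1, h2⟩
        refine ⟨Or.inr h1, ?_⟩
        rintro (rfl | h)
        · exact ha h1
        · exact h2 h
    rw [e1, e2]; ring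

lemma E_map {κ : Type*} [DecidableEq κ] (p : ℝ) (F : Finset ι) (s : ι ≃ κ) (f : Set κ → ℝ) :
    E p (F.map s.toEmbedding) f = E p F (fun S => f (s '' S)) := by
  induction F using Finset.induction_on generalizing f with
  | empty => simp [E_empty]
  | insert a F ha ih =>
    rw [Finset.map_insert, E_insert _ (by simpa using ha), E_insert _ ha, ih, ih]
    simp [image_insert_eq]

/-- Harris inequality. -/
lemma E_harris {p : ℝ} (h0 : 0 ≤ p) (h1 : p ≤ 1) (F : Finset ι) {f g : Set ι → ℝ}
    (hf : Monotone f) (hg : Monotone g) :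
    E p F f * E p F g ≤ E p F (fun S => f S * g S) := by
  induction F using Finset.induction_on generalizing f g with
  | empty => simp [E_empty]
  | insert a F ha ih =>
    have hi : Monotone (fun S : Set ι => insert a S) := fun S T h => insert_subset_insert h
    have i1 := ih hf hg
    have i2 := ih (hf.comp hi) (hg.comp hi)
    simp only [Function.comp_def] at i2
    have m1 : E p F f ≤ E p F (fun S => f (insert a S)) :=
      E_mono h0 h1 fun S _ => hf (subset_insert _ _)
    have m2 : E p F g ≤ E p F (fun S => g (insert a S)) :=
      E_mono h0 h1 fun S _ => hg (subset_insert _ _)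
    rw [E_insert _ ha, E_insert _ ha, E_insert _ ha]
    set a1 := E p F f
    set a2 := E p F (fun S => f (insert a S))
    set b1 := E p F g
    set b2 := E p F (fun S => g (insert a S))
    have hq : 0 ≤ 1 - p := by linarith
    have k1 := mul_le_mul_of_nonneg_left i1 hq
    have k2 := mul_le_mul_of_nonneg_left i2 h0
    have k3 : 0 ≤ p * (1 - p) * ((a2 - a1) * (b2 - b1)) :=
      mul_nonneg (mul_nonneg h0 hq) (mul_nonneg (by linarith) (by linarith))
    nlinarith

end FiniteProb
end Perc

open MeasureTheory Set Filter

namespace Perc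
section Events
variable {ι : Type*} [DecidableEq ι]

/-- The event `A` depends only on the coordinates in `F`. -/
def LocalTo (F : Finset ι) (A : Set (Set ι)) : Prop :=
  ∀ S T : Set ι, (∀ e ∈ F, e ∈ S ↔ e ∈ T) → (S ∈ A ↔ T ∈ A)

/-- Local events. -/
def IsLoc (A : Set (Set ι)) : Prop := ∃ F : Finset ι, LocalTo F A

open Classical in
/-- Indicator of an event. -/
noncomputable def ind (A : Set (Set ι)) (S : Set ι) : ℝ := if S ∈ A then 1 else 0

lemma ind_of_mem {A : Set (Set ι)} {S : Set ι} (h : S ∈ A) : ind A S = 1 := by simp [ind, h]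
lemma ind_of_not {A : Set (Set ι)} {S : Set ι} (h : S ∉ A) : ind A S = 0 := by simp [ind, h]
lemma ind_nonneg (A : Set (Set ι)) (S : Set ι) : 0 ≤ ind A S := by
  unfold ind; split_ifs <;> norm_num
lemma ind_le_one (A : Set (Set ι)) (S : Set ι) : ind A S ≤ 1 := by
  unfold ind; split_ifs <;> norm_num
lemma ind_inter (A B : Set (Set ι)) (S : Set ι) : ind (A ∩ B) S = ind A S * ind B S := by
  unfold ind; by_cases h : S ∈ A <;> by_cases h' : S ∈ B <;> simp [h, h']
lemma ind_le_of_imp {A B : Set (Set ι)} {S T : Set ι} (h : S ∈ A → T ∈ B) :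
    ind A S ≤ ind B T := by
  unfold ind; by_cases h' : S ∈ A
  · simp [h', h h']
  · simp [h']; split_ifs <;> norm_num
lemma ind_compl (A : Set (Set ι)) (S : Set ι) : ind Aᶜ S = 1 - ind A S := by
  unfold ind; by_cases h : S ∈ A <;> simp [h]
lemma ind_congr {A B : Set (Set ι)} {S T : Set ι} (h : S ∈ A ↔ T ∈ B) :
    ind A S = ind B T := by
  unfold ind
  by_cases h' : S ∈ A
  · simp [h', h.1 h']
  · have : T ∉ B := fun h2 => h' (h.2 h2)
    simp [h', this]

lemma LocalTo.mono {F G : Finset ι} {A : Set (Set ι)} (h : LocalTo F A) (hFG : F ⊆ G) :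
    LocalTo G A := fun S T hST => h S T fun e he => hST e (hFG he)

lemma LocalTo.compl {F : Finset ι} {A : Set (Set ι)} (h : LocalTo F A) : LocalTo F Aᶜ :=
  fun S T hST => not_congr (h S T hST)

lemma LocalTo.inter' {F : Finset ι} {A B : Set (Set ι)} (h : LocalTo F A) (h' : LocalTo F B) :
    LocalTo F (A ∩ B) := fun S T hST => and_congr (h S T hST) (h' S T hST)

lemma LocalTo.union' {F : Finset ι} {A B : Set (Set ι)} (h : LocalTo F A) (h' : LocalTo F B) :
    LocalTo F (A ∪ B) := fun S T hST => or_congr (h S T hST) (h' S T hST)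

lemma LocalTo.inter {F G : Finset ι} {A B : Set (Set ι)} (h : LocalTo F A) (h' : LocalTo G B) :
    LocalTo (F ∪ G) (A ∩ B) :=
  (h.mono Finset.subset_union_left).inter' (h'.mono Finset.subset_union_right)

lemma LocalTo.union {F G : Finset ι} {A B : Set (Set ι)} (h : LocalTo F A) (h' : LocalTo G B) :
    LocalTo (F ∪ G) (A ∪ B) :=
  (h.mono Finset.subset_union_left).union' (h'.mono Finset.subset_union_right)

lemma LocalTo.ind_inter {F : Finset ι} {A : Set (Set ι)} (h : LocalTo F A) (S : Set ι) :
    ind A S = ind A (S ∩ F) :=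
  ind_congr (h _ _ fun e he => by simp [he])

lemma IsLoc.compl {A : Set (Set ι)} (h : IsLoc A) : IsLoc Aᶜ := ⟨_, h.choose_spec.compl⟩
lemma IsLoc.inter {A B : Set (Set ι)} (h : IsLoc A) (h' : IsLoc B) : IsLoc (A ∩ B) :=
  ⟨_, h.choose_spec.inter h'.choose_spec⟩
lemma IsLoc.union {A B : Set (Set ι)} (h : IsLoc A) (h' : IsLoc B) : IsLoc (A ∪ B) :=
  ⟨_, h.choose_spec.union h'.choose_spec⟩
lemma IsLoc.empty : IsLoc (∅ : Set (Set ι)) := ⟨∅, fun _ _ _ => Iff.rfl⟩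
lemma IsLoc.univ : IsLoc (univ : Set (Set ι)) := ⟨∅, fun _ _ _ => Iff.rfl⟩
lemma LocalTo.biUnion {κ : Type*} {F : Finset ι} {s : Finset κ} {A : κ → Set (Set ι)}
    (h : ∀ k ∈ s, LocalTo F (A k)) : LocalTo F (⋃ k ∈ s, A k) := by
  intro S T hST
  simp only [mem_iUnion]
  exact exists_congr fun k => exists_congr fun hk => h k hk S T hST
lemma LocalTo.biInter {κ : Type*} {F : Finset ι} {s : Finset κ} {A : κ → Set (Set ι)}
    (h : ∀ k ∈ s, LocalTo F (A k)) : LocalTo F (⋂ k ∈ s, A k) := by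
  intro S T hST
  simp only [mem_iInter]
  exact forall_congr' fun k => forall_congr' fun hk => h k hk S T hST
lemma IsLoc.biUnion {κ : Type*} {s : Finset κ} {A : κ → Set (Set ι)}
    (h : ∀ k ∈ s, IsLoc (A k)) : IsLoc (⋃ k ∈ s, A k) := by
  classical
  induction s using Finset.induction_on with
  | empty => simpa using IsLoc.empty
  | insert a s ha ih =>
    rw [Finset.set_biUnion_insert]
    exact (h a (by simp)).union (ih fun k hk => h k (by simp [hk]))

lemma E_local {p : ℝ} {F G : Finset ι} (hFG : F ⊆ G) {f : Set ι → ℝ}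
    (hf : ∀ S, f S = f (S ∩ F)) : E p G f = E p F f := by
  rw [← Finset.union_sdiff_of_subset hFG, E_union p Finset.disjoint_sdiff]
  refine E_congr fun S hS => ?_
  rw [E_congr (g := fun _ => f S), E_const]
  intro T hT
  rw [hf]
  congr 1
  ext x; simp only [mem_inter_iff, mem_union, Finset.mem_coe]
  constructor
  · rintro ⟨h1 | h1, h2⟩
    · exact h1
    · have := hT h1
      simp at this; tauto
  · intro h; exact ⟨Or.inl h, by simpa using hS h⟩

open Classical in
/-- Probability of a local event. -/
noncomputable def Pr (p : ℝ) (A : Set (Set ι)) : ℝ :=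
  if h : IsLoc A then E p h.choose (ind A) else 0

lemma Pr_eq {p : ℝ} {F : Finset ι} {A : Set (Set ι)} (h : LocalTo F A) :
    Pr p A = E p F (ind A) := by
  have hl : IsLoc A := ⟨F, h⟩
  unfold Pr
  rw [dif_pos hl]
  rw [← E_local (Finset.subset_union_left (s₁ := hl.choose) (s₂ := F)) hl.choose_spec.ind_inter,
    ← E_local (Finset.subset_union_right (s₁ := hl.choose) (s₂ := F)) h.ind_inter]

lemma Pr_nonneg {p : ℝ} (h0 : 0 ≤ p) (h1 : p ≤ 1) (A : Set (Set ι)) : 0 ≤ Pr p A := by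
  unfold Pr; split_ifs
  · exact E_nonneg h0 h1 fun S _ => ind_nonneg _ _
  · exact le_rfl

lemma Pr_le_one {p : ℝ} (h0 : 0 ≤ p) (h1 : p ≤ 1) (A : Set (Set ι)) : Pr p A ≤ 1 := by
  unfold Pr; split_ifs
  · exact (E_mono h0 h1 fun S _ => ind_le_one _ _).trans_eq (E_const _ _ _)
  · norm_num

lemma Pr_compl {p : ℝ} {A : Set (Set ι)} (h : IsLoc A) : Pr p Aᶜ = 1 - Pr p A := by
  obtain ⟨F, hF⟩ := h
  rw [Pr_eq hF, Pr_eq hF.compl]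
  simp only [ind_compl, E_sub, E_const, funext (ind_compl A)]

lemma Pr_mono {p : ℝ} (h0 : 0 ≤ p) (h1 : p ≤ 1) {A B : Set (Set ι)} (hB : IsLoc B)
    (h : A ⊆ B) : Pr p A ≤ Pr p B := by
  by_cases hA : IsLoc A
  · obtain ⟨F, hF⟩ := hA
    obtain ⟨G, hG⟩ := hB
    rw [Pr_eq (hF.mono (Finset.subset_union_left (s₂ := G))),
      Pr_eq (hG.mono (Finset.subset_union_right (s₁ := F)))]
    exact E_mono h0 h1 fun S _ => ind_le_of_imp fun hS => h hS
  · have : Pr p A = 0 := by unfold Pr; rw [dif_neg hA]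
    rw [this]; exact Pr_nonneg h0 h1 _

lemma Pr_union_le {p : ℝ} (h0 : 0 ≤ p) (h1 : p ≤ 1) {A B : Set (Set ι)} (hA : IsLoc A)
    (hB : IsLoc B) : Pr p (A ∪ B) ≤ Pr p A + Pr p B := by
  obtain ⟨F, hF⟩ := hA
  obtain ⟨G, hG⟩ := hB
  have hF' := hF.mono (Finset.subset_union_left (s₂ := G))
  have hG' := hG.mono (Finset.subset_union_right (s₁ := F))
  rw [Pr_eq hF', Pr_eq hG', Pr_eq (hF'.union' hG'), ← E_add]
  refine E_mono h0 h1 fun S _ => ?_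
  unfold ind
  by_cases h : S ∈ A <;> by_cases h' : S ∈ B <;> simp [h, h']

lemma Pr_biUnion_le {p : ℝ} (h0 : 0 ≤ p) (h1 : p ≤ 1) {κ : Type*} (s : Finset κ)
    {A : κ → Set (Set ι)} (h : ∀ k ∈ s, IsLoc (A k)) :
    Pr p (⋃ k ∈ s, A k) ≤ ∑ k ∈ s, Pr p (A k) := by
  classical
  induction s using Finset.induction_on with
  | empty =>
    simp only [Finset.notMem_empty, iUnion_of_empty, iUnion_empty, Finset.sum_empty]
    rw [Pr_eq (F := ∅) (fun _ _ _ => Iff.rfl), E_empty, ind_of_not (by simp)]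
  | insert a s ha ih =>
    rw [Finset.set_biUnion_insert, Finset.sum_insert ha]
    have h' : ∀ k ∈ s, IsLoc (A k) := fun k hk => h k (by simp [hk])
    exact (Pr_union_le h0 h1 (h a (by simp)) (IsLoc.biUnion h')).trans
      (add_le_add le_rfl (ih h'))

lemma E_indep {p : ℝ} {F G H : Finset ι} (hd : Disjoint F G) (hF : F ⊆ H) (hG : G ⊆ H)
    {f g : Set ι → ℝ}
    (hf : ∀ S, f S = f (S ∩ F)) (hg : ∀ S, g S = g (S ∩ G)) :
    E p H (fun S => f S * g S) = E p F f * E p G g := by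
  have hFG : ((F ∪ G : Finset ι)) ⊆ H := Finset.union_subset hF hG
  rw [E_local hFG, E_union p hd, ← E_mul_right]
  · refine E_congr fun S hS => ?_
    rw [← E_smul]
    refine E_congr fun T hT => ?_
    have d : Disjoint (F : Set ι) (G : Set ι) := by exact_mod_cast hd
    rw [hf (S ∪ T), hg (S ∪ T)]
    congr 2
    · rw [union_inter_distrib_right, inter_eq_left.2 hS, (d.symm.mono_left hT).inter_eq, union_empty]
    · rw [union_inter_distrib_right, inter_eq_left.2 hT, (d.mono_left hS).inter_eq, empty_union]
  · intro S
    rw [hf S, hg S, hf (S ∩ ↑(F ∪ G)), hg (S ∩ ↑(F ∪ G))]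
    congr 2
    · ext x; simp; tauto
    · ext x; simp; tauto

lemma Pr_indep {p : ℝ} {F G : Finset ι} (hd : Disjoint F G) {A B : Set (Set ι)}
    (hA : LocalTo F A) (hB : LocalTo G B) : Pr p (A ∩ B) = Pr p A * Pr p B := by
  rw [Pr_eq (hA.inter hB), Pr_eq hA, Pr_eq hB,
    ← E_indep hd Finset.subset_union_left Finset.subset_union_right hA.ind_inter hB.ind_inter]
  simp only [funext (ind_inter A B)]

lemma Pr_univ {p : ℝ} : Pr p (Set.univ : Set (Set ι)) = 1 := by
  rw [Pr_eq (F := ∅) (fun _ _ _ => Iff.rfl), E_empty, ind_of_mem (by simp)]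

lemma Pr_biInter {p : ℝ} {κ : Type*} [DecidableEq κ] (s : Finset κ) {A : κ → Set (Set ι)}
    {F : κ → Finset ι} (hA : ∀ k ∈ s, LocalTo (F k) (A k))
    (hd : ∀ k ∈ s, ∀ l ∈ s, k ≠ l → Disjoint (F k) (F l)) :
    Pr p (⋂ k ∈ s, A k) = ∏ k ∈ s, Pr p (A k) := by
  induction s using Finset.induction_on with
  | empty => simp [Pr_univ]
  | insert a s ha ih =>
    rw [Finset.set_biInter_insert, Finset.prod_insert ha,
      Pr_indep (F := F a) (G := s.biUnion F) _ (hA a (by simp)), ih]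
    · exact fun k hk => hA k (by simp [hk])
    · exact fun k hk l hl => hd k (by simp [hk]) l (by simp [hl])
    · exact LocalTo.biInter fun k hk => (hA k (by simp [hk])).mono
        (Finset.subset_biUnion_of_mem F hk)
    · rw [Finset.disjoint_biUnion_right]
      intro k hk
      exact hd a (by simp) k (by simp [hk]) (by rintro rfl; exact ha hk)

lemma LocalTo.image {κ : Type*} [DecidableEq κ] {F : Finset ι} (s : ι ≃ κ)
    {A : Set (Set κ)} (h : LocalTo (F.map s.toEmbedding) A) :
    LocalTo F {S : Set ι | s '' S ∈ A} := by
  intro S T hST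
  refine h _ _ fun e he => ?_
  obtain ⟨x, hx, rfl⟩ := Finset.mem_map.1 he
  simpa using hST x hx

lemma IsLoc.image {κ : Type*} [DecidableEq κ] (s : ι ≃ κ) {A : Set (Set κ)} (h : IsLoc A) :
    IsLoc {S : Set ι | s '' S ∈ A} := by
  obtain ⟨F, hF⟩ := h
  refine ⟨F.map s.symm.toEmbedding, LocalTo.image s ?_⟩
  refine hF.mono fun x hx => ?_
  simp [hx]

lemma Pr_image {p : ℝ} {κ : Type*} [DecidableEq κ] (s : ι ≃ κ) {A : Set (Set κ)} (h : IsLoc A) :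
    Pr p {S : Set ι | s '' S ∈ A} = Pr p A := by
  obtain ⟨F, hF⟩ := h
  have hF' : LocalTo ((F.map s.symm.toEmbedding).map s.toEmbedding) A :=
    hF.mono fun x hx => by simp [hx]
  rw [Pr_eq hF', Pr_eq (LocalTo.image s hF'), E_map p (F.map s.symm.toEmbedding) s]
  rfl

lemma LocalTo.flip {F : Finset ι} {A : Set (Set ι)} (h : LocalTo F A) :
    LocalTo F {S : Set ι | Sᶜ ∈ A} := by
  intro S T hST
  exact h _ _ fun e he => not_congr (hST e he)

lemma IsLoc.flip {A : Set (Set ι)} (h : IsLoc A) : IsLoc {S : Set ι | Sᶜ ∈ A} :=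
  ⟨_, h.choose_spec.flip⟩

lemma Pr_flip {p : ℝ} {A : Set (Set ι)} (h : IsLoc A) :
    Pr p {S : Set ι | Sᶜ ∈ A} = Pr (1 - p) A := by
  obtain ⟨F, hF⟩ := h
  rw [Pr_eq hF.flip, Pr_eq hF, ← E_compl]
  refine E_congr fun S _ => ind_congr ?_
  exact hF _ _ fun e he => by simp [he]

lemma ind_monotone {A : Set (Set ι)} (h : IsUpperSet A) : Monotone (ind A) :=
  fun _ _ hST => ind_le_of_imp fun hS => h hST hS

lemma Pr_harris {p : ℝ} (h0 : 0 ≤ p) (h1 : p ≤ 1) {A B : Set (Set ι)} (hA : IsLoc A)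
    (hB : IsLoc B) (uA : IsUpperSet A) (uB : IsUpperSet B) :
    Pr p A * Pr p B ≤ Pr p (A ∩ B) := by
  obtain ⟨F, hF⟩ := hA
  obtain ⟨G, hG⟩ := hB
  have hF' := hF.mono (Finset.subset_union_left (s₂ := G))
  have hG' := hG.mono (Finset.subset_union_right (s₁ := F))
  rw [Pr_eq hF', Pr_eq hG', Pr_eq (hF'.inter' hG'), funext (ind_inter A B)]
  exact E_harris h0 h1 _ (ind_monotone uA) (ind_monotone uB)

lemma Pr_harris_compl {p : ℝ} (h0 : 0 ≤ p) (h1 : p ≤ 1) {A B : Set (Set ι)} (hA : IsLoc A)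
    (hB : IsLoc B) (uA : IsUpperSet A) (uB : IsUpperSet B) :
    Pr p Aᶜ * Pr p Bᶜ ≤ Pr p (Aᶜ ∩ Bᶜ) := by
  have h := Pr_harris h0 h1 hA hB uA uB
  obtain ⟨F, hF⟩ := hA
  obtain ⟨G, hG⟩ := hB
  have hF' := hF.mono (Finset.subset_union_left (s₂ := G))
  have hG' := hG.mono (Finset.subset_union_right (s₁ := F))
  have e : Pr p (Aᶜ ∩ Bᶜ) = 1 - Pr p A - Pr p B + Pr p (A ∩ B) := by
    rw [Pr_eq hF', Pr_eq hG', Pr_eq (hF'.inter' hG'), Pr_eq (hF'.compl.inter' hG'.compl),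
      ← E_const p (F ∪ G) 1, ← E_sub, ← E_sub, ← E_add]
    refine E_congr fun S _ => ?_
    rw [ind_inter, ind_inter, ind_compl, ind_compl]; ring
  rw [e, Pr_compl ⟨F, hF⟩, Pr_compl ⟨G, hG⟩]
  linarith

lemma Pr_mono_p {p q : ℝ} (h0 : 0 ≤ p) (hpq : p ≤ q) (h1 : q ≤ 1) {A : Set (Set ι)}
    (hA : IsLoc A) (uA : IsUpperSet A) : Pr p A ≤ Pr q A := by
  rcases eq_or_lt_of_le (h0.trans hpq) with h | hq
  · have : p = q := by linarith
    rw [this]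
  obtain ⟨F, hF⟩ := hA
  have : p = q * (p / q) := by field_simp
  rw [Pr_eq hF, Pr_eq hF]
  conv_lhs => rw [this]
  rw [E_thin]
  refine E_mono (h0.trans hpq) h1 fun S _ => ?_
  refine (E_mono (by positivity) ((div_le_one hq).2 hpq) (g := fun _ => ind A S)
    fun T _ => ?_).trans_eq (E_const _ _ _)
  exact ind_monotone uA inter_subset_left

lemma Pr_allopen {p : ℝ} (F : Finset ι) : Pr p {S : Set ι | (F : Set ι) ⊆ S} = p ^ F.card := by
  have hl : LocalTo F {S : Set ι | (F : Set ι) ⊆ S} := by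
    intro S T h
    simp only [mem_ofPred_eq]
    exact ⟨fun h' x hx => (h x (by simpa using hx)).1 (h' hx),
      fun h' x hx => (h x (by simpa using hx)).2 (h' hx)⟩
  rw [Pr_eq hl, E, Finset.sum_eq_single F]
  · rw [ind_of_mem (by simp)]; simp
  · intro S hS hne
    rw [ind_of_not, mul_zero]
    intro h
    exact hne (Finset.Subset.antisymm (Finset.mem_powerset.1 hS) (by simpa using h))
  · intro h; simp at h

lemma Pr_allclosed {p : ℝ} (F : Finset ι) :
    Pr p {S : Set ι | ∀ x ∈ F, x ∉ S} = (1 - p) ^ F.card := by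
  have hl : IsLoc {S : Set ι | (F : Set ι) ⊆ S} := by
    refine ⟨F, ?_⟩
    intro S T h
    simp only [mem_ofPred_eq]
    exact ⟨fun h' x hx => (h x (by simpa using hx)).1 (h' hx),
      fun h' x hx => (h x (by simpa using hx)).2 (h' hx)⟩
  rw [← Pr_allopen, ← Pr_flip hl]
  rfl

lemma localTo_allclosed (F : Finset ι) : LocalTo F {S : Set ι | ∀ x ∈ F, x ∉ S} := by
  intro S T h
  exact forall_congr' fun x => forall_congr' fun hx => not_congr (h x hx)

lemma localTo_allopen (F : Finset ι) : LocalTo F {S : Set ι | (F : Set ι) ⊆ S} := by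
  intro S T h
  exact ⟨fun h' x hx => (h x (by simpa using hx)).1 (h' hx),
      fun h' x hx => (h x (by simpa using hx)).2 (h' hx)⟩

/-- Finite energy. -/
lemma Pr_fe {p : ℝ} (h0 : 0 ≤ p) (h1 : p ≤ 1) (F0 : Finset ι) {A : Set (Set ι)} (hA : IsLoc A) :
    p ^ F0.card * Pr p {S : Set ι | S ∪ F0 ∈ A} ≤ Pr p A := by
  obtain ⟨F, hF⟩ := hA
  have hl : LocalTo (F \ F0) {S : Set ι | S ∪ F0 ∈ A} := by
    intro S T h
    refine hF _ _ fun e he => ?_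
    by_cases h' : e ∈ F0
    · simp [h']
    · have := h e (by simp [he, h'])
      simp [h', this]
  rw [← Pr_allopen, ← Pr_indep Finset.disjoint_sdiff (localTo_allopen F0) hl]
  refine Pr_mono h0 h1 ⟨F, hF⟩ ?_
  rintro S ⟨hS1, hS2⟩
  have : S ∪ F0 = S := union_eq_left.2 hS1
  simpa [this] using hS2

/-- The event that `A` still holds after closing any `r` coordinates. -/
def robust (r : ℕ) (A : Set (Set ι)) : Set (Set ι) :=
  {S | ∀ B : Finset ι, B.card ≤ r → S \ B ∈ A}

lemma LocalTo.robust {F : Finset ι} {A : Set (Set ι)} (h : LocalTo F A) (r : ℕ) :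
    LocalTo F (robust r A) := by
  intro S T hST
  refine forall_congr' fun B => forall_congr' fun _ => h _ _ fun e he => ?_
  have := hST e he
  simp [this]

lemma Pr_robust {p r : ℝ} (h0 : 0 ≤ p) (h1 : p ≤ 1) (r0 : 0 ≤ r) (r1 : r ≤ 1) {k : ℕ}
    {A : Set (Set ι)} (hA : IsLoc A) (uA : IsUpperSet A) :
    (1 - r) ^ k * Pr p (robust k A)ᶜ ≤ Pr (p * r) Aᶜ := by
  obtain ⟨F, hF⟩ := hA
  rw [Pr_eq hF.compl, Pr_eq (hF.robust k).compl, E_thin, ← E_smul]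
  refine E_mono h0 h1 fun S hS => ?_
  by_cases h : S ∈ robust k A
  · rw [ind_of_not (by simpa using h), mul_zero]
    exact E_nonneg r0 r1 fun T _ => ind_nonneg _ _
  · rw [ind_of_mem h, mul_one]
    simp only [robust, mem_ofPred_eq, not_forall] at h
    obtain ⟨B, hB, hSB⟩ := h
    have hq : 0 ≤ 1 - r := by linarith
    calc (1 - r) ^ k ≤ (1 - r) ^ (B ∩ F).card :=
          pow_le_pow_of_le_one hq (by linarith)
            ((Finset.card_le_card Finset.inter_subset_left).trans hB)
      _ = E r F (ind {S : Set ι | ∀ x ∈ B ∩ F, x ∉ S}) := by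
          rw [← Pr_allclosed, Pr_eq ((localTo_allclosed (B ∩ F)).mono Finset.inter_subset_right)]
      _ ≤ _ := by
          refine E_mono r0 r1 fun T hT => ind_le_of_imp fun h hA => hSB ?_
          refine uA ?_ hA
          rintro x ⟨hx, hx'⟩
          refine ⟨hx, fun hxB => ?_⟩
          exact h x (Finset.mem_inter.2 ⟨hxB, hT hx'⟩) hx'

end Events

lemma Pr_bern {P : Measure Config} {p : ℝ} (h0 : 0 ≤ p) (h1 : p ≤ 1) (hP : IsBernoulli P p)
    {A : Set (Set Edge)} (hA : IsLoc A) :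
    P {ω : Config | {e | ω e = true} ∈ A} ≤ ENNReal.ofReal (Pr p A) := by
  classical
  obtain ⟨F, hF⟩ := hA
  have hsub : {ω : Config | {e | ω e = true} ∈ A} ⊆
      ⋃ S ∈ F.powerset.filter (fun S : Finset Edge => (S : Set Edge) ∈ A),
        {ω : Config | ∀ e ∈ F, ω e = decide (e ∈ S)} := by
    intro ω hω
    simp only [mem_iUnion, Finset.mem_filter, Finset.mem_powerset]
    refine ⟨F.filter (fun e => ω e = true), ⟨Finset.filter_subset _ _, ?_⟩, ?_⟩
    · refine (hF _ _ fun e he => ?_).1 hω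
      simp [he]
    · intro e he
      simp [he]
  refine (measure_mono hsub).trans ((measure_biUnion_finset_le _ _).trans ?_)
  rw [Pr_eq hF, E, ENNReal.ofReal_sum_of_nonneg, Finset.sum_filter]
  · refine Finset.sum_le_sum fun S hS => ?_
    split_ifs with h
    · rw [hP.2, ind_of_mem h, mul_one]
      have hS' : S ⊆ F := Finset.mem_powerset.1 hS
      have : F = S ∪ (F \ S) := (Finset.union_sdiff_of_subset hS').symm
      conv_lhs => rw [this]
      rw [Finset.prod_union Finset.disjoint_sdiff]
      rw [Finset.prod_congr rfl (g := fun _ => ENNReal.ofReal p) (by intro x hx; simp [hx]),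
        Finset.prod_congr rfl (s₁ := F \ S) (g := fun _ => ENNReal.ofReal (1 - p))
          (by intro x hx; simp at hx; simp [hx])]
      rw [Finset.prod_const, Finset.prod_const, ENNReal.ofReal_mul (by positivity),
        ENNReal.ofReal_pow h0, ENNReal.ofReal_pow (by linarith)]
    · exact zero_le
  · intro S _
    have : 0 ≤ 1 - p := by linarith
    exact mul_nonneg (by positivity) (ind_nonneg _ _)

end Perc

open MeasureTheory Set Filter

namespace Perc

/-- `x` and `y` are joined by an edge of `S`. -/
def adj (S : Set Edge) (x y : Vert) : Prop :=
  ∃ e ∈ S, ((e.1 = x ∧ edgeTip e = y) ∨ (e.1 = y ∧ edgeTip e = x))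

/-- `x` and `y` are connected in `S` within `D`. -/
def conn (S : Set Edge) (D : Set Vert) (x y : Vert) : Prop :=
  x ∈ D ∧ Relation.ReflTransGen (fun a b => adj S a b ∧ a ∈ D ∧ b ∈ D) x y

/-- Some point of `X` is connected to some point of `Y`. -/
def connS (S : Set Edge) (D X Y : Set Vert) : Prop := ∃ x ∈ X, ∃ y ∈ Y, conn S D x y

lemma tip_false (v : Vert) : edgeTip (v, false) = (v.1 + 1, v.2) := by
  simp [edgeTip, Prod.ext_iff]

lemma tip_true (v : Vert) : edgeTip (v, true) = (v.1, v.2 + 1) := by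
  simp [edgeTip, Prod.ext_iff]

lemma adj_cases {S : Set Edge} {x y : Vert} (h : adj S x y) :
    ((x, false) ∈ S ∧ y = (x.1 + 1, x.2)) ∨ ((y, false) ∈ S ∧ x = (y.1 + 1, y.2)) ∨
    ((x, true) ∈ S ∧ y = (x.1, x.2 + 1)) ∨ ((y, true) ∈ S ∧ x = (y.1, y.2 + 1)) := by
  obtain ⟨⟨v, b⟩, he, (⟨rfl, rfl⟩ | ⟨rfl, rfl⟩)⟩ := h <;> cases b <;>
    simp_all [tip_false, tip_true]

lemma adj_edge {S : Set Edge} {e : Edge} (he : e ∈ S) : adj S e.1 (edgeTip e) :=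
  ⟨e, he, Or.inl ⟨rfl, rfl⟩⟩

lemma adj_h {S : Set Edge} {x y : ℤ} (he : ((x, y), false) ∈ S) : adj S (x, y) (x + 1, y) :=
  ⟨_, he, Or.inl ⟨rfl, by simp [tip_false]⟩⟩

lemma adj_v {S : Set Edge} {x y : ℤ} (he : ((x, y), true) ∈ S) : adj S (x, y) (x, y + 1) :=
  ⟨_, he, Or.inl ⟨rfl, by simp [tip_true]⟩⟩

lemma adj.symm {S : Set Edge} {x y : Vert} (h : adj S x y) : adj S y x := by
  obtain ⟨e, he, h⟩ := h
  exact ⟨e, he, h.symm⟩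

lemma adj.mono {S T : Set Edge} {x y : Vert} (h : adj S x y) (hST : S ⊆ T) : adj T x y := by
  obtain ⟨e, he, h⟩ := h
  exact ⟨e, hST he, h⟩

lemma adj_close {S : Set Edge} {x y : Vert} (h : adj S x y) :
    x.1 - 1 ≤ y.1 ∧ y.1 ≤ x.1 + 1 ∧ x.2 - 1 ≤ y.2 ∧ y.2 ≤ x.2 + 1 := by
  rcases adj_cases h with ⟨_, h⟩ | ⟨_, h⟩ | ⟨_, h⟩ | ⟨_, h⟩ <;> subst h <;> refine ⟨?_, ?_, ?_, ?_⟩ <;> simp only <;> omega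

lemma conn.left {S D x y} (h : conn S D x y) : x ∈ D := h.1

lemma conn.right {S D x y} (h : conn S D x y) : y ∈ D := by
  obtain ⟨hx, h⟩ := h
  cases h with
  | refl => exact hx
  | tail _ h => exact h.2.2

lemma conn.refl {S : Set Edge} {D : Set Vert} {x : Vert} (h : x ∈ D) : conn S D x x :=
  ⟨h, Relation.ReflTransGen.refl⟩

lemma conn.trans {S D x y z} (h : conn S D x y) (h' : conn S D y z) : conn S D x z :=
  ⟨h.1, h.2.trans h'.2⟩

lemma conn.symm {S D x y} (h : conn S D x y) : conn S D y x := by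
  refine ⟨h.right, ?_⟩
  have : Std.Symm (fun a b => adj S a b ∧ a ∈ D ∧ b ∈ D) :=
    ⟨fun a b h => ⟨h.1.symm, h.2.2, h.2.1⟩⟩
  exact Relation.ReflTransGen.symmetric.symm _ _ h.2

lemma conn.tail {S D x y z} (h : conn S D x y) (h' : adj S y z) (hz : z ∈ D) : conn S D x z :=
  ⟨h.1, h.2.tail ⟨h', h.right, hz⟩⟩

lemma conn_adj {S : Set Edge} {D : Set Vert} {x y : Vert} (h' : adj S x y) (hx : x ∈ D)
    (hy : y ∈ D) : conn S D x y := (conn.refl hx).tail h' hy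

lemma conn.mono {S T D D' x y} (h : conn S D x y) (hS : S ⊆ T) (hD : D ⊆ D') : conn T D' x y :=
  ⟨hD h.1, Relation.ReflTransGen.mono (fun _ _ k => ⟨k.1.mono hS, hD k.2.1, hD k.2.2⟩) _ _ h.2⟩

/-- Induction principle for connections. -/
lemma conn.induct {S : Set Edge} {D : Set Vert} {x : Vert} {Q : Vert → Prop} (h0 : x ∈ D → Q x)
    (hs : ∀ y z, conn S D x y → Q y → adj S y z → z ∈ D → Q z) {y : Vert} (h : conn S D x y) :
    Q y := by
  obtain ⟨hx, h⟩ := h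
  induction h with
  | refl => exact h0 hx
  | tail h1 h2 ih => exact hs _ _ ⟨hx, h1⟩ ih h2.1 h2.2.2

/-- Connection in `S` within `D` only depends on edges inside `D`. -/
lemma conn_congr {S T : Set Edge} {D : Set Vert}
    (h : ∀ e : Edge, e.1 ∈ D → edgeTip e ∈ D → e ∈ S → e ∈ T) {x y : Vert} (hc : conn S D x y) :
    conn T D x y := by
  refine hc.induct (Q := fun y => conn T D x y) conn.refl ?_
  rintro y z hy ih ⟨e, he, h1 | h1⟩ hz
  · exact ih.tail ⟨e, h e (by rw [h1.1]; exact hy.right) (by rwa [h1.2]) he, Or.inl h1⟩ hz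
  · exact ih.tail ⟨e, h e (by rwa [h1.1]) (by rw [h1.2]; exact hy.right) he, Or.inr h1⟩ hz

/-- Edges with both endpoints in `D`. -/
def edgesIn (D : Finset Vert) : Finset Edge :=
  (D ×ˢ (Finset.univ : Finset Bool)).filter fun e => edgeTip e ∈ D

lemma mem_edgesIn {D : Finset Vert} {e : Edge} : e ∈ edgesIn D ↔ e.1 ∈ D ∧ edgeTip e ∈ D := by
  simp [edgesIn]

lemma localTo_conn (D : Finset Vert) (x y : Vert) :
    LocalTo (edgesIn D) {S | conn S (D : Set Vert) x y} := by
  intro S T h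
  constructor
  · exact fun hc => conn_congr (fun e h1 h2 he => (h e (mem_edgesIn.2 ⟨h1, h2⟩)).1 he) hc
  · exact fun hc => conn_congr (fun e h1 h2 he => (h e (mem_edgesIn.2 ⟨h1, h2⟩)).2 he) hc

lemma localTo_connS (D : Finset Vert) (X Y : Set Vert) :
    LocalTo (edgesIn D) {S | connS S (D : Set Vert) X Y} := by
  intro S T h
  exact exists_congr fun x => and_congr Iff.rfl <| exists_congr fun y => and_congr Iff.rfl <|
    localTo_conn D x y S T h

lemma isLoc_connS (D : Finset Vert) (X Y : Set Vert) :
    IsLoc {S | connS S (D : Set Vert) X Y} := ⟨_, localTo_connS D X Y⟩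

lemma isLoc_conn (D : Finset Vert) (x y : Vert) :
    IsLoc {S | conn S (D : Set Vert) x y} := ⟨_, localTo_conn D x y⟩

lemma connS.mono {S T D D' X X' Y Y'} (h : connS S D X Y) (hS : S ⊆ T) (hD : D ⊆ D')
    (hX : X ⊆ X') (hY : Y ⊆ Y') : connS T D' X' Y' := by
  obtain ⟨x, hx, y, hy, h⟩ := h
  exact ⟨x, hX hx, y, hY hy, h.mono hS hD⟩

lemma connS.symm {S D X Y} (h : connS S D X Y) : connS S D Y X := by
  obtain ⟨x, hx, y, hy, h⟩ := h
  exact ⟨y, hy, x, hx, h.symm⟩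

lemma upper_connS (D X Y : Set Vert) : IsUpperSet {S | connS S D X Y} :=
  fun _ _ hST h => connS.mono h hST subset_rfl subset_rfl subset_rfl

lemma upper_conn (D : Set Vert) (x y : Vert) : IsUpperSet {S | conn S D x y} :=
  fun _ _ hST h => conn.mono h hST subset_rfl

/-- A path either stays in `D` or exits `D`. -/
lemma conn_exit {S : Set Edge} {D' D : Set Vert} {u z : Vert} (h : conn S D' u z) (hu : u ∈ D) :
    conn S (D' ∩ D) u z ∨
      ∃ w w', conn S (D' ∩ D) u w ∧ adj S w w' ∧ w' ∈ D' ∧ w' ∉ D := by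
  refine h.induct (Q := fun z => conn S (D' ∩ D) u z ∨
      ∃ w w', conn S (D' ∩ D) u w ∧ adj S w w' ∧ w' ∈ D' ∧ w' ∉ D) ?_ ?_
  · exact fun h => Or.inl (conn.refl ⟨h, hu⟩)
  · rintro y z hy (ih | ih) ha hz
    · by_cases hzD : z ∈ D
      · exact Or.inl (ih.tail ha ⟨hz, hzD⟩)
      · exact Or.inr ⟨y, z, ih, ha, hz, hzD⟩
    · exact Or.inr ih

/-- Rectangles. -/
noncomputable def rect (a b c d : ℤ) : Finset Vert := Finset.Icc a b ×ˢ Finset.Icc c d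

lemma mem_rect {a b c d : ℤ} {v : Vert} :
    v ∈ rect a b c d ↔ a ≤ v.1 ∧ v.1 ≤ b ∧ c ≤ v.2 ∧ v.2 ≤ d := by
  simp [rect, and_assoc]

/-- Box with center `o` and radius `n`. -/
noncomputable def bx (o : Vert) (n : ℤ) : Finset Vert := rect (o.1 - n) (o.1 + n) (o.2 - n) (o.2 + n)

lemma mem_bx {o v : Vert} {n : ℤ} :
    v ∈ bx o n ↔ o.1 - n ≤ v.1 ∧ v.1 ≤ o.1 + n ∧ o.2 - n ≤ v.2 ∧ v.2 ≤ o.2 + n := mem_rect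

/-- Inner boundary of the box. -/
def bd (o : Vert) (n : ℤ) : Set Vert :=
  {v | v ∈ bx o n ∧ (v.1 = o.1 - n ∨ v.1 = o.1 + n ∨ v.2 = o.2 - n ∨ v.2 = o.2 + n)}

lemma mem_bd {o v : Vert} {n : ℤ} :
    v ∈ bd o n ↔ v ∈ bx o n ∧ (v.1 = o.1 - n ∨ v.1 = o.1 + n ∨ v.2 = o.2 - n ∨ v.2 = o.2 + n) :=
  Iff.rfl

/-- A connection from inside a box to a point which is not strictly inside gives a connection
within the box to the boundary of the box. -/
lemma conn_exit_bx {S : Set Edge} {D : Set Vert} {u z o : Vert} {n : ℤ} (h : conn S D u z)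
    (hu : u ∈ bx o n) (hz : z ∈ bx o n → z ∈ bd o n) :
    ∃ w ∈ bd o n, conn S (D ∩ bx o n) u w := by
  rcases conn_exit h (D := (bx o n : Set Vert)) (by simpa using hu) with h | ⟨w, w', h, ha, _, hw⟩
  · exact ⟨z, hz h.right.2, h⟩
  · refine ⟨w, ?_, h⟩
    have hw1 : w ∈ bx o n := h.right.2
    refine ⟨hw1, ?_⟩
    have := adj_close ha
    rw [Finset.mem_coe, mem_bx] at hw
    rw [mem_bx] at hw1
    omega

/-- Lattice automorphisms acting on vertices and edges. -/
structure Aut where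
  /-- action on vertices -/
  τ : Vert ≃ Vert
  /-- action on edges -/
  σ : Edge ≃ Edge
  h : ∀ e, ((σ e).1 = τ e.1 ∧ edgeTip (σ e) = τ (edgeTip e)) ∨
    ((σ e).1 = τ (edgeTip e) ∧ edgeTip (σ e) = τ e.1)

/-- Inverse automorphism. -/
def Aut.symm (a : Aut) : Aut where
  τ := a.τ.symm
  σ := a.σ.symm
  h := by
    intro e
    obtain ⟨e, rfl⟩ := a.σ.surjective e
    rcases a.h e with ⟨h1, h2⟩ | ⟨h1, h2⟩ <;> rw [h1, h2] <;> simp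

lemma Aut.adj (a : Aut) {S : Set Edge} {x y : Vert} (h : adj S x y) :
    adj (a.σ '' S) (a.τ x) (a.τ y) := by
  obtain ⟨e, he, h⟩ := h
  refine ⟨a.σ e, mem_image_of_mem _ he, ?_⟩
  rcases a.h e with ⟨h1, h2⟩ | ⟨h1, h2⟩ <;> rw [h1, h2] <;>
    rcases h with ⟨rfl, rfl⟩ | ⟨rfl, rfl⟩ <;> simp

lemma Aut.conn (a : Aut) {S : Set Edge} {D D' : Set Vert} (hD : ∀ v ∈ D, a.τ v ∈ D')
    {x y : Vert} (h : conn S D x y) : conn (a.σ '' S) D' (a.τ x) (a.τ y) := by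
  refine h.induct (Q := fun y => Perc.conn (a.σ '' S) D' (a.τ x) (a.τ y)) ?_ ?_
  · exact fun hx => conn.refl (hD _ hx)
  · intro y z _ ih h hz
    exact ih.tail (a.adj h) (hD _ hz)

lemma Aut.connS (a : Aut) {S : Set Edge} {D D' X X' Y Y' : Set Vert} (hD : ∀ v ∈ D, a.τ v ∈ D')
    (hX : ∀ v ∈ X, a.τ v ∈ X') (hY : ∀ v ∈ Y, a.τ v ∈ Y') (h : connS S D X Y) :
    connS (a.σ '' S) D' X' Y' := by
  obtain ⟨x, hx, y, hy, h⟩ := h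
  exact ⟨_, hX x hx, _, hY y hy, a.conn hD h⟩

lemma Aut.connS_iff (a : Aut) {S : Set Edge} {D D' X X' Y Y' : Set Vert}
    (hD : ∀ v, v ∈ D ↔ a.τ v ∈ D')
    (hX : ∀ v, v ∈ X ↔ a.τ v ∈ X') (hY : ∀ v, v ∈ Y ↔ a.τ v ∈ Y') :
    Perc.connS (a.σ '' S) D' X' Y' ↔ Perc.connS S D X Y := by
  constructor
  · intro h
    have := a.symm.connS (D' := D) (X' := X) (Y' := Y) ?_ ?_ ?_ h
    · rwa [show a.symm.σ '' (a.σ '' S) = S from by simp [Aut.symm]] at this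
    · intro v hv; rw [hD]; simpa [Aut.symm] using hv
    · intro v hv; rw [hX]; simpa [Aut.symm] using hv
    · intro v hv; rw [hY]; simpa [Aut.symm] using hv
  · exact a.connS (fun v => (hD v).1) (fun v => (hX v).1) (fun v => (hY v).1)

lemma Aut.Pr_connS (a : Aut) {p : ℝ} {D D' : Finset Vert} {X X' Y Y' : Set Vert}
    (hD : ∀ v, v ∈ D ↔ a.τ v ∈ D')
    (hX : ∀ v, v ∈ X ↔ a.τ v ∈ X') (hY : ∀ v, v ∈ Y ↔ a.τ v ∈ Y') :
    Pr p {S | Perc.connS S (D' : Set Vert) X' Y'} = Pr p {S | Perc.connS S (D : Set Vert) X Y} := by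
  rw [← Pr_image a.σ (isLoc_connS D' X' Y')]
  congr 1
  ext S
  exact a.connS_iff (by simpa using hD) hX hY

/-- Translation. -/
def transl (t : Vert) : Aut where
  τ := Equiv.addRight t
  σ := (Equiv.addRight t).prodCongr (Equiv.refl _)
  h := by
    rintro ⟨v, b⟩
    left
    simp [edgeTip, add_right_comm]

lemma transl_τ (t v : Vert) : (transl t).τ v = v + t := rfl

/-- Rotation by 90 degrees. -/
def rot : Aut where
  τ := ⟨fun v => (-v.2, v.1), fun v => (v.2, -v.1), fun v => by simp, fun v => by simp⟩
  σ := ⟨fun e => if e.2 then ((-e.1.2 - 1, e.1.1), false) else ((-e.1.2, e.1.1), true),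
    fun e => if e.2 then ((e.1.2, -e.1.1), false) else ((e.1.2, -e.1.1 - 1), true),
    fun ⟨v, b⟩ => by cases b <;> simp,
    fun ⟨v, b⟩ => by cases b <;> simp⟩
  h := by
    rintro ⟨v, b⟩
    cases b
    · left; simp [tip_false, tip_true]
    · right; simp [tip_false, tip_true]; ring

lemma rot_τ (v : Vert) : rot.τ v = (-v.2, v.1) := rfl

end Perc

open MeasureTheory Set Filter

namespace Perc

/-- The primal edge crossed by a dual edge (faces are indexed by lower-left corners). -/
def dualE : Edge ≃ Edge where
  toFun e := if e.2 then ((e.1.1, e.1.2 + 1), false) else ((e.1.1 + 1, e.1.2), true)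
  invFun e := if e.2 then ((e.1.1 - 1, e.1.2), false) else ((e.1.1, e.1.2 - 1), true)
  left_inv := by rintro ⟨v, b⟩; cases b <;> simp
  right_inv := by rintro ⟨v, b⟩; cases b <;> simp

lemma dualE_true (v : Vert) : dualE (v, true) = ((v.1, v.2 + 1), false) := rfl
lemma dualE_false (v : Vert) : dualE (v, false) = ((v.1 + 1, v.2), true) := rfl

/-- Dual configuration. -/
def dual (S : Set Edge) : Set Edge := {e | dualE e ∉ S}

lemma mem_dual {S : Set Edge} {e : Edge} : e ∈ dual S ↔ dualE e ∉ S := Iff.rfl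

lemma dual_eq (S : Set Edge) : dual S = (dualE.symm '' S)ᶜ := by
  ext e
  rw [mem_dual, mem_compl_iff, Equiv.image_symm_eq_preimage]
  rfl

lemma isLoc_dual {A : Set (Set Edge)} (hA : IsLoc A) : IsLoc {S | dual S ∈ A} := by
  simp only [dual_eq]
  exact IsLoc.image dualE.symm hA.flip

lemma Pr_dual {p : ℝ} {A : Set (Set Edge)} (hA : IsLoc A) :
    Pr p {S | dual S ∈ A} = Pr (1 - p) A := by
  simp only [dual_eq]
  rw [← Pr_flip hA, ← Pr_image dualE.symm hA.flip]
  rfl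

/-- Left-right crossing of a rectangle. -/
def LR (S : Set Edge) (a b c d : ℤ) : Prop :=
  connS S (rect a b c d : Set Vert) {v | v.1 = a} {v | v.1 = b}

/-- Top-bottom crossing of a rectangle. -/
def TB (S : Set Edge) (a b c d : ℤ) : Prop :=
  connS S (rect a b c d : Set Vert) {v | v.2 = d} {v | v.2 = c}

lemma planar1 (w h : ℕ) (χ I : ℕ → ℕ → ℤ) (h1 : ∀ j ≤ h, χ 0 j = 1) (h2 : ∀ j ≤ h, χ w j = 0)
    (h3 : ∀ i < w, I i 0 = 0) (h4 : ∀ i < w, I i (h + 1) = 1)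
    (h5 : ∀ i < w, ∀ j ≤ h, χ i j ≠ χ (i + 1) j → I i j = I i (j + 1))
    (h6 : ∀ i, i + 1 < w → ∀ j < h, χ (i + 1) j ≠ χ (i + 1) (j + 1) →
      I i (j + 1) = I (i + 1) (j + 1)) : False := by
  have key : ∑ i ∈ Finset.range w, ∑ j ∈ Finset.range h, I i (j + 1) *
      ((χ (i + 1) j - χ i j) + (χ (i + 1) (j + 1) - χ (i + 1) j) - (χ (i + 1) (j + 1) - χ i (j + 1))
        - (χ i (j + 1) - χ i j)) = 0 := by
    refine Finset.sum_eq_zero fun i _ => Finset.sum_eq_zero fun j _ => ?_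
    ring
  set H : ℕ → ℕ → ℤ := fun i j => I i j * (χ (i + 1) j - χ i j) with hH
  set V : ℕ → ℕ → ℤ := fun i j => I i (j + 1) * (χ i (j + 1) - χ i j) with hV
  have e1 : ∀ i < w, ∀ j < h, I i (j + 1) *
      ((χ (i + 1) j - χ i j) + (χ (i + 1) (j + 1) - χ (i + 1) j) - (χ (i + 1) (j + 1) - χ i (j + 1))
        - (χ i (j + 1) - χ i j)) = (V (i + 1) j - V i j) - (H i (j + 1) - H i j) := by
    intro i hi j hj
    have a1 : I i (j + 1) * (χ (i + 1) j - χ i j) = H i j := by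
      simp only [hH]
      by_cases hc : χ i j = χ (i + 1) j
      · rw [hc]; simp
      · rw [h5 i hi j hj.le hc]
    have a2 : I i (j + 1) * (χ (i + 1) (j + 1) - χ (i + 1) j) = V (i + 1) j := by
      simp only [hV]
      by_cases hc : χ (i + 1) j = χ (i + 1) (j + 1)
      · rw [hc]; simp
      · rcases Nat.lt_or_ge (i + 1) w with hi' | hi'
        · rw [h6 i hi' j hj hc]
        · have : i + 1 = w := by omega
          exfalso; apply hc
          rw [this, h2 _ hj.le, h2 _ hj]
    have a3 : H i (j + 1) = I i (j + 1) * (χ (i + 1) (j + 1) - χ i (j + 1)) := rfl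
    have a4 : V i j = I i (j + 1) * (χ i (j + 1) - χ i j) := rfl
    rw [← a1, ← a2, a3, a4]; ring
  rw [Finset.sum_congr rfl fun i hi => Finset.sum_congr rfl fun j hj =>
    e1 i (Finset.mem_range.1 hi) j (Finset.mem_range.1 hj)] at key
  simp only [Finset.sum_sub_distrib] at key
  have e2 : ∑ i ∈ Finset.range w, ∑ j ∈ Finset.range h, V (i + 1) j -
      ∑ i ∈ Finset.range w, ∑ j ∈ Finset.range h, V i j = 0 := by
    rw [← Finset.sum_sub_distrib, Finset.sum_range_sub (fun i => ∑ j ∈ Finset.range h, V i j),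
      Finset.sum_eq_zero, Finset.sum_eq_zero, sub_zero]
    · intro j hj
      have := Finset.mem_range.1 hj
      simp only [hV]
      rw [h1 _ this, h1 _ this.le]; simp
    · intro j hj
      have := Finset.mem_range.1 hj
      simp only [hV]
      rw [h2 _ this, h2 _ this.le]; simp
  have e3 : ∑ i ∈ Finset.range w, ∑ j ∈ Finset.range h, H i (j + 1) -
      ∑ i ∈ Finset.range w, ∑ j ∈ Finset.range h, H i j = -1 := by
    rw [← Finset.sum_sub_distrib]
    have : ∀ i ∈ Finset.range w, ∑ j ∈ Finset.range h, H i (j + 1) - ∑ j ∈ Finset.range h, H i j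
        = χ (i + 1) h - χ i h := by
      intro i hi
      have hi' := Finset.mem_range.1 hi
      rw [← Finset.sum_sub_distrib, Finset.sum_range_sub (fun j => H i j)]
      simp only [hH]
      rw [h3 i hi']
      by_cases hc : χ i h = χ (i + 1) h
      · rw [hc]; simp
      · rw [h5 i hi' h le_rfl hc, h4 i hi']; ring
    rw [Finset.sum_congr rfl this, Finset.sum_range_sub (fun i => χ i h), h1 _ le_rfl, h2 _ le_rfl]
    norm_num
  linarith

open Classical in
/-- Duality, existence part. -/
lemma LR_or_TB (S : Set Edge) {a b c d : ℤ} (hab : a ≤ b) (hcd : c ≤ d) :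
    LR S a b c d ∨ TB (dual S) a (b - 1) (c - 1) d := by
  by_contra hcon
  push Not at hcon
  obtain ⟨hLR, hTB⟩ := hcon
  obtain ⟨w, hw⟩ := Int.eq_ofNat_of_zero_le (sub_nonneg.2 hab)
  obtain ⟨h, hh⟩ := Int.eq_ofNat_of_zero_le (sub_nonneg.2 hcd)
  set A : Vert → Prop := fun v => ∃ x : Vert, x.1 = a ∧ conn S (rect a b c d : Set Vert) x v
  set B : Vert → Prop := fun v => ∃ x : Vert, x.2 = d ∧
    conn (dual S) (rect a (b - 1) (c - 1) d : Set Vert) x v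
  have hA : ∀ e ∈ S, e.1 ∈ rect a b c d → edgeTip e ∈ rect a b c d → (A e.1 ↔ A (edgeTip e)) := by
    intro e he h1 h2
    constructor
    · rintro ⟨x, hx, hc⟩; exact ⟨x, hx, hc.tail (adj_edge he) (by simpa using h2)⟩
    · rintro ⟨x, hx, hc⟩; exact ⟨x, hx, hc.tail (adj_edge he).symm (by simpa using h1)⟩
  have hB : ∀ e, dualE e ∉ S → e.1 ∈ rect a (b - 1) (c - 1) d →
      edgeTip e ∈ rect a (b - 1) (c - 1) d → (B e.1 ↔ B (edgeTip e)) := by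
    intro e he h1 h2
    have he' : e ∈ dual S := he
    constructor
    · rintro ⟨x, hx, hc⟩; exact ⟨x, hx, hc.tail (adj_edge he') (by simpa using h2)⟩
    · rintro ⟨x, hx, hc⟩; exact ⟨x, hx, hc.tail (adj_edge he').symm (by simpa using h1)⟩
  have h5 : ∀ (i : ℕ), i < w → ∀ j ≤ h, ((A (a + i, c + j)) ↔ A (a + i + 1, c + j)) ∨
      (B (a + i, c - 1 + j) ↔ B (a + i, c - 1 + j + 1)) := by
    intro i hi j hj
    by_cases he : (((a + i, c + j), false) : Edge) ∈ S
    · left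
      have := hA _ he (by rw [mem_rect]; dsimp; omega)
        (by rw [tip_false, mem_rect]; dsimp; omega)
      rwa [tip_false] at this
    · right
      have := hB ((a + i, c - 1 + j), true) (by
        rw [dualE_true]; dsimp; rwa [show c - 1 + (j : ℤ) + 1 = c + j by ring])
        (by rw [mem_rect]; dsimp; omega) (by rw [tip_true, mem_rect]; dsimp; omega)
      rwa [tip_true] at this
  have h6 : ∀ (i : ℕ), i + 1 < w → ∀ j < h, ((A (a + i + 1, c + j)) ↔ A (a + i + 1, c + j + 1)) ∨
      (B (a + i, c + j) ↔ B (a + i + 1, c + j)) := by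
    intro i hi j hj
    by_cases he : (((a + i + 1, c + j), true) : Edge) ∈ S
    · left
      have := hA _ he (by rw [mem_rect]; dsimp; omega)
        (by rw [tip_true, mem_rect]; dsimp; omega)
      rwa [tip_true] at this
    · right
      have := hB ((a + i, c + j), false) (by
        rw [dualE_false]; exact he)
        (by rw [mem_rect]; dsimp; omega) (by rw [tip_false, mem_rect]; dsimp; omega)
      rwa [tip_false] at this
  refine planar1 w h (fun i j => if A (a + i, c + j) then 1 else 0)
    (fun i j => if B (a + i, c - 1 + j) then 1 else 0) ?_ ?_ ?_ ?_ ?_ ?_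
  · intro j hj
    refine if_pos ⟨(a, c + j), rfl, ?_⟩
    simp only [Nat.cast_zero, add_zero]
    exact conn.refl (by rw [Finset.mem_coe, mem_rect]; dsimp; omega)
  · intro j hj
    refine if_neg ?_
    rintro ⟨x, hx, hc⟩
    exact hLR ⟨x, hx, _, (by simp only [mem_ofPred_eq]; omega), hc⟩
  · intro i hi
    refine if_neg ?_
    rintro ⟨x, hx, hc⟩
    exact hTB ⟨x, hx, _, (by simp), hc⟩
  · intro i hi
    refine if_pos ⟨(a + i, c - 1 + (h + 1 : ℕ)), by push_cast; omega, ?_⟩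
    exact conn.refl (by rw [Finset.mem_coe, mem_rect]; dsimp; push_cast; omega)
  · intro i hi j hj hne
    rcases h5 i hi j hj with h' | h'
    · exfalso; apply hne
      push_cast; rw [← add_assoc]
      simp only [h']
    · push_cast; rw [← add_assoc]
      simp only [h']
  · intro i hi j hj hne
    rcases h6 i hi j hj with h' | h'
    · exfalso; apply hne
      push_cast; rw [← add_assoc, ← add_assoc]
      simp only [h']
    · push_cast
      rw [show c - 1 + ((j : ℤ) + 1) = c + j by ring, ← add_assoc]
      simp only [h']

/-- divergence of a flow -/
def dvg (J : Edge → ℤ) (v : Vert) : ℤ :=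
  J (v, false) + J (v, true) - J ((v.1 - 1, v.2), false) - J ((v.1, v.2 - 1), true)

open Classical in
lemma dvg_single (J : Edge → ℤ) (e : Edge) (s : ℤ) (v : Vert) :
    dvg (fun e' => J e' + if e' = e then s else 0) v =
      dvg J v + (if v = e.1 then s else 0) - (if v = edgeTip e then s else 0) := by
  obtain ⟨⟨x, y⟩, b⟩ := e
  obtain ⟨v1, v2⟩ := v
  cases b
  · simp only [dvg, tip_false, Prod.mk.injEq, and_true, Bool.true_eq_false, and_false, if_false]
    have : (v1 - 1 = x ∧ v2 = y) ↔ (v1 = x + 1 ∧ v2 = y) := by constructor <;> rintro ⟨h, h'⟩ <;> exact ⟨by omega, h'⟩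
    simp only [this]; ring
  · simp only [dvg, tip_true, Prod.mk.injEq, and_true, Bool.false_eq_true, and_false, if_false]
    have : (v1 = x ∧ v2 - 1 = y) ↔ (v1 = x ∧ v2 = y + 1) := by constructor <;> rintro ⟨h, h'⟩ <;> exact ⟨h, by omega⟩
    simp only [this]; ring

open Classical in
/-- A path carries a unit flow. -/
lemma exists_flow {S : Set Edge} {D : Set Vert} {x y : Vert} (hc : conn S D x y) :
    ∃ J : Edge → ℤ, (∀ e, J e ≠ 0 → e ∈ S ∧ e.1 ∈ D ∧ edgeTip e ∈ D) ∧
      ∀ v, dvg J v = (if v = x then 1 else 0) - (if v = y then 1 else 0) := by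
  refine hc.induct (Q := fun y => ∃ J : Edge → ℤ, (∀ e, J e ≠ 0 → e ∈ S ∧ e.1 ∈ D ∧ edgeTip e ∈ D) ∧
      ∀ v, dvg J v = (if v = x then 1 else 0) - (if v = y then 1 else 0)) ?_ ?_
  · intro _
    exact ⟨fun _ => 0, by simp, fun v => by simp [dvg]⟩
  · rintro y z hy ⟨J, h1, h2⟩ ⟨e, he, h⟩ hz
    rcases h with ⟨rfl, rfl⟩ | ⟨rfl, rfl⟩
    · refine ⟨fun e' => J e' + if e' = e then 1 else 0, ?_, ?_⟩
      · intro e' he'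
        by_cases h : e' = e
        · subst h; exact ⟨he, hy.right, hz⟩
        · exact h1 e' (by simpa [h] using he')
      · intro v; rw [dvg_single, h2]; ring
    · refine ⟨fun e' => J e' + if e' = e then -1 else 0, ?_, ?_⟩
      · intro e' he'
        by_cases h : e' = e
        · subst h; exact ⟨he, hz, hy.right⟩
        · exact h1 e' (by simpa [h] using he')
      · intro v; rw [dvg_single, h2]
        split_ifs <;> ring

/-- Duality, exclusion part. -/
lemma not_LR_and_TB {T : Set Edge} {a b c d : ℤ} (h1 : LR T a b c d)
    (h2 : TB (dual T) a (b - 1) (c - 1) d) : False := by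
  classical
  obtain ⟨x, hx, y, hy, hxy⟩ := h1
  obtain ⟨f, hf, g, hg, hfg⟩ := h2
  simp only [mem_ofPred_eq] at hx hy hf hg
  obtain ⟨J, hJ, hdiv⟩ := exists_flow hxy
  have hxr := hxy.left
  have hyr := hxy.right
  have hfr := hfg.left
  have hgr := hfg.right
  rw [Finset.mem_coe, mem_rect] at hxr hyr hfr hgr
  set W : ℤ → ℕ → ℤ := fun u k => ∑ j ∈ Finset.range k, J ((u, d - j), false) with hW
  have hWs : ∀ u k, W u (k + 1) = W u k + J ((u, d - k), false) := fun u k => by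
    simp only [hW, Finset.sum_range_succ]
  have hWB : ∀ u k, W u k - W (u - 1) k = ∑ j ∈ Finset.range k, dvg J (u, d - j)
      - J ((u, d), true) + J ((u, d - k), true) := by
    intro u k
    induction k with
    | zero => simp [hW]
    | succ k ih =>
      rw [hWs, hWs, Finset.sum_range_succ]
      have : dvg J (u, d - k) = J ((u, d - k), false) + J ((u, d - k), true)
        - J ((u - 1, d - k), false) - J ((u, d - k - 1), true) := rfl
      rw [this, show d - ((k + 1 : ℕ) : ℤ) = d - k - 1 by push_cast; ring]
      linarith
  have hJd : ∀ u, J ((u, d), true) = 0 := by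
    intro u; by_contra hne
    have := (hJ _ hne).2.2
    rw [tip_true, Finset.mem_coe, mem_rect] at this
    dsimp at this; omega
  have hJc : ∀ u, J ((u, c - 1), true) = 0 := by
    intro u; by_contra hne
    have := (hJ _ hne).2.1
    rw [Finset.mem_coe, mem_rect] at this
    dsimp at this; omega
  have hWu : ∀ u k, a < u → u < b → W u k = W (u - 1) k + J ((u, d - k), true) := by
    intro u k hu hu'
    have h := hWB u k
    rw [hJd, Finset.sum_eq_zero] at h
    · linarith
    · intro j _
      rw [hdiv, if_neg, if_neg, sub_zero]
      · rintro rfl; simp at hy; omega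
      · rintro rfl; simp at hx; omega
  obtain ⟨h, hh⟩ := Int.eq_ofNat_of_zero_le (show 0 ≤ d - c by omega)
  have hW1 : ∀ u, a ≤ u → u < b → W u (h + 1) = 1 := by
    intro u hu
    induction u, hu using Int.leInduction with
    | base =>
      intro _
      have h' := hWB a (h + 1)
      have h0 : W (a - 1) (h + 1) = 0 := by
        refine Finset.sum_eq_zero fun j _ => ?_
        by_contra hne
        have := (hJ _ hne).2.1
        rw [Finset.mem_coe, mem_rect] at this
        dsimp at this; omega
      rw [h0, hJd, show d - ((h + 1 : ℕ) : ℤ) = c - 1 by push_cast; omega, hJc] at h'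
      have : ∑ j ∈ Finset.range (h + 1), dvg J (a, d - (j : ℤ)) = 1 := by
        rw [Finset.sum_eq_single (d - x.2).toNat]
        · rw [hdiv, if_pos, if_neg, sub_zero]
          · rintro rfl; simp at hy; omega
          · refine Prod.ext ?_ ?_
            · exact hx.symm
            · dsimp; omega
        · intro j hj hne
          rw [hdiv, if_neg, if_neg, sub_zero]
          · rintro rfl; simp at hy; omega
          · intro heq
            apply hne
            rw [← heq]; dsimp; omega
        · intro hn
          exfalso; apply hn; rw [Finset.mem_range]; omega
      linarith
    | succ u hu ih =>
      intro hu'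
      rw [hWu (u + 1) (h + 1) (by omega) hu', show d - ((h + 1 : ℕ) : ℤ) = c - 1 by push_cast; omega,
        hJc, add_sub_cancel_right, ih (by omega), add_zero]
  have hfin : W g.1 (d - g.2).toNat = 0 := by
    refine hfg.induct (Q := fun g => W g.1 (d - g.2).toNat = 0) ?_ ?_
    · intro _
      rw [hf]; simp [hW]
    · intro u v hu ih hadj hv
      have hur := hu.right
      rw [Finset.mem_coe, mem_rect] at hur hv
      have key : ∀ u v : Vert, (u, false) ∈ dual T → v = (u.1 + 1, u.2) → v.1 ≤ b - 1 → a ≤ u.1 →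
          u.2 ≤ d → W u.1 (d - u.2).toNat = W v.1 (d - v.2).toNat := by
        rintro ⟨u1, u2⟩ v hu rfl h1 h2 h3
        simp only at h1 h2 h3 ⊢
        rw [hWu (u1 + 1) _ (by omega) (by omega), add_sub_cancel_right]
        rw [show d - ((d - u2).toNat : ℤ) = u2 by omega]
        have : J ((u1 + 1, u2), true) = 0 := by
          by_contra hne
          exact hu (hJ _ hne).1
        rw [this, add_zero]
      have key2 : ∀ u v : Vert, (u, true) ∈ dual T → v = (u.1, u.2 + 1) →
          u.2 + 1 ≤ d → W u.1 (d - u.2).toNat = W v.1 (d - v.2).toNat := by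
        rintro ⟨u1, u2⟩ v hu rfl h3
        simp only at h3 ⊢
        rw [show (d - u2).toNat = (d - (u2 + 1)).toNat + 1 by omega, hWs]
        rw [show d - ((d - (u2 + 1)).toNat : ℤ) = u2 + 1 by omega]
        have : J ((u1, u2 + 1), false) = 0 := by
          by_contra hne
          exact hu (hJ _ hne).1
        rw [this, add_zero]
      rcases adj_cases hadj with ⟨h, h'⟩ | ⟨h, h'⟩ | ⟨h, h'⟩ | ⟨h, h'⟩
      · rw [← key u v h h' hv.2.1 hur.1 hur.2.2.2, ih]
      · rw [key v u h h' hur.2.1 hv.1 hv.2.2.2, ih]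
      · rw [← key2 u v h h' (by rw [h'] at hv; exact hv.2.2.2), ih]
      · rw [key2 v u h h' (by rw [h'] at hur; exact hur.2.2.2), ih]
  rw [show (d - g.2).toNat = h + 1 by omega, hW1 _ hgr.1 (by omega)] at hfin
  exact one_ne_zero hfin

/-- A left-right chain `Q` in a rectangle meets every chain in the vertical column strip going
from below to above the rectangle. -/
lemma cross_meet {Q Z : Set Vert} {a b c d : ℤ} {x y u w : Vert} (hab : a < b) (hcd : c ≤ d)
    (hQ : Q ⊆ (rect a b c d : Set Vert)) (hxy : conn univ Q x y) (hx : x.1 = a) (hy : y.1 = b)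
    (hZ : ∀ v ∈ Z, a ≤ v.1 ∧ v.1 ≤ b) (huw : conn univ Z u w) (hu : u.2 ≤ c) (hw : d ≤ w.2) :
    ∃ v, v ∈ Q ∧ v ∈ Z := by
  by_contra hcon
  push Not at hcon
  have hcon' : ∀ v ∈ Z, v ∉ Q := fun v hv h => hcon v h hv
  set T : Set Edge := {e | e.1 ∈ Q ∧ edgeTip e ∈ Q} with hT
  have hLR : LR T a b c d := by
    refine ⟨x, hx, y, hy, ?_⟩
    exact (conn_congr (fun e h1 h2 _ => (⟨h1, h2⟩ : e ∈ T)) hxy).mono subset_rfl hQ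
  have hQr : ∀ v ∈ Q, a ≤ v.1 ∧ v.1 ≤ b ∧ c ≤ v.2 ∧ v.2 ≤ d := fun v hv => by
    have := hQ hv; rwa [Finset.mem_coe, mem_rect] at this
  refine not_LR_and_TB hLR ?_
  set m : Vert → Vert := fun v => (min v.1 (b - 1), max (c - 1) (min v.2 d)) with hm
  have hmr : ∀ v ∈ Z, m v ∈ (rect a (b - 1) (c - 1) d : Set Vert) := by
    intro v hv
    have := hZ v hv
    rw [Finset.mem_coe, mem_rect]; simp only [hm]; omega
  -- steps
  have keyh : ∀ v v' : Vert, v ∈ Z → v' ∈ Z → v' = (v.1 + 1, v.2) →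
      conn (dual T) (rect a (b - 1) (c - 1) d : Set Vert) (m v) (m v') := by
    intro v v' hv hv' h
    have g1 : v'.1 = _ := congrArg Prod.fst h
    have g2 : v'.2 = _ := congrArg Prod.snd h
    simp only at g1 g2
    by_cases hb : v.1 + 1 = b
    · have : m v' = m v := by
        simp only [hm]; refine Prod.ext ?_ ?_ <;> simp only <;> omega
      rw [this]; exact conn.refl (hmr v hv)
    · have h1 := hZ v hv
      have h2 := hZ v' hv'
      have h3 : v'.1 = v.1 + 1 := by rw [h]
      have : m v' = ((m v).1 + 1, (m v).2) := by
        simp only [hm]; refine Prod.ext ?_ ?_ <;> simp only <;> omega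
      refine conn_adj ⟨(m v, false), ?_, Or.inl ⟨rfl, ?_⟩⟩ (hmr v hv) (hmr v' hv')
      · rw [mem_dual, dualE_false, ← this]
        rintro ⟨hq1, hq2⟩
        rw [tip_true] at hq2
        have k1 := hQr _ hq1
        have k2 := hQr _ hq2
        have : m v' = v' := by
          simp only [hm] at k1 k2 ⊢
          refine Prod.ext ?_ ?_ <;> dsimp at k1 k2 ⊢ <;> omega
        dsimp only at hq1
        rw [this] at hq1
        exact hcon' v' hv' hq1
      · rw [tip_false, this]
  have keyv : ∀ v v' : Vert, v ∈ Z → v' ∈ Z → v' = (v.1, v.2 + 1) →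
      conn (dual T) (rect a (b - 1) (c - 1) d : Set Vert) (m v) (m v') := by
    intro v v' hv hv' h
    have g1 : v'.1 = _ := congrArg Prod.fst h
    have g2 : v'.2 = _ := congrArg Prod.snd h
    simp only at g1 g2
    by_cases hb : v.2 + 1 ≤ c - 1 ∨ d ≤ v.2
    · have : m v' = m v := by
        simp only [hm]; refine Prod.ext ?_ ?_ <;> simp only <;> omega
      rw [this]; exact conn.refl (hmr v hv)
    · have h1 := hZ v hv
      have h2 := hZ v' hv'
      have h3 : v'.2 = v.2 + 1 := by rw [h]
      have h4 : v'.1 = v.1 := by rw [h]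
      have : m v' = ((m v).1, (m v).2 + 1) := by
        simp only [hm]; refine Prod.ext ?_ ?_ <;> simp only <;> omega
      refine conn_adj ⟨(m v, true), ?_, Or.inl ⟨rfl, ?_⟩⟩ (hmr v hv) (hmr v' hv')
      · rw [mem_dual, dualE_true, ← this]
        rintro ⟨hq1, hq2⟩
        rw [tip_false] at hq2
        dsimp only at hq1 hq2
        by_cases hbb : v.1 = b
        · have : ((m v').1 + 1, (m v').2) = v' := by
            simp only [hm]
            refine Prod.ext ?_ ?_ <;> dsimp <;> omega
          rw [this] at hq2
          exact hcon' v' hv' hq2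
        · have : m v' = v' := by
            simp only [hm]
            refine Prod.ext ?_ ?_ <;> dsimp <;> omega
          rw [this] at hq1
          exact hcon' v' hv' hq1
      · rw [tip_true, this]
  have hmain : conn (dual T) (rect a (b - 1) (c - 1) d : Set Vert) (m u) (m w) := by
    refine huw.induct (Q := fun w => conn (dual T) (rect a (b - 1) (c - 1) d : Set Vert) (m u) (m w))
      ?_ ?_
    · exact fun h => conn.refl (hmr u h)
    · intro v v' hv ih hadj hv'
      rcases adj_cases hadj with ⟨_, h'⟩ | ⟨_, h'⟩ | ⟨_, h'⟩ | ⟨_, h'⟩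
      · exact ih.trans (keyh v v' hv.right hv' h')
      · exact ih.trans (keyh v' v hv' hv.right h').symm
      · exact ih.trans (keyv v v' hv.right hv' h')
      · exact ih.trans (keyv v' v hv' hv.right h').symm
  have huZ := huw.left
  have hu1 := hZ u huZ
  refine ⟨m w, by simp only [hm, mem_ofPred_eq]; omega, ((m u).1, c - 1), rfl, ?_⟩
  refine hmain.symm.trans ?_
  by_cases huc : u.2 = c
  · refine (conn_adj ⟨(((m u).1, c - 1), true), ?_, Or.inl ⟨rfl, ?_⟩⟩ ?_ (hmr u huZ)).symm
    · rw [mem_dual, dualE_true]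
      rintro ⟨hq1, hq2⟩
      rw [tip_false] at hq2
      dsimp only at hq1 hq2
      rw [sub_add_cancel] at hq1 hq2
      by_cases hbb : u.1 = b
      · have : ((m u).1 + 1, c) = u := by
          simp only [hm]; refine Prod.ext ?_ ?_ <;> dsimp <;> omega
        rw [this] at hq2; exact hcon' _ huZ hq2
      · have : ((m u).1, c) = u := by
          simp only [hm]; refine Prod.ext ?_ ?_ <;> dsimp <;> omega
        rw [this] at hq1; exact hcon' _ huZ hq1
    · rw [tip_true]; simp only [hm]; refine Prod.ext ?_ ?_ <;> dsimp; omega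
    · rw [Finset.mem_coe, mem_rect]; simp only [hm]; omega
  · have : m u = ((m u).1, c - 1) := by
      simp only [hm]; refine Prod.ext ?_ ?_ <;> dsimp; omega
    rw [← this]; exact conn.refl (hmr u huZ)

end Perc

open MeasureTheory Set Filter

namespace Perc

/-- Edges touching `U`. -/
def edgesTouch (U : Finset Vert) : Finset Edge :=
  U.biUnion fun v => {(v, false), (v, true), ((v.1 - 1, v.2), false), ((v.1, v.2 - 1), true)}

lemma mem_edgesTouch {U : Finset Vert} {e : Edge} :
    e ∈ edgesTouch U ↔ e.1 ∈ U ∨ edgeTip e ∈ U := by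
  simp only [edgesTouch, Finset.mem_biUnion, Finset.mem_insert, Finset.mem_singleton]
  constructor
  · rintro ⟨v, hv, rfl | rfl | rfl | rfl⟩
    · exact Or.inl hv
    · exact Or.inl hv
    · right; rw [tip_false]; simpa using hv
    · right; rw [tip_true]; simpa using hv
  · obtain ⟨v, b⟩ := e
    rintro (h | h)
    · exact ⟨v, h, by cases b <;> simp⟩
    · refine ⟨_, h, ?_⟩
      cases b
      · rw [tip_false]; simp
      · rw [tip_true]; simp

/-- Edge boundary of `U`. -/
def bdryE (U : Finset Vert) : Finset Edge :=
  (edgesTouch U).filter fun e => (e.1 ∈ U ∧ edgeTip e ∉ U) ∨ (e.1 ∉ U ∧ edgeTip e ∈ U)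

lemma mem_bdryE {U : Finset Vert} {e : Edge} :
    e ∈ bdryE U ↔ (e.1 ∈ U ∧ edgeTip e ∉ U) ∨ (e.1 ∉ U ∧ edgeTip e ∈ U) := by
  rw [bdryE, Finset.mem_filter, mem_edgesTouch]; tauto

/-- `0` is connected within `U` to an endpoint of `e`. -/
def hit (U : Finset Vert) (e : Edge) : Set (Set Edge) :=
  {S | connS S (U : Set Vert) {0} {x | x = e.1 ∨ x = edgeTip e}}

lemma hit_local (U : Finset Vert) (e : Edge) : LocalTo (edgesIn U) (hit U e) := localTo_connS _ _ _

/-- The Duminil-Copin–Tassion functional. -/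
noncomputable def phi (p : ℝ) (U : Finset Vert) : ℝ := p * ∑ e ∈ bdryE U, Pr p (hit U e)

lemma phi_mono {p q : ℝ} (h0 : 0 ≤ p) (hpq : p ≤ q) (h1 : q ≤ 1) (U : Finset Vert) :
    phi p U ≤ phi q U := by
  unfold phi
  refine mul_le_mul hpq (Finset.sum_le_sum fun e _ =>
    Pr_mono_p h0 hpq h1 (isLoc_connS _ _ _) (upper_connS _ _ _)) ?_ (h0.trans hpq)
  exact Finset.sum_nonneg fun e _ => Pr_nonneg h0 (hpq.trans h1) _

/-- One-arm event. -/
def arm (o : Vert) (n : ℤ) : Set (Set Edge) := {S | connS S (bx o n : Set Vert) {o} (bd o n)}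

open Classical in
/-- The set of points not connected to the boundary of the box. -/
noncomputable def nonconn (n : ℤ) (S : Set Edge) : Finset Vert :=
  (bx 0 n).filter fun z => ¬ connS S (bx 0 n : Set Vert) {z} (bd 0 n)

lemma mem_nonconn {n : ℤ} {S : Set Edge} {z : Vert} :
    z ∈ nonconn n S ↔ z ∈ bx 0 n ∧ ¬ connS S (bx 0 n : Set Vert) {z} (bd 0 n) := by
  simp [nonconn]

lemma nonconn_local_aux {n : ℤ} {S T : Set Edge} {U : Finset Vert}
    (h : ∀ e ∈ edgesIn (bx 0 n) \ edgesIn U, e ∈ S ↔ e ∈ T) (hS : nonconn n S = U) :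
    nonconn n T = U := by
  have hU : ∀ z, z ∈ U ↔ z ∈ bx 0 n ∧ ¬ connS S (bx 0 n : Set Vert) {z} (bd 0 n) := by
    intro z; rw [← hS, mem_nonconn]
  ext z
  rw [mem_nonconn]
  constructor
  · rintro ⟨hz, hn⟩
    by_contra hzU
    rw [hU] at hzU
    push Not at hzU
    obtain ⟨z', rfl, w, hw, hc⟩ := hzU hz
    apply hn
    refine ⟨z', rfl, w, hw, ?_⟩
    have : conn S ((bx 0 n : Set Vert) \ U) z' w := by
      have hc' := hc.symm
      refine conn.symm ?_
      refine hc'.induct (Q := fun y => conn S ((bx 0 n : Set Vert) \ U) w y) ?_ ?_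
      · intro hw'
        refine conn.refl ⟨hw', ?_⟩
        intro hwU
        exact ((hU w).1 hwU).2 ⟨w, rfl, w, hw, conn.refl hw'⟩
      · intro y y' hy ih hadj hy'
        refine ih.tail hadj ⟨hy', ?_⟩
        intro hyU
        exact ((hU _).1 hyU).2 ⟨_, rfl, w, hw, (hy.tail hadj hy').symm⟩
    refine (conn_congr ?_ this).mono subset_rfl diff_subset
    intro e he1 he2 he
    refine (h e ?_).1 he
    rw [Finset.mem_sdiff, mem_edgesIn, mem_edgesIn]
    exact ⟨⟨he1.1, he2.1⟩, fun h => he1.2 h.1⟩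
  · intro hz
    refine ⟨((hU z).1 hz).1, ?_⟩
    rintro ⟨z', rfl, w, hw, hc⟩
    rcases conn_exit hc (D := (U : Set Vert)) (by simpa using hz) with hc | ⟨w1, w2, hc, hadj, h1, h2⟩
    · have hwU := hc.right.2
      exact ((hU w).1 hwU).2 ⟨w, rfl, w, hw, conn.refl hc.right.1⟩
    · have hw1 := hc.right
      have h2' : w2 ∉ U := h2
      rw [hU] at h2'
      push Not at h2'
      obtain ⟨_, rfl, w', hw', hc'⟩ := h2' h1
      refine ((hU w1).1 hw1.2).2 ⟨w1, rfl, w', hw', ?_⟩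
      refine (conn_adj ?_ hw1.1 h1).trans hc'
      obtain ⟨e, he, hh⟩ := hadj
      refine ⟨e, (h e ?_).2 he, hh⟩
      rw [Finset.mem_sdiff, mem_edgesIn, mem_edgesIn]
      rcases hh with ⟨rfl, rfl⟩ | ⟨rfl, rfl⟩
      · exact ⟨⟨hw1.1, h1⟩, fun h => h2 h.2⟩
      · exact ⟨⟨h1, hw1.1⟩, fun h => h2 h.1⟩

lemma nonconn_local (n : ℤ) (U : Finset Vert) :
    LocalTo (edgesIn (bx 0 n) \ edgesIn U) {S | nonconn n S = U} :=
  fun _ _ h => ⟨nonconn_local_aux h, nonconn_local_aux fun e he => (h e he).symm⟩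

lemma nonconn_bdry {n : ℤ} {S : Set Edge} : bdryE (nonconn n S) ⊆ edgesIn (bx 0 n) := by
  have key : ∀ x y, adj univ x y → x ∈ nonconn n S → x ∈ bx 0 n ∧ y ∈ bx 0 n := by
    intro x y hxy hx
    rw [mem_nonconn] at hx
    refine ⟨hx.1, ?_⟩
    have hxb : x ∉ bd 0 n := fun hb => hx.2 ⟨x, rfl, x, hb, conn.refl hx.1⟩
    rw [mem_bd] at hxb
    have := adj_close hxy
    have h1 := hx.1
    rw [mem_bx] at h1 ⊢
    have h2 : ¬ (x.1 = (0 : Vert).1 - n ∨ x.1 = (0 : Vert).1 + n ∨ x.2 = (0 : Vert).2 - n ∨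
      x.2 = (0 : Vert).2 + n) := fun h => hxb ⟨hx.1, h⟩
    omega
  intro e he
  rw [mem_edgesIn]
  rw [mem_bdryE] at he
  rcases he with ⟨h, _⟩ | ⟨_, h⟩
  · exact key _ _ (adj_edge (mem_univ e)) h
  · exact (key _ _ (adj_edge (mem_univ e)).symm h).symm

open Classical in
lemma dct_pointwise {n : ℤ} (hn : 0 ≤ n) (S : Set Edge) {e : Edge} (he : e ∈ edgesIn (bx 0 n)) :
    ∑ U ∈ (bx 0 n).powerset.filter (fun U => (0 : Vert) ∈ U),
      (if e ∈ bdryE U then ind {S | nonconn n S = U} S * ind (hit U e) S else 0) ≤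
    ind (arm 0 n) (insert e S) - ind (arm 0 n) (S \ {e}) := by
  have hup : IsUpperSet (arm 0 n) := upper_connS _ _ _
  have hRHS : 0 ≤ ind (arm 0 n) (insert e S) - ind (arm 0 n) (S \ {e}) := by
    have := ind_monotone hup (diff_subset.trans (subset_insert e S) : S \ {e} ⊆ insert e S)
    linarith
  by_cases hex : ∃ U ∈ (bx 0 n).powerset.filter (fun U => (0 : Vert) ∈ U),
      (if e ∈ bdryE U then ind {S | nonconn n S = U} S * ind (hit U e) S else 0) ≠ 0
  · obtain ⟨U, hU, hne⟩ := hex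
    have hb : e ∈ bdryE U := by by_contra h; simp [h] at hne
    rw [if_pos hb] at hne
    have hSU : nonconn n S = U := by
      by_contra h; exact hne (by rw [ind_of_not (by simpa using h), zero_mul])
    have hhit : S ∈ hit U e := by
      by_contra h; exact hne (by rw [ind_of_not h, mul_zero])
    rw [Finset.sum_eq_single U]
    · rw [if_pos hb, ind_of_mem (by simpa using hSU), ind_of_mem hhit]
      rw [Finset.mem_filter] at hU
      have h0 : S ∉ arm 0 n := by
        have := hU.2
        rw [← hSU, mem_nonconn] at this
        exact this.2
      have h1 : S \ {e} ∉ arm 0 n := fun h => h0 (hup diff_subset h)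
      have h2 : insert e S ∈ arm 0 n := by
        obtain ⟨_, rfl, x, hx, hc⟩ := hhit
        have hUD : ∀ z, z ∈ U → z ∈ bx 0 n := fun z hz => Finset.mem_powerset.1 hU.1 hz
        have hxU : x ∈ U := hc.right
        have main : ∀ y, adj (insert e S) x y → y ∈ bx 0 n → y ∉ U → insert e S ∈ arm 0 n := by
          intro y hadj hy hyU
          rw [← hSU, mem_nonconn] at hyU
          push Not at hyU
          obtain ⟨_, rfl, w, hw, hc'⟩ := hyU hy
          refine ⟨0, rfl, w, hw, ?_⟩
          exact ((hc.mono (subset_insert _ _) hUD).tail hadj hy).trans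
            (hc'.mono (subset_insert _ _) subset_rfl)
        rw [mem_edgesIn] at he
        rw [mem_bdryE] at hb
        have hae := adj_edge (mem_insert e S)
        rcases hx with rfl | rfl
        · refine main _ hae he.2 ?_
          tauto
        · refine main _ hae.symm he.1 ?_
          tauto
      rw [ind_of_mem h2, ind_of_not h1]; norm_num
    · intro V _ hV
      have : ¬ nonconn n S = V := by rw [hSU]; exact hV.symm
      rw [ind_of_not (A := {S | nonconn n S = V}) (by simpa using this)]; simp
    · intro h; exact absurd hU h
  · push Not at hex
    rw [Finset.sum_eq_zero hex]
    exact hRHS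

lemma arm_isLoc (o : Vert) (n : ℤ) : LocalTo (edgesIn (bx o n)) (arm o n) := localTo_connS _ _ _

lemma isLoc_nonconn (n : ℤ) (U : Finset Vert) : IsLoc {S | nonconn n S = U} :=
  ⟨_, nonconn_local n U⟩

open Classical in
lemma dct_deriv {n : ℤ} (hn : 0 ≤ n) {p : ℝ} (h0 : 0 < p) (h1 : p ≤ 1)
    (hphi : ∀ U : Finset Vert, (0 : Vert) ∈ U → 1 ≤ phi p U) :
    1 - Pr p (arm 0 n) ≤ ∑ e ∈ edgesIn (bx 0 n), E p (edgesIn (bx 0 n))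
      (fun S => ind (arm 0 n) (insert e S) - ind (arm 0 n) (S \ {e})) := by
  set F := edgesIn (bx 0 n) with hF
  set Q := (bx 0 n).powerset.filter (fun U => (0 : Vert) ∈ U) with hQ
  have s1 : ∑ e ∈ F, E p F (fun S => ∑ U ∈ Q,
      (if e ∈ bdryE U then ind {S | nonconn n S = U} S * ind (hit U e) S else 0)) ≤
      ∑ e ∈ F, E p F (fun S => ind (arm 0 n) (insert e S) - ind (arm 0 n) (S \ {e})) :=
    Finset.sum_le_sum fun e he => E_mono h0.le h1 fun S _ => dct_pointwise hn S he
  refine le_trans ?_ s1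
  have s2 : ∀ U ∈ Q, Pr p {S | nonconn n S = U} ≤
      ∑ e ∈ F, E p F (fun S =>
      (if e ∈ bdryE U then ind {S | nonconn n S = U} S * ind (hit U e) S else 0)) := by
    intro U hU
    rw [hQ, Finset.mem_filter, Finset.mem_powerset] at hU
    have hUF : edgesIn U ⊆ F := fun e he => by
      rw [mem_edgesIn] at he; rw [hF, mem_edgesIn]; exact ⟨hU.1 he.1, hU.1 he.2⟩
    have t1 : ∀ e ∈ F, E p F (fun S =>
      (if e ∈ bdryE U then ind {S | nonconn n S = U} S * ind (hit U e) S else 0)) =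
      if e ∈ bdryE U then Pr p {S | nonconn n S = U} * Pr p (hit U e) else 0 := by
      intro e _
      split_ifs
      · rw [Pr_eq (nonconn_local n U), Pr_eq (hit_local U e),
          ← E_indep Finset.sdiff_disjoint Finset.sdiff_subset hUF
          (nonconn_local n U).ind_inter (hit_local U e).ind_inter]
      · exact E_const _ _ _
    rw [Finset.sum_congr rfl t1]
    by_cases hz : ∃ S, nonconn n S = U
    · obtain ⟨S, rfl⟩ := hz
      rw [← Finset.sum_filter]
      have : F.filter (fun e => e ∈ bdryE (nonconn n S)) = bdryE (nonconn n S) := by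
        rw [Finset.filter_mem_eq_inter]
        exact Finset.inter_eq_right.2 nonconn_bdry
      rw [this, ← Finset.mul_sum]
      have hp := hphi _ hU.2
      unfold phi at hp
      have : 1 ≤ ∑ e ∈ bdryE (nonconn n S), Pr p (hit (nonconn n S) e) := by
        refine hp.trans (mul_le_of_le_one_left ?_ h1)
        exact Finset.sum_nonneg fun e _ => Pr_nonneg h0.le h1 _
      exact le_mul_of_one_le_right (Pr_nonneg h0.le h1 _) this
    · have : {S | nonconn n S = U} = ∅ := by
        ext S; simp only [mem_ofPred_eq, mem_empty_iff_false, iff_false]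
        exact fun h => hz ⟨S, h⟩
      rw [this]
      have : Pr p (∅ : Set (Set Edge)) = 0 := by
        rw [Pr_eq (F := ∅) (fun _ _ _ => Iff.rfl), E_empty, ind_of_not (by simp)]
      simp [this]
  have s3 : 1 - Pr p (arm 0 n) ≤ ∑ U ∈ Q, Pr p {S | nonconn n S = U} := by
    rw [← Pr_compl ⟨_, arm_isLoc 0 n⟩]
    refine le_trans ?_ (Pr_biUnion_le h0.le h1 Q fun U _ => isLoc_nonconn n U)
    refine Pr_mono h0.le h1 (IsLoc.biUnion fun U _ => isLoc_nonconn n U) ?_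
    intro S hS
    simp only [mem_iUnion]
    refine ⟨nonconn n S, ?_, rfl⟩
    rw [hQ, Finset.mem_filter, Finset.mem_powerset]
    refine ⟨Finset.filter_subset _ _, mem_nonconn.2 ⟨?_, hS⟩⟩
    rw [mem_bx]; simp; omega
  refine s3.trans ((Finset.sum_le_sum s2).trans_eq ?_)
  rw [Finset.sum_comm]
  exact Finset.sum_congr rfl fun e _ => (E_sum _ _ _ _).symm

lemma dct1 {q q1 : ℝ} (h0 : 0 < q) (hq : q < q1) (h1 : q1 < 1)
    (hphi : ∀ U : Finset Vert, (0 : Vert) ∈ U → 1 ≤ phi q U) {n : ℤ} (hn : 0 ≤ n) :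
    (q1 - q) / 2 ≤ Pr q1 (arm 0 n) := by
  by_cases hh : 1 / 2 ≤ Pr q1 (arm 0 n)
  · linarith
  push Not at hh
  have hd : ∀ p : ℝ, HasDerivAt (fun p => Pr p (arm 0 n)) (∑ e ∈ edgesIn (bx 0 n), E p (edgesIn (bx 0 n))
      (fun S => ind (arm 0 n) (insert e S) - ind (arm 0 n) (S \ {e}))) p := by
    intro p
    have := E_hasDerivAt (edgesIn (bx 0 n)) (ind (arm 0 n)) p
    simpa only [← Pr_eq (arm_isLoc 0 n)] using this
  obtain ⟨c, hc, hc'⟩ := exists_hasDerivAt_eq_slope (fun p => Pr p (arm 0 n)) _ hq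
    (fun x _ => (hd x).continuousAt.continuousWithinAt) (fun x _ => hd x)
  have hb := dct_deriv hn (h0.trans hc.1) (hc.2.le.trans h1.le)
    (fun U hU => (hphi U hU).trans (phi_mono h0.le hc.1.le (hc.2.le.trans h1.le) U))
  rw [hc'] at hb
  have hm := Pr_mono_p (h0.trans hc.1).le hc.2.le h1.le ⟨_, arm_isLoc 0 n⟩
    (upper_connS _ _ _ : IsUpperSet (arm 0 n))
  have h3 := Pr_nonneg h0.le (by linarith : q ≤ 1) (arm 0 n)
  have h4 : 0 < q1 - q := by linarith
  have h5 : 1 / 2 ≤ (Pr q1 (arm 0 n) - Pr q (arm 0 n)) / (q1 - q) := by linarith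
  rw [le_div_iff₀ h4] at h5
  linarith

end Perc

open MeasureTheory Set Filter

namespace Perc

lemma Pr_diff {p : ℝ} {A B : Set (Set Edge)} (hA : IsLoc A) (hB : IsLoc B) (h : B ⊆ A) :
    Pr p (A \ B) = Pr p A - Pr p B := by
  obtain ⟨F, hF⟩ := hA
  obtain ⟨G, hG⟩ := hB
  have hF' := hF.mono (Finset.subset_union_left (s₂ := G))
  have hG' := hG.mono (Finset.subset_union_right (s₁ := F))
  rw [show A \ B = A ∩ Bᶜ from rfl, Pr_eq hF', Pr_eq hG', Pr_eq (hF'.inter' hG'.compl), ← E_sub]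
  refine E_congr fun S _ => ?_
  rw [ind_inter, ind_compl]
  by_cases h1 : S ∈ B
  · rw [ind_of_mem h1, ind_of_mem (h h1)]; norm_num
  · rw [ind_of_not h1]; ring

lemma isLoc_arm (o : Vert) (n : ℤ) : IsLoc (arm o n) := ⟨_, arm_isLoc o n⟩

lemma upper_arm (o : Vert) (n : ℤ) : IsUpperSet (arm o n) := upper_connS _ _ _

lemma Pr_arm (p : ℝ) (o : Vert) (n : ℤ) : Pr p (arm o n) = Pr p (arm 0 n) := by
  refine (transl o).Pr_connS ?_ ?_ ?_
  · intro v; rw [transl_τ, mem_bx, mem_bx]; simp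
    omega
  · intro v; rw [transl_τ]; simp
  · intro v; rw [transl_τ, mem_bd, mem_bd, mem_bx, mem_bx]; simp
    omega

lemma arm_anti {o : Vert} {n N : ℤ} (h0 : 0 ≤ n) (h : n ≤ N) : arm o N ⊆ arm o n := by
  rintro S ⟨x, hx, w, hw, hc⟩
  rw [mem_singleton_iff.1 hx] at hc
  obtain ⟨w', hw', hc'⟩ := conn_exit_bx (n := n) (o := o) hc (by rw [mem_bx]; omega) (by
    rw [mem_bd, mem_bx] at hw
    rw [mem_bd, mem_bx]; omega)
  exact ⟨_, rfl, w', hw', hc'.mono subset_rfl inter_subset_right⟩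

lemma bad_arms {q c ε : ℝ} (q0 : 0 < q) (q1 : q ≤ 1) (hc : 0 < c) (hε : 0 < ε)
    (harm : ∀ n : ℤ, 0 ≤ n → c ≤ Pr q (arm 0 n)) :
    ∃ m : ℤ, 0 ≤ m ∧ ∀ n : ℤ, m ≤ n →
      Pr q {S | connS S (bx 0 n : Set Vert) (bx 0 m) (bd 0 n)}ᶜ ≤ ε := by
  have hc1 : c ≤ 1 := (harm 0 le_rfl).trans (Pr_le_one q0.le q1 _)
  obtain ⟨k, hk⟩ := exists_pow_lt_of_lt_one (half_pos hε) (by linarith : 1 - c < 1)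
  have hbdd : BddBelow (range fun n : ℕ => Pr q (arm 0 (n : ℤ))) :=
    ⟨0, by rintro _ ⟨n, rfl⟩; exact Pr_nonneg q0.le q1 _⟩
  obtain ⟨_, ⟨M, rfl⟩, hM⟩ := Real.lt_sInf_add_pos (range_nonempty fun n : ℕ => Pr q (arm 0 (n : ℤ)))
    (by positivity : 0 < ε / (2 * (k + 1)))
  have hM' : ∀ n : ℤ, 0 ≤ n → Pr q (arm 0 M) - Pr q (arm 0 n) ≤ ε / (2 * (k + 1)) := by
    intro n hn
    obtain ⟨n, rfl⟩ := Int.eq_ofNat_of_zero_le hn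
    have := csInf_le hbdd (mem_range_self n)
    simp only at this hM
    linarith
  set o : ℕ → Vert := fun i => ((i : ℤ) * (2 * M + 1), 0) with ho
  have hmul : ∀ i : ℕ, i < k → (0:ℤ) ≤ i * (2 * M + 1) ∧ (i:ℤ) * (2 * M + 1) ≤ k * (2 * M + 1) := by
    intro i hi
    refine ⟨by positivity, ?_⟩
    gcongr
  set m : ℤ := k * (2 * M + 1) + M with hm
  have hm0 : 0 ≤ m := by positivity
  have hMm : (M : ℤ) ≤ m := by rw [hm]; have : (0:ℤ) ≤ k * (2 * M + 1) := by positivity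
                               omega
  refine ⟨m, hm0, fun n hn => ?_⟩
  have hsub : {S | connS S (bx 0 n : Set Vert) (bx 0 m) (bd 0 n)}ᶜ ⊆
      (⋂ i ∈ Finset.range k, (arm (o i) M)ᶜ) ∪
      ⋃ i ∈ Finset.range k, (arm (o i) M \ arm (o i) (n + m)) := by
    intro S hS
    by_contra hcon
    simp only [mem_union, mem_iInter, mem_iUnion, not_or, not_forall, not_exists,
      Finset.mem_range, mem_compl_iff, not_not, Set.mem_sdiff, not_and] at hcon
    obtain ⟨⟨i, hi, ha⟩, h2⟩ := hcon
    apply hS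
    obtain ⟨_, rfl, w, hw, hc⟩ := h2 i hi ha
    have := hmul i hi
    have h3 : (o i).1 = (i : ℤ) * (2 * M + 1) := rfl
    have h4 : (o i).2 = 0 := rfl
    obtain ⟨w', hw', hc'⟩ := conn_exit_bx (n := n) (o := 0) hc (by
        rw [mem_bx]; simp only [Prod.fst_zero, Prod.snd_zero]; omega) (by
      rw [mem_bd, mem_bx] at hw
      rw [mem_bd, mem_bx]
      simp only [Prod.fst_zero, Prod.snd_zero]; omega)
    refine ⟨o i, ?_, w', hw', hc'.mono subset_rfl inter_subset_right⟩
    rw [Finset.mem_coe, mem_bx]; simp only [Prod.fst_zero, Prod.snd_zero]; omega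
  have l1 : IsLoc (⋂ i ∈ Finset.range k, (arm (o i) M)ᶜ) := by
    have : (⋂ i ∈ Finset.range k, (arm (o i) M)ᶜ) = (⋃ i ∈ Finset.range k, (arm (o i) M))ᶜ := by
      simp
    rw [this]
    exact (IsLoc.biUnion fun i _ => isLoc_arm _ _).compl
  have l2 : ∀ i ∈ Finset.range k, IsLoc (arm (o i) M \ arm (o i) (n + m)) := fun i _ =>
    (isLoc_arm _ _).inter (isLoc_arm _ _).compl
  refine (Pr_mono q0.le q1 (l1.union (IsLoc.biUnion l2)) hsub).trans ?_
  refine (Pr_union_le q0.le q1 l1 (IsLoc.biUnion l2)).trans ?_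
  have b1 : Pr q (⋂ i ∈ Finset.range k, (arm (o i) M)ᶜ) ≤ (1 - c) ^ k := by
    rw [Pr_biInter (Finset.range k) (F := fun i => edgesIn (bx (o i) M))
      (fun i _ => (arm_isLoc (o i) M).compl)]
    · calc _ ≤ ∏ i ∈ Finset.range k, (1 - c) := by
            refine Finset.prod_le_prod (fun i _ => Pr_nonneg q0.le q1 _) fun i _ => ?_
            rw [Pr_compl (isLoc_arm _ _), Pr_arm]
            linarith [harm M (by positivity)]
        _ = _ := by simp
    · intro i _ j _ hij
      rw [Finset.disjoint_left]
      intro e he he'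
      rw [mem_edgesIn, mem_bx] at he he'
      have h3 : (o i).1 = (i : ℤ) * (2 * M + 1) := rfl
      have h4 : (o j).1 = (j : ℤ) * (2 * M + 1) := rfl
      rw [h3] at he
      rw [h4] at he'
      rcases lt_or_gt_of_ne hij with h | h
      · have : ((i:ℤ) + 1) * (2 * M + 1) ≤ j * (2 * M + 1) := by
          gcongr; omega
        have h5 : ((i:ℤ) + 1) * (2 * M + 1) = i * (2 * M + 1) + (2 * M + 1) := by ring
        omega
      · have : ((j:ℤ) + 1) * (2 * M + 1) ≤ i * (2 * M + 1) := by
          gcongr; omega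
        have h5 : ((j:ℤ) + 1) * (2 * M + 1) = j * (2 * M + 1) + (2 * M + 1) := by ring
        omega
  have b2 : Pr q (⋃ i ∈ Finset.range k, (arm (o i) M \ arm (o i) (n + m))) ≤ ε / 2 := by
    have hb : ∀ i ∈ Finset.range k, Pr q (arm (o i) M \ arm (o i) (n + m)) ≤ ε / (2 * (k + 1)) := by
      intro i _
      have hM0 : (0 : ℤ) ≤ M := by positivity
      have hMn : (M : ℤ) ≤ n + m := by omega
      have hd := Pr_diff (p := q) (isLoc_arm (o i) M) (isLoc_arm (o i) (n + m))
        (arm_anti (o := o i) hM0 hMn)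
      rw [Pr_arm q (o i), Pr_arm q (o i)] at hd
      rw [hd]
      exact hM' (n + m) (by omega)
    calc Pr q (⋃ i ∈ Finset.range k, (arm (o i) M \ arm (o i) (n + m)))
          ≤ ∑ i ∈ Finset.range k, Pr q (arm (o i) M \ arm (o i) (n + m)) :=
            Pr_biUnion_le q0.le q1 _ l2
      _ ≤ ∑ i ∈ Finset.range k, ε / (2 * (k + 1)) := Finset.sum_le_sum hb
      _ = k * (ε / (2 * (k + 1))) := by simp
      _ ≤ ε / 2 := by
          rw [mul_div_assoc', div_le_div_iff₀ (by positivity) (by norm_num)]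
          nlinarith
  linarith

lemma side_arms {q c : ℝ} (q0 : 0 < q) (q1 : q ≤ 1) (hc : 0 < c)
    (harm : ∀ n : ℤ, 0 ≤ n → c ≤ Pr q (arm 0 n)) :
    ∃ m : ℤ, 0 ≤ m ∧ ∀ n : ℤ, m ≤ n →
      Pr q {S | connS S (bx 0 n : Set Vert) (bx 0 m) {v | v.1 = -n}}ᶜ ≤ 1 / 8 ∧
      Pr q {S | connS S (bx 0 n : Set Vert) (bx 0 m) {v | v.1 = n}}ᶜ ≤ 1 / 8 := by
  obtain ⟨m, hm, h⟩ := bad_arms q0 q1 hc (by norm_num : (0:ℝ) < (1/8)^4) harm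
  refine ⟨m, hm, fun n hn => ?_⟩
  set A1 : Set (Set Edge) := {S | connS S (bx 0 n : Set Vert) (bx 0 m) {v | v.1 = -n}} with hA1
  set A2 : Set (Set Edge) := {S | connS S (bx 0 n : Set Vert) (bx 0 m) {v | v.2 = -n}} with hA2
  set A3 : Set (Set Edge) := {S | connS S (bx 0 n : Set Vert) (bx 0 m) {v | v.1 = n}} with hA3
  set A4 : Set (Set Edge) := {S | connS S (bx 0 n : Set Vert) (bx 0 m) {v | v.2 = n}} with hA4
  have l : ∀ Y : Set Vert, IsLoc {S | connS S (bx 0 n : Set Vert) (bx 0 m) Y} :=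
    fun Y => isLoc_connS _ _ _
  have u : ∀ Y : Set Vert, IsUpperSet {S | connS S (bx 0 n : Set Vert) (bx 0 m) Y} :=
    fun Y => upper_connS _ _ _
  have r1 : Pr q A2 = Pr q A1 := by
    refine rot.Pr_connS ?_ ?_ ?_
    · intro v; rw [rot_τ, mem_bx, mem_bx]; simp; omega
    · intro v; rw [rot_τ, Finset.mem_coe, Finset.mem_coe, mem_bx, mem_bx]; simp; omega
    · intro v; rw [rot_τ]; simp
  have r2 : Pr q A3 = Pr q A2 := by
    refine rot.Pr_connS ?_ ?_ ?_
    · intro v; rw [rot_τ, mem_bx, mem_bx]; simp; omega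
    · intro v; rw [rot_τ, Finset.mem_coe, Finset.mem_coe, mem_bx, mem_bx]; simp; omega
    · intro v; rw [rot_τ]; simp; omega
  have r3 : Pr q A4 = Pr q A3 := by
    refine rot.Pr_connS ?_ ?_ ?_
    · intro v; rw [rot_τ, mem_bx, mem_bx]; simp; omega
    · intro v; rw [rot_τ, Finset.mem_coe, Finset.mem_coe, mem_bx, mem_bx]; simp; omega
    · intro v; rw [rot_τ]; simp
  have c1 : Pr q A1ᶜ = 1 - Pr q A1 := Pr_compl (l _)
  have c2 : Pr q A2ᶜ = 1 - Pr q A1 := by rw [← r1]; exact Pr_compl (l _)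
  have c3 : Pr q A3ᶜ = 1 - Pr q A1 := by rw [← r1, ← r2]; exact Pr_compl (l _)
  have c4 : Pr q A4ᶜ = 1 - Pr q A1 := by rw [← r1, ← r2, ← r3]; exact Pr_compl (l _)
  have h12 := Pr_harris_compl q0.le q1 (l _) (l _) (u {v | v.1 = -n}) (u {v | v.2 = -n})
  have h34 := Pr_harris_compl q0.le q1 (l _) (l _) (u {v | v.1 = n}) (u {v | v.2 = n})
  rw [← hA1, ← hA2, c1, c2, ← compl_union] at h12
  rw [← hA3, ← hA4, c3, c4, ← compl_union] at h34
  have h1234 := Pr_harris_compl q0.le q1 ((l _).union (l _)) ((l _).union (l _))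
    ((u {v | v.1 = -n}).union (u {v | v.2 = -n})) ((u {v | v.1 = n}).union (u {v | v.2 = n}))
  rw [← hA1, ← hA2, ← hA3, ← hA4, ← compl_union (A1 ∪ A2)] at h1234
  have hle : Pr q (A1 ∪ A2 ∪ (A3 ∪ A4))ᶜ ≤ (1/8)^4 := by
    refine (Pr_mono q0.le q1 (l _).compl ?_).trans (h n hn)
    apply compl_subset_compl.2
    rintro S ⟨x, hx, y, hy, hxy⟩
    rw [mem_bd] at hy
    simp only [Prod.fst_zero, Prod.snd_zero, zero_sub, zero_add] at hy
    rcases hy.2 with h | h | h | h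
    · exact Or.inl (Or.inl ⟨x, hx, y, h, hxy⟩)
    · exact Or.inr (Or.inl ⟨x, hx, y, h, hxy⟩)
    · exact Or.inl (Or.inr ⟨x, hx, y, h, hxy⟩)
    · exact Or.inr (Or.inr ⟨x, hx, y, h, hxy⟩)
  have hpos : 0 ≤ 1 - Pr q A1 := by linarith [Pr_le_one q0.le q1 A1]
  have hfin : 1 - Pr q A1 ≤ 1 / 8 := by
    refine le_of_pow_le_pow_left₀ (n := 4) (by norm_num) (by norm_num) ?_
    calc (1 - Pr q A1) ^ 4 = ((1 - Pr q A1) * (1 - Pr q A1)) * ((1 - Pr q A1) * (1 - Pr q A1)) := by ring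
      _ ≤ Pr q (A1 ∪ A2)ᶜ * Pr q (A3 ∪ A4)ᶜ := by
        refine mul_le_mul h12 h34 (by positivity) (Pr_nonneg q0.le q1 _)
      _ ≤ _ := h1234.trans hle
  exact ⟨c1.trans_le hfin, c3.trans_le hfin⟩

end Perc

open MeasureTheory Set Filter

namespace Perc

/-- Two-arm event at `e`. -/
def twoArm (D B : Set Vert) (e : Edge) : Set (Set Edge) :=
  {S | connS (S \ {e}) D {e.1} B ∧ connS (S \ {e}) D {edgeTip e} B ∧
    ¬ connS (S \ {e}) D {e.1} {edgeTip e}}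

lemma localTo_del {F : Finset Edge} {A : Set (Set Edge)} (h : LocalTo F A) (e : Edge) :
    LocalTo F {S | S \ {e} ∈ A} := by
  intro S T hST
  refine h _ _ fun x hx => ?_
  rw [Set.mem_sdiff, Set.mem_sdiff, hST x hx]

lemma localTo_twoArm (D : Finset Vert) (B : Set Vert) (e : Edge) :
    LocalTo (edgesIn D) (twoArm D B e) :=
  (localTo_del (localTo_connS D {e.1} B) e).inter'
    ((localTo_del (localTo_connS D {edgeTip e} B) e).inter'
      (localTo_del (localTo_connS D {e.1} {edgeTip e}) e).compl)

/-- The cluster of `v` in `D`. -/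
def cl (S : Set Edge) (D : Set Vert) (v : Vert) : Set Vert := {w | conn S D v w}

/-- Number of clusters in `D` touching `B`. -/
noncomputable def ncl (S : Set Edge) (D B : Set Vert) : ℕ := (cl S D '' B).ncard

lemma ncl_le {S : Set Edge} {D B : Set Vert} (hB : B.Finite) : ncl S D B ≤ B.ncard :=
  ncard_image_le hB

lemma ncl_drop {S : Set Edge} {D B : Set Vert} (hB : B.Finite) (hBD : B ⊆ D) {e : Edge}
    (h1 : e.1 ∈ D) (h2 : edgeTip e ∈ D) :
    (ncl (insert e S) D B : ℝ) - ncl (S \ {e}) D B ≤ - ind (twoArm D B e) S := by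
  set f : Set Vert → Set Vert := fun C => {w | ∃ v ∈ C, conn (insert e S) D v w} with hf
  have hsub : S \ {e} ⊆ insert e S := diff_subset.trans (subset_insert _ _)
  have hfc : ∀ v ∈ D, f (cl (S \ {e}) D v) = cl (insert e S) D v := by
    intro v hv
    ext w
    constructor
    · rintro ⟨u, hu, huw⟩
      exact (conn.mono hu hsub subset_rfl).trans huw
    · intro h
      exact ⟨v, conn.refl hv, h⟩
  have him : cl (insert e S) D '' B = f '' (cl (S \ {e}) D '' B) := by
    rw [image_image]
    exact image_congr fun v hv => (hfc v (hBD hv)).symm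
  have hfin : (cl (S \ {e}) D '' B).Finite := hB.image _
  have hle : ncl (insert e S) D B ≤ ncl (S \ {e}) D B := by
    unfold ncl; rw [him]; exact ncard_image_le hfin
  by_cases hT : S ∈ twoArm D B e
  · rw [ind_of_mem hT]
    obtain ⟨⟨x, hx, u, hu, hxu⟩, ⟨y, hy, w, hw, hyw⟩, hn⟩ := hT
    rw [mem_singleton_iff] at hx hy
    subst hx hy
    have hne : ncl (insert e S) D B ≠ ncl (S \ {e}) D B := by
      unfold ncl
      rw [him, Ne, ncard_image_iff hfin]
      intro hinj
      have heq : f (cl (S \ {e}) D u) = f (cl (S \ {e}) D w) := by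
        rw [hfc _ (hBD hu), hfc _ (hBD hw)]
        have huw : conn (insert e S) D u w :=
          ((hxu.symm.mono hsub subset_rfl).tail (adj_edge (mem_insert e S)) h2).trans
            (hyw.mono hsub subset_rfl)
        ext z
        exact ⟨fun h => huw.symm.trans h, fun h => huw.trans h⟩
      have := hinj (mem_image_of_mem _ hu) (mem_image_of_mem _ hw) heq
      have hwu : w ∈ cl (S \ {e}) D u := by rw [this]; exact conn.refl (hBD hw)
      exact hn ⟨_, rfl, _, rfl, (hxu.trans hwu).trans hyw.symm⟩
    have : ncl (insert e S) D B + 1 ≤ ncl (S \ {e}) D B := lt_of_le_of_ne hle hne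
    have : (ncl (insert e S) D B : ℝ) + 1 ≤ ncl (S \ {e}) D B := by exact_mod_cast this
    linarith
  · rw [ind_of_not hT]
    have : (ncl (insert e S) D B : ℝ) ≤ ncl (S \ {e}) D B := by exact_mod_cast hle
    linarith

lemma twoArm_sum {q q2 : ℝ} (h0 : 0 < q) (hq : q < q2) (h1 : q2 ≤ 1) (D : Finset Vert)
    {B : Set Vert} (hB : B ⊆ D) : ∃ ξ ∈ Ioo q q2,
    ∑ e ∈ edgesIn D, Pr ξ (twoArm D B e) ≤ B.ncard / (q2 - q) := by
  have hBf : B.Finite := D.finite_toSet.subset hB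
  have hd := fun p : ℝ => E_hasDerivAt (edgesIn D) (fun S => (ncl S D B : ℝ)) p
  obtain ⟨c, hc, hc'⟩ := exists_hasDerivAt_eq_slope (fun p => E p (edgesIn D)
    (fun S => (ncl S D B : ℝ))) _ hq
    (fun x _ => (hd x).continuousAt.continuousWithinAt) (fun x _ => hd x)
  refine ⟨c, hc, ?_⟩
  have c0 : 0 ≤ c := (h0.trans hc.1).le
  have c1 : c ≤ 1 := hc.2.le.trans h1
  have k1 : ∑ e ∈ edgesIn D, E c (edgesIn D) (fun S => (ncl (insert e S) D B : ℝ) -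
      ncl (S \ {e}) D B) ≤ ∑ e ∈ edgesIn D, - Pr c (twoArm D B e) := by
    refine Finset.sum_le_sum fun e he => ?_
    rw [Pr_eq (localTo_twoArm D B e), neg_eq_neg_one_mul, ← E_smul]
    refine E_mono c0 c1 fun S _ => ?_
    rw [neg_one_mul]
    rw [mem_edgesIn] at he
    exact ncl_drop hBf hB he.1 he.2
  rw [hc', Finset.sum_neg_distrib] at k1
  have k2 : E q (edgesIn D) (fun S => (ncl S D B : ℝ)) ≤ B.ncard := by
    refine (E_mono h0.le (hq.le.trans h1) (g := fun _ => (B.ncard : ℝ)) fun S _ => ?_).trans_eq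
      (E_const _ _ _)
    exact_mod_cast ncl_le hBf
  have k3 : 0 ≤ E q2 (edgesIn D) (fun S => (ncl S D B : ℝ)) :=
    E_nonneg (h0.trans hq).le h1 fun S _ => by positivity
  have k4 : -(B.ncard / (q2 - q) : ℝ) ≤ (E q2 (edgesIn D) (fun S => (ncl S D B : ℝ)) -
      E q (edgesIn D) (fun S => (ncl S D B : ℝ))) / (q2 - q) := by
    rw [← neg_div]
    have : 0 < q2 - q := by linarith
    gcongr
    linarith
  linarith

lemma ncard_bd {n : ℤ} (hn : 0 ≤ n) : ((bd 0 n).ncard : ℝ) ≤ 4 * (2 * n + 1) := by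
  have hsub : bd 0 n ⊆ ((rect (-n) (-n) (-n) n ∪ rect n n (-n) n ∪ (rect (-n) n (-n) (-n) ∪
      rect (-n) n n n) : Finset Vert) : Set Vert) := by
    intro v hv
    rw [mem_bd, mem_bx] at hv
    simp only [Prod.fst_zero, Prod.snd_zero] at hv
    simp only [Finset.mem_coe, Finset.mem_union, mem_rect]
    omega
  have h1 := ncard_le_ncard hsub (Finset.finite_toSet _)
  rw [ncard_coe_finset] at h1
  have h2 := Finset.card_union_le (rect (-n) (-n) (-n) n ∪ rect n n (-n) n)
    (rect (-n) n (-n) (-n) ∪ rect (-n) n n n)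
  have h3 := Finset.card_union_le (rect (-n) (-n) (-n) n) (rect n n (-n) n)
  have h4 := Finset.card_union_le (rect (-n) n (-n) (-n)) (rect (-n) n n n)
  have c1 : (rect (-n) (-n) (-n) n).card = (2 * n + 1).toNat := by
    simp [rect]; congr 1; ring
  have c2 : (rect n n (-n) n).card = (2 * n + 1).toNat := by
    simp [rect]; congr 1; ring
  have c3 : (rect (-n) n (-n) (-n)).card = (2 * n + 1).toNat := by
    simp [rect]; congr 1; ring
  have c4 : (rect (-n) n n n).card = (2 * n + 1).toNat := by
    simp [rect]; congr 1; ring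
  have h5 : ((bd 0 n).ncard : ℤ) ≤ 4 * (2 * n + 1) := by omega
  exact_mod_cast h5

lemma Pr_twoArm_transl (p : ℝ) (t v : Vert) (b : Bool) (n : ℤ) :
    Pr p (twoArm (bx t n) (bd t n) (v, b)) = Pr p (twoArm (bx 0 n) (bd 0 n) (v - t, b)) := by
  rw [← Pr_image (transl t).σ ⟨_, localTo_twoArm (bx t n) (bd t n) (v, b)⟩]
  congr 1
  ext S
  have he : (transl t).σ (v - t, b) = (v, b) := by simp [transl]
  have hd : (transl t).σ '' S \ {(v, b)} = (transl t).σ '' (S \ {(v - t, b)}) := by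
    rw [image_diff (transl t).σ.injective, image_singleton, he]
  have ht : edgeTip (v - t, b) + t = edgeTip (v, b) := by
    simp only [edgeTip]; abel
  simp only [twoArm, mem_ofPred_eq, hd]
  have hD : ∀ w, w ∈ (bx 0 n : Set Vert) ↔ (transl t).τ w ∈ (bx t n : Set Vert) := by
    intro w; rw [transl_τ, Finset.mem_coe, Finset.mem_coe, mem_bx, mem_bx]; simp; omega
  have hB : ∀ w, w ∈ bd 0 n ↔ (transl t).τ w ∈ bd t n := by
    intro w; rw [transl_τ, mem_bd, mem_bd, mem_bx, mem_bx]; simp; omega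
  have h1 : ∀ w, w ∈ ({v - t} : Set Vert) ↔ (transl t).τ w ∈ ({v} : Set Vert) := by
    intro w; rw [transl_τ]; simp [eq_sub_iff_add_eq]
  have h2 : ∀ w, w ∈ ({edgeTip (v - t, b)} : Set Vert) ↔
      (transl t).τ w ∈ ({edgeTip (v, b)} : Set Vert) := by
    intro w; rw [transl_τ, ← ht]; simp
  rw [(transl t).connS_iff hD h1 hB, (transl t).connS_iff hD h2 hB, (transl t).connS_iff hD h1 h2]

lemma twoArm_mono {D B : Set Vert} {e : Edge} {t : Vert} {n : ℤ} (h1 : e.1 ∈ bx t n)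
    (h2 : edgeTip e ∈ bx t n) (hD : (bx t n : Set Vert) ⊆ D)
    (hB : ∀ z ∈ B, z ∉ bx t n) : twoArm D B e ⊆ twoArm (bx t n) (bd t n) e := by
  rintro S ⟨⟨_, hx, z, hz, hc⟩, ⟨_, hy, w, hw, hc'⟩, hn⟩
  rw [mem_singleton_iff] at hx hy
  rw [hx] at hc
  rw [hy] at hc'
  refine ⟨?_, ?_, fun h => hn (h.mono subset_rfl hD subset_rfl subset_rfl)⟩
  · obtain ⟨z', hz', h⟩ := conn_exit_bx (n := n) (o := t) hc h1 (fun h => absurd h (hB z hz))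
    exact ⟨_, rfl, z', hz', h.mono subset_rfl inter_subset_right⟩
  · obtain ⟨z', hz', h⟩ := conn_exit_bx (n := n) (o := t) hc' h2 (fun h => absurd h (hB w hw))
    exact ⟨_, rfl, z', hz', h.mono subset_rfl inter_subset_right⟩

lemma twoArm_bound {p K : ℝ} (h0 : 0 ≤ p) (h1 : p ≤ 1) {n : ℤ} (hn : 1 ≤ n)
    (hK : ∑ e ∈ edgesIn (bx 0 n), Pr p (twoArm (bx 0 n) (bd 0 n) e) ≤ K)
    {D B : Set Vert} (v : Vert) (b : Bool) (hD : (bx v (2 * n) : Set Vert) ⊆ D)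
    (hB : ∀ z ∈ B, z ∉ bx v (2 * n)) :
    (2 * n - 1 : ℝ) ^ 2 * Pr p (twoArm D B (v, b)) ≤ K := by
  refine le_trans ?_ hK
  have hcard : ((bx v (n - 1)).card : ℝ) = (2 * n - 1 : ℝ) ^ 2 := by
    have : ((bx v (n - 1)).card : ℤ) = (2 * n - 1) ^ 2 := by
      simp only [bx, rect, Finset.card_product, Int.card_Icc]
      push_cast
      rw [Int.toNat_of_nonneg (by omega), Int.toNat_of_nonneg (by omega)]; ring
    exact_mod_cast this
  have hinj : Function.Injective (fun t : Vert => ((v - t, b) : Edge)) := by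
    intro s t h
    simpa using h
  rw [← hcard, ← nsmul_eq_mul, ← Finset.sum_const]
  calc ∑ t ∈ bx v (n - 1), Pr p (twoArm D B (v, b)) ≤
      ∑ t ∈ bx v (n - 1), Pr p (twoArm (bx 0 n) (bd 0 n) (v - t, b)) := by
        refine Finset.sum_le_sum fun t ht => ?_
        rw [← Pr_twoArm_transl]
        refine Pr_mono h0 h1 ⟨_, localTo_twoArm _ _ _⟩ (twoArm_mono ?_ ?_ ?_ ?_)
        · rw [mem_bx] at *; dsimp; omega
        · cases b
          · rw [tip_false]; rw [mem_bx] at *; dsimp; omega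
          · rw [tip_true]; rw [mem_bx] at *; dsimp; omega
        · refine subset_trans ?_ hD
          intro w hw
          rw [Finset.mem_coe] at *
          rw [mem_bx] at *; omega
        · intro z hz hzt
          refine hB z hz ?_
          rw [mem_bx] at *; omega
    _ = ∑ e ∈ (bx v (n - 1)).image (fun t : Vert => ((v - t, b) : Edge)),
          Pr p (twoArm (bx 0 n) (bd 0 n) e) := by
        rw [Finset.sum_image fun _ _ _ _ h => hinj h]
    _ ≤ _ := by
        refine Finset.sum_le_sum_of_subset_of_nonneg ?_ fun _ _ _ => Pr_nonneg h0 h1 _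
        intro e he
        obtain ⟨t, ht, rfl⟩ := Finset.mem_image.1 he
        rw [mem_edgesIn]
        cases b
        · rw [tip_false]; rw [mem_bx] at *; rw [mem_bx]; dsimp; omega
        · rw [tip_true]; rw [mem_bx] at *; rw [mem_bx]; dsimp; omega

lemma pivot {S : Set Edge} {D X Y : Set Vert} {e : Edge} (h : connS (insert e S) D X Y)
    (hn : ¬ connS S D X Y) : S ∈ twoArm D (X ∪ Y) e := by
  have heS : e ∉ S := fun he => hn (by rwa [insert_eq_of_mem he] at h)
  obtain ⟨u, hu, w, hw, hc⟩ := h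
  have key := hc.induct (Q := fun z => conn S D u z ∨
    ((conn S D u e.1 ∨ conn S D u (edgeTip e)) ∧ (conn S D z e.1 ∨ conn S D z (edgeTip e))))
    (fun h => Or.inl (conn.refl h)) (by
      rintro y z _ ih ⟨f, hf, hyz⟩ hz
      rcases hf with rfl | hf
      · right
        rcases hyz with ⟨rfl, rfl⟩ | ⟨rfl, rfl⟩
        · refine ⟨?_, Or.inr (conn.refl hz)⟩
          tauto
        · refine ⟨?_, Or.inl (conn.refl hz)⟩
          tauto
      · have hadj : adj S y z := ⟨f, hf, hyz⟩
        rcases ih with ih | ⟨ih1, ih2⟩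
        · exact Or.inl (ih.tail hadj hz)
        · refine Or.inr ⟨ih1, ih2.imp ?_ ?_⟩ <;>
          · intro h
            exact (conn_adj hadj.symm hz h.left).trans h)
  have hS : S \ {e} = S := diff_singleton_eq_self heS
  simp only [twoArm, mem_ofPred_eq, hS]
  have huw : ¬ conn S D u w := fun h => hn ⟨u, hu, w, hw, h⟩
  rcases key with h | ⟨h1 | h1, h2 | h2⟩
  · exact absurd h huw
  · exact absurd (h1.trans h2.symm) huw
  · refine ⟨⟨_, rfl, u, Or.inl hu, h1.symm⟩, ⟨_, rfl, w, Or.inr hw, h2.symm⟩, ?_⟩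
    rintro ⟨_, rfl, _, rfl, h⟩
    exact huw ((h1.trans h).trans h2.symm)
  · refine ⟨⟨_, rfl, w, Or.inr hw, h2.symm⟩, ⟨_, rfl, u, Or.inl hu, h1.symm⟩, ?_⟩
    rintro ⟨_, rfl, _, rfl, h⟩
    exact huw ((h1.trans h.symm).trans h2.symm)
  · exact absurd (h1.trans h2.symm) huw

lemma exists_pivot {S : Set Edge} {D X Y : Set Vert} (V : Finset Edge) 
    (h : connS (S ∪ V) D X Y) (hn : ¬ connS S D X Y) :
    ∃ F ⊆ V, ∃ e ∈ V, S ∪ (F : Set Edge) ∈ twoArm D (X ∪ Y) e := by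
  classical
  induction V using Finset.induction_on with
  | empty => simp at h; exact absurd h hn
  | insert a V ha ih =>
    by_cases h' : connS (S ∪ V) D X Y
    · obtain ⟨F, hF, e, he, hh⟩ := ih h'
      exact ⟨F, hF.trans (Finset.subset_insert _ _), e, Finset.mem_insert_of_mem he, hh⟩
    · refine ⟨V, Finset.subset_insert _ _, a, Finset.mem_insert_self _ _, pivot ?_ h'⟩
      rwa [Finset.coe_insert, union_insert] at h

end Perc

open MeasureTheory Set Filter

namespace Perc

lemma rect_conn_h {a b c d : ℤ} {S : Set Edge} (hS : (edgesIn (rect a b c d) : Set Edge) ⊆ S) {y i j : ℤ}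
    (hy : c ≤ y) (hy' : y ≤ d) (hi : a ≤ i) (hij : i ≤ j) (hj : j ≤ b) :
    conn S (rect a b c d : Set Vert) (i, y) (j, y) := by
  induction j, hij using Int.leInduction with
  | base => exact conn.refl (by rw [Finset.mem_coe, mem_rect]; dsimp; omega)
  | succ j hij ih =>
    refine (ih (by omega)).tail (adj_h (hS ?_)) ?_
    · rw [Finset.mem_coe, mem_edgesIn, tip_false, mem_rect, mem_rect]; dsimp; omega
    · rw [Finset.mem_coe, mem_rect]; dsimp; omega

lemma rect_conn_v {a b c d : ℤ} {S : Set Edge} (hS : (edgesIn (rect a b c d) : Set Edge) ⊆ S) {x i j : ℤ}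
    (hx : a ≤ x) (hx' : x ≤ b) (hi : c ≤ i) (hij : i ≤ j) (hj : j ≤ d) :
    conn S (rect a b c d : Set Vert) (x, i) (x, j) := by
  induction j, hij using Int.leInduction with
  | base => exact conn.refl (by rw [Finset.mem_coe, mem_rect]; dsimp; omega)
  | succ j hij ih =>
    refine (ih (by omega)).tail (adj_v (hS ?_)) ?_
    · rw [Finset.mem_coe, mem_edgesIn, tip_true, mem_rect, mem_rect]; dsimp; omega
    · rw [Finset.mem_coe, mem_rect]; dsimp; omega

lemma rect_conn {a b c d : ℤ} {S : Set Edge} (hS : (edgesIn (rect a b c d) : Set Edge) ⊆ S) {u v : Vert}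
    (hu : u ∈ rect a b c d) (hv : v ∈ rect a b c d) : conn S (rect a b c d : Set Vert) u v := by
  obtain ⟨x, y⟩ := u
  obtain ⟨x', y'⟩ := v
  rw [mem_rect] at hu hv
  dsimp at hu hv
  have h1 : conn S (rect a b c d : Set Vert) (x, y) (x', y) := by
    rcases le_total x x' with h | h
    · exact rect_conn_h hS (by omega) (by omega) (by omega) h (by omega)
    · exact (rect_conn_h hS (by omega) (by omega) (by omega) h (by omega)).symm
  have h2 : conn S (rect a b c d : Set Vert) (x', y) (x', y') := by
    rcases le_total y y' with h | h
    · exact rect_conn_v hS (by omega) (by omega) (by omega) h (by omega)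
    · exact (rect_conn_v hS (by omega) (by omega) (by omega) h (by omega)).symm
  exact h1.trans h2

lemma link_bound {p δ : ℝ} (h0 : 0 < p) (h1 : p ≤ 1) {m : ℤ} (D : Finset Vert) (X Y : Set Vert)
    (hD : bx 0 (m + 1) ⊆ D)
    (hδ : ∀ e ∈ edgesIn (bx 0 (m + 1)), Pr p (twoArm D (X ∪ Y) e) ≤ δ) :
    Pr p ({S | connS S (D : Set Vert) (bx 0 m) X} ∩ {S | connS S (D : Set Vert) (bx (1, 0) m) Y} ∩
      {S | connS S (D : Set Vert) X Y}ᶜ) ≤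
    2 ^ (edgesIn (bx 0 (m + 1))).card * (edgesIn (bx 0 (m + 1))).card *
      ((p ^ (edgesIn (bx 0 (m + 1))).card)⁻¹ * δ) := by
  set V := edgesIn (bx 0 (m + 1)) with hV
  set k := V.card with hk
  have hl : ∀ e F, IsLoc {S | S ∪ ((F : Finset Edge) : Set Edge) ∈ twoArm D (X ∪ Y) e} := by
    intro e F
    refine ⟨edgesIn D, fun S T h => localTo_twoArm D (X ∪ Y) e _ _ fun x hx => ?_⟩
    rw [mem_union, mem_union, h x hx]
  have hsub : ({S | connS S (D : Set Vert) (bx 0 m) X} ∩ {S | connS S (D : Set Vert) (bx (1, 0) m) Y} ∩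
      {S | connS S (D : Set Vert) X Y}ᶜ) ⊆ ⋃ x ∈ V.powerset ×ˢ V,
        {S | S ∪ ((x.1 : Finset Edge) : Set Edge) ∈ twoArm D (X ∪ Y) x.2} := by
    rintro S ⟨⟨⟨u, hu, x, hx, hux⟩, ⟨w, hw, y, hy, hwy⟩⟩, hn⟩
    have hconn : connS (S ∪ V) (D : Set Vert) X Y := by
      refine ⟨x, hx, y, hy, ((hux.symm.mono subset_union_left subset_rfl).trans ?_).trans
        (hwy.mono subset_union_left subset_rfl)⟩
      have : conn (S ∪ V) (bx 0 (m + 1) : Set Vert) u w := by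
        refine rect_conn subset_union_right ?_ ?_
        · rw [Finset.mem_coe, mem_bx] at hu; rw [mem_rect]; dsimp at *; omega
        · rw [Finset.mem_coe, mem_bx] at hw; rw [mem_rect]; dsimp at *; omega
      exact this.mono subset_rfl hD
    obtain ⟨F, hF, e, he, hh⟩ := exists_pivot V hconn hn
    simp only [mem_iUnion]
    exact ⟨(F, e), Finset.mem_product.2 ⟨Finset.mem_powerset.2 hF, he⟩, hh⟩
  refine (Pr_mono h0.le h1 (IsLoc.biUnion fun x _ => hl x.2 x.1) hsub).trans ?_
  refine (Pr_biUnion_le h0.le h1 _ fun x _ => hl x.2 x.1).trans ?_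
  have hcard : ((V.powerset ×ˢ V).card : ℝ) = 2 ^ k * k := by
    rw [Finset.card_product, Finset.card_powerset]; push_cast; rfl
  rw [← hcard, ← nsmul_eq_mul]
  refine Finset.sum_le_card_nsmul _ _ _ ?_
  rintro ⟨F, e⟩ hx
  rw [Finset.mem_product, Finset.mem_powerset] at hx
  have hfe := Pr_fe h0.le h1 F (A := twoArm D (X ∪ Y) e) ⟨_, localTo_twoArm D (X ∪ Y) e⟩
  have hpk : p ^ k ≤ p ^ F.card := pow_le_pow_of_le_one h0.le h1 (Finset.card_le_card hx.1)
  rw [inv_mul_eq_div, le_div_iff₀ (by positivity), mul_comm]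
  refine le_trans ?_ (hδ e hx.2)
  refine le_trans ?_ hfe
  exact mul_le_mul_of_nonneg_right hpk (Pr_nonneg h0.le h1 _)

lemma isLoc_LR (a b c d : ℤ) : IsLoc {S | LR S a b c d} := isLoc_connS _ _ _
lemma isLoc_TB (a b c d : ℤ) : IsLoc {S | TB S a b c d} := isLoc_connS _ _ _
lemma upper_LR (a b c d : ℤ) : IsUpperSet {S | LR S a b c d} := upper_connS _ _ _

lemma half_LR (N : ℤ) : Pr (1 / 2) {S | LR S (-N) (N + 1) (-N) N} ≤ 1 / 2 := by
  have h1 : Pr (1 / 2) {S | TB S (-N) N (-N - 1) N} = Pr (1 / 2) {S | LR S (-N) (N + 1) (-N) N} := by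
    refine rot.symm.Pr_connS ?_ ?_ ?_
    · intro v
      have : rot.symm.τ v = (v.2, -v.1) := rfl
      rw [this, mem_rect, mem_rect]; dsimp; omega
    · intro v
      have : rot.symm.τ v = (v.2, -v.1) := rfl
      rw [this, mem_ofPred_eq, mem_ofPred_eq]; omega
    · intro v
      have : rot.symm.τ v = (v.2, -v.1) := rfl
      rw [this, mem_ofPred_eq, mem_ofPred_eq]; omega
  have h2 := Pr_dual (p := 1 / 2) (isLoc_TB (-N) N (-N - 1) N)
  rw [show (1 - 1 / 2 : ℝ) = 1 / 2 by norm_num, h1] at h2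
  have h3 : Pr (1 / 2) {S | dual S ∈ {S | TB S (-N) N (-N - 1) N}} ≤
      Pr (1 / 2) {S | LR S (-N) (N + 1) (-N) N}ᶜ := by
    refine Pr_mono (by norm_num) (by norm_num) (isLoc_LR _ _ _ _).compl ?_
    intro S hS h
    refine not_LR_and_TB h ?_
    rw [add_sub_cancel_right]
    exact hS
  rw [Pr_compl (isLoc_LR _ _ _ _)] at h3
  linarith

theorem exists_phi_lt {q : ℝ} (h0 : 0 < q) (hq : q < 1 / 2) :
    ∃ U : Finset Vert, (0 : Vert) ∈ U ∧ phi q U < 1 := by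
  by_contra hcon
  push Not at hcon
  obtain ⟨q1, hq1, hq2⟩ := exists_between hq
  have q10 : 0 < q1 := h0.trans hq1
  have q11 : q1 ≤ 1 := by linarith
  obtain ⟨m, hm, hside⟩ := side_arms (c := (q1 - q) / 2) q10 q11 (by linarith) fun n hn =>
    dct1 h0 hq1 (by linarith) hcon hn
  set V := edgesIn (bx 0 (m + 1)) with hV
  set k := V.card with hk
  set C : ℝ := 2 ^ k * k * (q1 ^ k)⁻¹ with hC
  have hC0 : 0 ≤ C := by positivity
  set g : ℝ := 1 / 2 - q1 with hg
  have hg0 : 0 < g := by linarith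
  obtain ⟨n0, hn0⟩ := exists_nat_ge (96 * C / g)
  set n : ℤ := n0 + 1 with hn
  have hn1 : 1 ≤ n := by omega
  have hnr : (n : ℝ) = n0 + 1 := by rw [hn]; push_cast; rfl
  have hn1r : (1 : ℝ) ≤ n := by exact_mod_cast hn1
  have hnC : 96 * C ≤ n * g := by
    rw [div_le_iff₀ hg0] at hn0
    rw [hnr]; nlinarith
  obtain ⟨ξ, hξ, hsum⟩ := twoArm_sum q10 hq2 (by norm_num) (bx 0 n) (B := bd 0 n)
    (fun v hv => (mem_bd.1 hv).1)
  have ξ0 : 0 < ξ := q10.trans hξ.1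
  have ξ1 : ξ ≤ 1 := by linarith [hξ.2]
  set N : ℤ := 2 * n + m + 2 with hN
  set D := rect (-N) (N + 1) (-N) N with hD
  set X : Set Vert := {v | v.1 = -N} with hX
  set Y : Set Vert := {v | v.1 = N + 1} with hY
  have hmn : m ≤ N := by omega
  obtain ⟨hs1, hs2⟩ := hside N hmn
  have hδ : ∀ e ∈ V, Pr ξ (twoArm D (X ∪ Y) e) ≤ 12 / (n * g) := by
    rintro ⟨v, b⟩ he
    rw [hV, mem_edgesIn, mem_bx] at he
    simp only [Prod.fst_zero, Prod.snd_zero] at he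
    have hb := twoArm_bound ξ0.le ξ1 hn1 hsum (D := D) (B := X ∪ Y) v b (by
      intro w hw
      rw [Finset.mem_coe] at *
      rw [mem_bx] at hw; rw [mem_rect]; omega) (by
      rintro z (hz | hz) hzb
      · rw [hX, mem_ofPred_eq] at hz; rw [mem_bx] at hzb; omega
      · rw [hY, mem_ofPred_eq] at hz; rw [mem_bx] at hzb; omega)
    have hbd := ncard_bd (by omega : 0 ≤ n)
    have hP := Pr_nonneg ξ0.le ξ1 (twoArm D (X ∪ Y) (v, b))
    rw [le_div_iff₀ hg0] at hb
    rw [le_div_iff₀ (by positivity)]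
    have h3 : (n : ℝ) ^ 2 * (Pr ξ (twoArm D (X ∪ Y) (v, b)) * g) ≤ 12 * n := by
      calc (n : ℝ) ^ 2 * (Pr ξ (twoArm D (X ∪ Y) (v, b)) * g) ≤
          (2 * (n : ℝ) - 1) ^ 2 * (Pr ξ (twoArm D (X ∪ Y) (v, b)) * g) := by
            gcongr; linarith
        _ ≤ 4 * (2 * (n : ℝ) + 1) := by linarith
        _ ≤ 12 * (n : ℝ) := by linarith
    have h4 : (n : ℝ) * (n * (Pr ξ (twoArm D (X ∪ Y) (v, b)) * g)) ≤ n * 12 := by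
      linarith
    have h5 := le_of_mul_le_mul_left h4 (by linarith)
    linarith
  have hlink := link_bound ξ0 ξ1 D X Y (by
    intro v hv; rw [mem_bx] at hv; rw [mem_rect]; dsimp at hv; omega) hδ
  have hlink' : 2 ^ V.card * V.card * ((ξ ^ V.card)⁻¹ * (12 / (n * g))) ≤ 1 / 8 := by
    have e1 : (ξ ^ V.card)⁻¹ ≤ (q1 ^ k)⁻¹ := by
      gcongr
      exact hξ.1.le
    calc _ ≤ 2 ^ k * k * ((q1 ^ k)⁻¹ * (12 / (n * g))) := by gcongr
      _ = C * 12 / (n * g) := by rw [hC]; ring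
      _ ≤ 1 / 8 := by
        rw [div_le_div_iff₀ (by positivity) (by norm_num)]; linarith
  set A1 : Set (Set Edge) := {S | connS S (D : Set Vert) (bx 0 m) X} with hA1
  set A2 : Set (Set Edge) := {S | connS S (D : Set Vert) (bx (1, 0) m) Y} with hA2
  have b1 : Pr ξ A1ᶜ ≤ 1 / 8 := by
    have u1 : Pr q1 A1 ≤ Pr ξ A1 :=
      Pr_mono_p q10.le hξ.1.le ξ1 (isLoc_connS _ _ _) (upper_connS _ _ _)
    have u2 : Pr q1 {S | connS S (bx 0 N : Set Vert) (bx 0 m) {v | v.1 = -N}} ≤ Pr q1 A1 := by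
      refine Pr_mono q10.le q11 (isLoc_connS _ _ _) ?_
      intro S hS
      refine connS.mono hS subset_rfl ?_ subset_rfl subset_rfl
      intro w hw
      rw [Finset.mem_coe] at *
      rw [mem_bx] at hw; rw [mem_rect]; dsimp at hw; omega
    rw [Pr_compl (isLoc_connS _ _ _)] at hs1 ⊢
    linarith
  have b2 : Pr ξ A2ᶜ ≤ 1 / 8 := by
    have u1 : Pr q1 A2 ≤ Pr ξ A2 :=
      Pr_mono_p q10.le hξ.1.le ξ1 (isLoc_connS _ _ _) (upper_connS _ _ _)
    have u2 : Pr q1 {S | connS S (bx (1, 0) N : Set Vert) (bx (1, 0) m) {v | v.1 = N + 1}} ≤ Pr q1 A2 := by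
      refine Pr_mono q10.le q11 (isLoc_connS _ _ _) ?_
      intro S hS
      refine connS.mono hS subset_rfl ?_ subset_rfl subset_rfl
      intro w hw
      rw [Finset.mem_coe] at *
      rw [mem_bx] at hw; rw [mem_rect]; dsimp at hw; omega
    have u3 : Pr q1 {S | connS S (bx (1, 0) N : Set Vert) (bx (1, 0) m) {v | v.1 = N + 1}} =
        Pr q1 {S | connS S (bx 0 N : Set Vert) (bx 0 m) {v | v.1 = N}} := by
      refine (transl (1, 0)).Pr_connS ?_ ?_ ?_
      · intro v; rw [transl_τ, mem_bx, mem_bx]; simp; omega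
      · intro v; rw [transl_τ, Finset.mem_coe, Finset.mem_coe, mem_bx, mem_bx]; simp; omega
      · intro v; rw [transl_τ]; simp
    rw [Pr_compl (isLoc_connS _ _ _)] at hs2 ⊢
    linarith
  have lA1 : IsLoc A1 := isLoc_connS _ _ _
  have lA2 : IsLoc A2 := isLoc_connS _ _ _
  have lL : IsLoc {S | connS S (D : Set Vert) X Y} := isLoc_connS _ _ _
  have b3 : Pr ξ {S | connS S (D : Set Vert) X Y}ᶜ ≤ 3 / 8 := by
    have hsub : {S | connS S (D : Set Vert) X Y}ᶜ ⊆ (A1ᶜ ∪ A2ᶜ) ∪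
        (A1 ∩ A2 ∩ {S | connS S (D : Set Vert) X Y}ᶜ) := by
      intro S hS
      by_cases h1 : S ∈ A1
      · by_cases h2 : S ∈ A2
        · exact Or.inr ⟨⟨h1, h2⟩, hS⟩
        · exact Or.inl (Or.inr h2)
      · exact Or.inl (Or.inl h1)
    have l3 := (lA1.inter lA2).inter lL.compl
    have l4 := lA1.compl.union lA2.compl
    have e1 := Pr_mono ξ0.le ξ1 (l4.union l3) hsub
    have e2 := Pr_union_le ξ0.le ξ1 l4 l3
    have e3 := Pr_union_le ξ0.le ξ1 lA1.compl lA2.compl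
    have e4 := hlink.trans hlink'
    linarith
  rw [Pr_compl lL] at b3
  have b4 : Pr ξ {S | connS S (D : Set Vert) X Y} ≤ Pr (1 / 2) {S | connS S (D : Set Vert) X Y} :=
    Pr_mono_p ξ0.le hξ.2.le (by norm_num) (isLoc_connS _ _ _) (upper_connS _ _ _)
  have b5 : Pr (1 / 2) {S | connS S (D : Set Vert) X Y} ≤ 1 / 2 := half_LR N
  linarith

end Perc

open MeasureTheory Set Filter

namespace Perc

open Classical in
/-- The cluster of the origin inside `U`. -/
noncomputable def clus (U : Finset Vert) (S : Set Edge) : Finset Vert :=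
  U.filter fun z => conn S (U : Set Vert) 0 z

lemma mem_clus {U : Finset Vert} {S : Set Edge} {z : Vert} :
    z ∈ clus U S ↔ conn S (U : Set Vert) 0 z := by
  classical
  simp only [clus, Finset.mem_filter]
  exact ⟨fun h => h.2, fun h => ⟨h.right, h⟩⟩

/-- Edges inside `U` touching `C`. -/
def edgesAt (U C : Finset Vert) : Finset Edge :=
  (edgesIn U).filter fun e => e.1 ∈ C ∨ edgeTip e ∈ C

lemma clus_local_aux {U C : Finset Vert} {S T : Set Edge} (h : ∀ e ∈ edgesAt U C, e ∈ S ↔ e ∈ T)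
    (hS : clus U S = C) : clus U T = C := by
  have hadj : ∀ y z, y ∈ U → z ∈ U → y ∈ C → (adj S y z ↔ adj T y z) := by
    intro y z hy hz hyC
    refine exists_congr fun e => ?_
    constructor
    · rintro ⟨he, hh⟩
      refine ⟨(h e ?_).1 he, hh⟩
      rw [edgesAt, Finset.mem_filter, mem_edgesIn]
      rcases hh with ⟨rfl, rfl⟩ | ⟨rfl, rfl⟩
      · exact ⟨⟨hy, hz⟩, Or.inl hyC⟩
      · exact ⟨⟨hz, hy⟩, Or.inr hyC⟩
    · rintro ⟨he, hh⟩
      refine ⟨(h e ?_).2 he, hh⟩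
      rw [edgesAt, Finset.mem_filter, mem_edgesIn]
      rcases hh with ⟨rfl, rfl⟩ | ⟨rfl, rfl⟩
      · exact ⟨⟨hy, hz⟩, Or.inl hyC⟩
      · exact ⟨⟨hz, hy⟩, Or.inr hyC⟩
  rw [← hS]
  ext z
  rw [mem_clus, mem_clus]
  constructor
  · intro hc
    refine hc.induct (Q := fun z => conn S (U : Set Vert) 0 z) conn.refl ?_
    intro y z hy ih ha hz
    exact ih.tail ((hadj y z ih.right hz (by rw [← hS, mem_clus]; exact ih)).2 ha) hz
  · intro hc
    refine hc.induct (Q := fun z => conn T (U : Set Vert) 0 z) conn.refl ?_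
    intro y z hy ih ha hz
    exact ih.tail ((hadj y z ih.right hz (by rw [← hS, mem_clus]; exact hy)).1 ha) hz

lemma clus_local (U C : Finset Vert) : LocalTo (edgesAt U C) {S | clus U S = C} :=
  fun _ _ h => ⟨clus_local_aux h, clus_local_aux fun e he => (h e he).symm⟩

lemma Pr_sum_le {κ : Type*} {p : ℝ} (h0 : 0 ≤ p) (h1 : p ≤ 1) {F : Finset Edge}
    {Q : Finset κ} {φ : Set Edge → κ} (hφ : ∀ C ∈ Q, LocalTo F {S | φ S = C})
    {A : Set (Set Edge)} (hA : LocalTo F A) (h : ∀ S, φ S ∈ Q → S ∈ A) :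
    ∑ C ∈ Q, Pr p {S | φ S = C} ≤ Pr p A := by
  classical
  rw [Finset.sum_congr rfl fun C hC => Pr_eq (hφ C hC), Pr_eq hA, ← E_sum]
  refine E_mono h0 h1 fun S _ => ?_
  by_cases hS : φ S ∈ Q
  · rw [ind_of_mem (h S hS), Finset.sum_eq_single (φ S)]
    · exact ind_le_one _ _
    · intro C _ hC
      exact ind_of_not fun h => hC h.symm
    · intro h; exact absurd hS h
  · rw [Finset.sum_eq_zero]
    · exact ind_nonneg _ _
    · intro C hC
      exact ind_of_not fun h => hS (by rw [show φ S = C from h]; exact hC)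

/-- The endpoint of a boundary edge outside `U`. -/
def outer (U : Finset Vert) (f : Edge) : Vert := if f.1 ∈ U then edgeTip f else f.1

open Classical in
lemma arm_recursion {q : ℝ} (h0 : 0 ≤ q) (h1 : q ≤ 1) {U : Finset Vert} (hU0 : (0 : Vert) ∈ U)
    {L n : ℤ} (hUL : U ⊆ bx 0 (L - 1)) (hn : L ≤ n) :
    Pr q (arm 0 n) ≤ phi q U * Pr q (arm 0 (n - L)) := by
  have hL : 1 ≤ L := by
    have := hUL hU0
    rw [mem_bx] at this; dsimp at this; omega
  set Q : Edge → Finset (Finset Vert) := fun f =>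
    U.powerset.filter fun C => f.1 ∈ C ∨ edgeTip f ∈ C with hQ
  set E3 : Finset Vert → Edge → Set (Set Edge) := fun C f =>
    {S | connS S ((bx 0 n \ C : Finset Vert) : Set Vert) {outer U f} (bd 0 n)} with hE3
  have lE3 : ∀ C f, LocalTo (edgesIn (bx 0 n \ C)) (E3 C f) := fun C f => localTo_connS _ _ _
  have lE2 : ∀ f : Edge, LocalTo {f} {S : Set Edge | f ∈ S} := fun f S T h =>
    h f (Finset.mem_singleton_self f)
  have hl : ∀ f C, IsLoc ({S | clus U S = C} ∩ ({S | f ∈ S} ∩ E3 C f)) := fun f C =>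
    IsLoc.inter ⟨_, clus_local U C⟩ (IsLoc.inter ⟨_, lE2 f⟩ ⟨_, lE3 C f⟩)
  have hsub : arm 0 n ⊆ ⋃ f ∈ bdryE U, ⋃ C ∈ Q f,
      ({S | clus U S = C} ∩ ({S | f ∈ S} ∩ E3 C f)) := by
    rintro S ⟨x, hx, w, hw, hc⟩
    rw [mem_singleton_iff.1 hx] at hc
    have hwU : w ∉ U := by
      intro h
      have := hUL h
      rw [mem_bd, mem_bx] at hw
      rw [mem_bx] at this
      dsimp at *; omega
    have h0C : (0 : Vert) ∈ clus U S := mem_clus.2 (conn.refl hU0)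
    have hwC : w ∉ clus U S := fun h => hwU (mem_clus.1 h).right
    rcases conn_exit hc.symm (D := {v | v ∉ clus U S}) hwC with h | ⟨w1, w2, h, ha, hw2, hw2C⟩
    · exact absurd h0C h.right.2
    · have hw2C' : w2 ∈ clus U S := by
        by_contra h'; exact hw2C h'
      have hw2U : conn S (U : Set Vert) 0 w2 := mem_clus.1 hw2C'
      have hw1U : w1 ∉ U := by
        intro h'
        exact h.right.2 (mem_clus.2 (hw2U.tail ha.symm h'))
      obtain ⟨f, hf, hh⟩ := ha
      have hw2U' : w2 ∈ U := hw2U.right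
      have hout : outer U f = w1 := by
        unfold outer
        rcases hh with ⟨rfl, rfl⟩ | ⟨rfl, rfl⟩
        · rw [if_neg hw1U]
        · rw [if_pos hw2U']
      simp only [mem_iUnion]
      refine ⟨f, ?_, clus U S, ?_, rfl, hf, ?_⟩
      · rw [mem_bdryE]
        rcases hh with ⟨rfl, rfl⟩ | ⟨rfl, rfl⟩
        · exact Or.inr ⟨hw1U, hw2U'⟩
        · exact Or.inl ⟨hw2U', hw1U⟩
      · rw [hQ, Finset.mem_filter, Finset.mem_powerset]
        refine ⟨Finset.filter_subset _ _, ?_⟩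
        rcases hh with ⟨rfl, rfl⟩ | ⟨rfl, rfl⟩
        · exact Or.inr hw2C'
        · exact Or.inl hw2C'
      · refine ⟨_, rfl, w, hw, ?_⟩
        rw [hout]
        refine h.symm.mono subset_rfl ?_
        intro v hv
        rw [Finset.mem_coe, Finset.mem_sdiff]
        exact hv
  refine (Pr_mono h0 h1 (IsLoc.biUnion fun f _ => IsLoc.biUnion fun C _ => hl f C) hsub).trans ?_
  refine (Pr_biUnion_le h0 h1 _ fun f _ => IsLoc.biUnion fun C _ => hl f C).trans ?_
  have hf : ∀ f ∈ bdryE U, Pr q (⋃ C ∈ Q f, ({S | clus U S = C} ∩ ({S | f ∈ S} ∩ E3 C f))) ≤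
      q * Pr q (hit U f) * Pr q (arm 0 (n - L)) := by
    intro f hf
    rw [mem_bdryE] at hf
    have hout : outer U f ∉ U ∧ (∀ C : Finset Vert, C ⊆ U → (f.1 ∈ C ∨ edgeTip f ∈ C) →
        f ∉ edgesIn (bx 0 n \ C)) ∧ outer U f ∈ bx 0 L := by
      have hclose := adj_close (adj_edge (mem_univ f))
      refine ⟨?_, ?_, ?_⟩
      · unfold outer; rcases hf with h | h
        · rw [if_pos h.1]; exact h.2
        · rw [if_neg h.1]; exact h.1
      · intro C hC h h'
        rw [mem_edgesIn, Finset.mem_sdiff, Finset.mem_sdiff] at h'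
        tauto
      · unfold outer; rcases hf with h | h
        · rw [if_pos h.1]; have := hUL h.1; rw [mem_bx] at *; dsimp at *; omega
        · rw [if_neg h.1]; have := hUL h.2; rw [mem_bx] at *; dsimp at *; omega
    refine (Pr_biUnion_le h0 h1 _ fun C _ => hl f C).trans ?_
    have hC : ∀ C ∈ Q f, Pr q ({S | clus U S = C} ∩ ({S | f ∈ S} ∩ E3 C f)) ≤
        Pr q {S | clus U S = C} * (q * Pr q (arm 0 (n - L))) := by
      intro C hC
      rw [hQ, Finset.mem_filter, Finset.mem_powerset] at hC
      have d1 : Disjoint ({f} : Finset Edge) (edgesIn (bx 0 n \ C)) := by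
        rw [Finset.disjoint_singleton_left]; exact hout.2.1 C hC.1 hC.2
      have d2 : Disjoint (edgesAt U C) ({f} ∪ edgesIn (bx 0 n \ C)) := by
        rw [Finset.disjoint_left]
        intro e he he'
        rw [edgesAt, Finset.mem_filter, mem_edgesIn] at he
        rw [Finset.mem_union, Finset.mem_singleton, mem_edgesIn, Finset.mem_sdiff,
          Finset.mem_sdiff] at he'
        rcases he' with rfl | he'
        · tauto
        · tauto
      rw [Pr_indep d2 (clus_local U C) ((lE2 f).inter (lE3 C f)), Pr_indep d1 (lE2 f) (lE3 C f)]
      have hq : Pr q {S : Set Edge | f ∈ S} = q := by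
        have := Pr_allopen (p := q) ({f} : Finset Edge)
        simpa using this
      rw [hq]
      have h3 : Pr q (E3 C f) ≤ Pr q (arm 0 (n - L)) := by
        rw [← Pr_arm q (outer U f)]
        refine Pr_mono h0 h1 (isLoc_arm _ _) ?_
        rintro S ⟨x, hx, w, hw, hc⟩
        rw [mem_singleton_iff.1 hx] at hc
        have hob := hout.2.2
        obtain ⟨w', hw', hc'⟩ := conn_exit_bx (n := n - L) (o := outer U f) hc
          (by rw [mem_bx]; omega) (by
            rw [mem_bd, mem_bx] at *
            dsimp at *; omega)
        exact ⟨_, rfl, w', hw', hc'.mono subset_rfl inter_subset_right⟩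
      have := Pr_nonneg h0 h1 {S | clus U S = C}
      gcongr
    refine (Finset.sum_le_sum hC).trans ?_
    rw [← Finset.sum_mul]
    have hs : ∑ C ∈ Q f, Pr q {S | clus U S = C} ≤ Pr q (hit U f) := by
      refine Pr_sum_le h0 h1 (F := edgesIn U) (fun C _ =>
        (clus_local U C).mono (Finset.filter_subset _ _)) (hit_local U f) ?_
      intro S hS
      rw [hQ, Finset.mem_filter] at hS
      rcases hS.2 with h | h
      · exact ⟨0, rfl, _, Or.inl rfl, mem_clus.1 h⟩
      · exact ⟨0, rfl, _, Or.inr rfl, mem_clus.1 h⟩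
    calc _ ≤ Pr q (hit U f) * (q * Pr q (arm 0 (n - L))) := by
          have := Pr_nonneg h0 h1 (arm 0 (n - L))
          gcongr
      _ = _ := by ring
  refine (Finset.sum_le_sum hf).trans_eq ?_
  rw [phi, ← Finset.sum_mul, ← Finset.mul_sum]

theorem exp_decay {q : ℝ} (h0 : 0 < q) (hq : q < 1 / 2) : ∃ C c : ℝ, 0 < C ∧ 0 < c ∧
    ∀ n : ℕ, Pr q (arm 0 (n : ℤ)) ≤ C * Real.exp (-c * n) := by
  obtain ⟨U, hU0, hU⟩ := exists_phi_lt h0 hq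
  have h1 : q ≤ 1 := by linarith
  obtain ⟨L, hL1, hUL⟩ : ∃ L : ℕ, 1 ≤ L ∧ U ⊆ bx 0 ((L : ℤ) - 1) := by
    refine ⟨(U.sup fun v => v.1.natAbs + v.2.natAbs) + 1, by omega, fun v hv => ?_⟩
    have := Finset.le_sup (f := fun v : Vert => v.1.natAbs + v.2.natAbs) hv
    rw [mem_bx]; dsimp at *; push_cast; omega
  set φ := max (phi q U) (1 / 2) with hφ
  have hφ1 : φ < 1 := max_lt hU (by norm_num)
  have hφ0 : 0 < φ := lt_max_of_lt_right (by norm_num)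
  set c := - Real.log φ / L with hc
  have hLr : (0 : ℝ) < L := by exact_mod_cast hL1
  have hc0 : 0 < c := div_pos (neg_pos.2 (Real.log_neg hφ0 hφ1)) hLr
  have hcL : c * L = - Real.log φ := by rw [hc]; field_simp
  refine ⟨Real.exp (c * L), c, Real.exp_pos _, hc0, fun n => ?_⟩
  induction n using Nat.strong_induction_on with
  | _ n ih =>
    by_cases hn : n < L
    · refine (Pr_le_one h0.le h1 _).trans ?_
      rw [← Real.exp_add]
      refine Real.one_le_exp ?_
      have : (n : ℝ) ≤ L := by exact_mod_cast hn.le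
      nlinarith
    · push Not at hn
      have hr := arm_recursion h0.le h1 hU0 hUL (n := n) (by exact_mod_cast hn)
      rw [← Nat.cast_sub hn] at hr
      have hP := Pr_nonneg h0.le h1 (arm 0 ((n - L : ℕ) : ℤ))
      calc Pr q (arm 0 (n : ℤ)) ≤ phi q U * Pr q (arm 0 ((n - L : ℕ) : ℤ)) := hr
        _ ≤ φ * (Real.exp (c * L) * Real.exp (-c * (n - L : ℕ))) := by
          refine mul_le_mul (le_max_left _ _) (ih (n - L) (by omega)) hP hφ0.le
        _ = _ := by
          rw [Nat.cast_sub hn]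
          have : φ = Real.exp (-(c * L)) := by rw [hcL, neg_neg, Real.exp_log hφ0]
          rw [this, ← Real.exp_add, ← Real.exp_add, ← Real.exp_add]
          congr 1; ring

lemma LR_compl_le {p : ℝ} (h0 : 0 ≤ p) (h1 : p ≤ 1) {a b c d : ℤ} (hab : a ≤ b) (hcd : c ≤ d) :
    Pr p {S | LR S a b c d}ᶜ ≤ (b - a) * Pr (1 - p) (arm 0 (d - c + 1)) := by
  have h0' : 0 ≤ 1 - p := by linarith
  have h1' : 1 - p ≤ 1 := by linarith
  have s1 : Pr p {S | LR S a b c d}ᶜ ≤ Pr p {S | dual S ∈ {S | TB S a (b - 1) (c - 1) d}} := by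
    refine Pr_mono h0 h1 (isLoc_dual (isLoc_TB _ _ _ _)) ?_
    intro S hS
    exact (LR_or_TB S hab hcd).resolve_left hS
  rw [Pr_dual (isLoc_TB _ _ _ _)] at s1
  refine s1.trans ?_
  have hsub : {S | TB S a (b - 1) (c - 1) d} ⊆ ⋃ x ∈ Finset.Icc a (b - 1), arm (x, d) (d - c + 1) := by
    rintro S ⟨u, hu, w, hw, hc⟩
    rw [mem_ofPred_eq] at hu hw
    have hur := hc.left
    have hwr := hc.right
    rw [Finset.mem_coe, mem_rect] at hur hwr
    obtain ⟨w', hw', hc'⟩ := conn_exit_bx (n := d - c + 1) (o := u) hc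
      (by rw [mem_bx]; omega) (by rw [mem_bd, mem_bx]; omega)
    simp only [mem_iUnion, Finset.mem_Icc]
    refine ⟨u.1, ⟨by omega, by omega⟩, ?_⟩
    have hu' : ((u.1, d) : Vert) = u := Prod.ext rfl hu.symm
    rw [hu']
    exact ⟨_, rfl, w', hw', hc'.mono subset_rfl inter_subset_right⟩
  refine (Pr_mono h0' h1' (IsLoc.biUnion fun x _ => isLoc_arm _ _) hsub).trans ?_
  refine (Pr_biUnion_le h0' h1' _ fun x _ => isLoc_arm _ _).trans ?_
  rw [Finset.sum_congr rfl fun x _ => Pr_arm (1 - p) (x, d) (d - c + 1), Finset.sum_const,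
    nsmul_eq_mul]
  have : ((Finset.Icc a (b - 1)).card : ℤ) = b - a := by
    rw [Int.card_Icc]; omega
  have : ((Finset.Icc a (b - 1)).card : ℝ) = b - a := by exact_mod_cast this
  rw [this]

end Perc

open MeasureTheory Set Filter

namespace Perc

/-- Reflection in the diagonal. -/
def swp : Aut where
  τ := ⟨fun v => (v.2, v.1), fun v => (v.2, v.1), fun _ => rfl, fun _ => rfl⟩
  σ := ⟨fun e => ((e.1.2, e.1.1), !e.2), fun e => ((e.1.2, e.1.1), !e.2),
    fun ⟨v, b⟩ => by simp, fun ⟨v, b⟩ => by simp⟩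
  h := by
    rintro ⟨v, b⟩
    left
    cases b <;> simp [tip_false, tip_true]

lemma swp_τ (v : Vert) : swp.τ v = (v.2, v.1) := rfl

lemma swp_ττ (v : Vert) : swp.τ (swp.τ v) = v := rfl

lemma swp_σσ (e : Edge) : swp.σ (swp.σ e) = e := swp.σ.left_inv e

lemma swp_image (T : Set Edge) : swp.σ '' (swp.σ '' T) = T := by
  rw [image_image]
  simp only [swp_σσ, image_id']

/-- `Q` is connected using the edges in `T`. -/
def Con (T : Set Edge) (Q : Set Vert) : Prop := ∀ u ∈ Q, ∀ v ∈ Q, conn T Q u v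

lemma Con.mono {T T' : Set Edge} {Q : Set Vert} (h : Con T Q) (hT : T ⊆ T') : Con T' Q :=
  fun u hu v hv => (h u hu v hv).mono hT subset_rfl

lemma con_comp (T : Set Edge) (D : Set Vert) (x : Vert) : Con T {z | conn T D x z} := by
  have key : ∀ z, conn T D x z → conn T {z | conn T D x z} x z := by
    intro z hz
    refine hz.induct (Q := fun z => conn T {z | conn T D x z} x z) ?_ ?_
    · exact fun hx => conn.refl (conn.refl hx)
    · intro y z hy ih ha hzD
      exact ih.tail ha (hy.tail ha hzD)
  intro u hu v hv
  exact (key u hu).symm.trans (key v hv)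

lemma Con.swap {T : Set Edge} {Q : Set Vert} (h : Con T Q) :
    Con (swp.σ '' T) (swp.τ ⁻¹' Q) := by
  intro u hu v hv
  have := swp.conn (D' := swp.τ ⁻¹' Q) (fun v hv => by rwa [mem_preimage, swp_ττ])
    (h _ hu _ hv)
  rwa [swp_ττ, swp_ττ] at this

/-- Horizontal crossing. -/
structure HC (T : Set Edge) (a b c d : ℤ) (Q : Set Vert) : Prop where
  sub : Q ⊆ (rect a b c d : Set Vert)
  left : ∃ x ∈ Q, x.1 = a
  right : ∃ y ∈ Q, y.1 = b
  con : Con T Q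

/-- Vertical crossing. -/
structure VC (T : Set Edge) (a b c d : ℤ) (Q : Set Vert) : Prop where
  sub : Q ⊆ (rect a b c d : Set Vert)
  bot : ∃ x ∈ Q, x.2 = c
  top : ∃ y ∈ Q, y.2 = d
  con : Con T Q

lemma HC.mono {T T' : Set Edge} {a b c d : ℤ} {Q : Set Vert} (h : HC T a b c d Q) (hT : T ⊆ T') :
    HC T' a b c d Q := ⟨h.sub, h.left, h.right, h.con.mono hT⟩

lemma VC.mono {T T' : Set Edge} {a b c d : ℤ} {Q : Set Vert} (h : VC T a b c d Q) (hT : T ⊆ T') :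
    VC T' a b c d Q := ⟨h.sub, h.bot, h.top, h.con.mono hT⟩

lemma LR_HC {T : Set Edge} {a b c d : ℤ} (h : LR T a b c d) : ∃ Q, HC T a b c d Q := by
  obtain ⟨x, hx, y, hy, hc⟩ := h
  refine ⟨{z | conn T (rect a b c d : Set Vert) x z}, fun z hz => conn.right hz,
    ⟨x, conn.refl hc.left, hx⟩, ⟨y, hc, hy⟩, con_comp _ _ _⟩

lemma HC.swap {T : Set Edge} {a b c d : ℤ} {Q : Set Vert} (h : HC T a b c d Q) :
    VC (swp.σ '' T) c d a b (swp.τ ⁻¹' Q) := by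
  refine ⟨?_, ?_, ?_, h.con.swap⟩
  · intro v hv
    have := h.sub hv
    rw [Finset.mem_coe, mem_rect] at this ⊢
    rw [swp_τ] at this
    dsimp at this; omega
  · obtain ⟨x, hx, e⟩ := h.left
    exact ⟨swp.τ x, by rwa [mem_preimage, swp_ττ], e⟩
  · obtain ⟨x, hx, e⟩ := h.right
    exact ⟨swp.τ x, by rwa [mem_preimage, swp_ττ], e⟩

lemma HC_swap' {T : Set Edge} {a b c d : ℤ} {Q : Set Vert} (h : HC (swp.σ '' T) a b c d Q) :
    VC T c d a b (swp.τ ⁻¹' Q) := by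
  have := h.swap
  rwa [swp_image] at this

lemma VC.swap {T : Set Edge} {a b c d : ℤ} {Q : Set Vert} (h : VC T a b c d Q) :
    HC (swp.σ '' T) c d a b (swp.τ ⁻¹' Q) := by
  refine ⟨?_, ?_, ?_, h.con.swap⟩
  · intro v hv
    have := h.sub hv
    rw [Finset.mem_coe, mem_rect] at this ⊢
    rw [swp_τ] at this
    dsimp at this; omega
  · obtain ⟨x, hx, e⟩ := h.bot
    exact ⟨swp.τ x, by rwa [mem_preimage, swp_ττ], e⟩
  · obtain ⟨x, hx, e⟩ := h.top
    exact ⟨swp.τ x, by rwa [mem_preimage, swp_ττ], e⟩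

lemma meet_gen {T : Set Edge} {a b c d : ℤ} {Q X : Set Vert} (h : HC T a b c d Q) (hab : a < b)
    (hcd : c ≤ d) (hX : Con univ X) (hXs : ∀ v ∈ X, a ≤ v.1 ∧ v.1 ≤ b)
    {u w : Vert} (hu : u ∈ X) (hw : w ∈ X)
    (huc : u.2 ≤ c) (hwd : d ≤ w.2) : ∃ v, v ∈ Q ∧ v ∈ X := by
  obtain ⟨x, hx, hxa⟩ := h.left
  obtain ⟨y, hy, hyb⟩ := h.right
  exact cross_meet hab hcd h.sub ((h.con x hx y hy).mono (subset_univ _) subset_rfl) hxa hyb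
    hXs (hX u hu w hw) huc hwd

lemma meet {T T' : Set Edge} {a b c d a' b' c' d' : ℤ} {Q Z : Set Vert} (h : HC T a b c d Q)
    (h' : VC T' a' b' c' d' Z) (hab : a < b) (hcd : c ≤ d) (h1 : a ≤ a') (h2 : b' ≤ b)
    (h3 : c' ≤ c) (h4 : d ≤ d') : ∃ v, v ∈ Q ∧ v ∈ Z := by
  obtain ⟨x, hx, hxa⟩ := h'.bot
  obtain ⟨y, hy, hyb⟩ := h'.top
  refine meet_gen h hab hcd (h'.con.mono (subset_univ _)) ?_ hx hy (by omega) (by omega)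
  intro v hv
  have := h'.sub hv
  rw [Finset.mem_coe, mem_rect] at this
  omega

/-- Connected sets sharing a vertex. -/
lemma Con.union {T : Set Edge} {Q Z : Set Vert} (hQ : Con T Q) (hZ : Con T Z) {v : Vert}
    (h1 : v ∈ Q) (h2 : v ∈ Z) {x y : Vert} (hx : x ∈ Q) (hy : y ∈ Z) :
    conn T (Q ∪ Z) x y :=
  ((hQ x hx v h1).mono subset_rfl subset_union_left).trans
    ((hZ v h2 y hy).mono subset_rfl subset_union_right)

/-- The `j`th strip, its crossing rectangle. -/
noncomputable def strip (n K j : ℕ) : Finset Vert :=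
  rect (-n) n (-n + j * K) (-n + j * K + K - 1)

/-- The good event for horizontal crossings. -/
structure Good0 (S : Set Edge) (n K M r : ℕ) : Prop where
  strips : ∀ j < M, S ∈ robust r {S | LR S (-n) n (-n + j * K) (-n + j * K + K - 1)}
  wide : ∀ N : ℕ, n ≤ N → LR S (-N - 1) (N + 1) (-N) N

/-- Horizontal crossing of the `j`th strip. -/
def HS (T : Set Edge) (n K j : ℕ) (Q : Set Vert) : Prop :=
  HC T (-n) n (-n + j * K) (-n + j * K + K - 1) Q

/-- Vertical crossing of the `j`th strip. -/
def VS (T : Set Edge) (n K j : ℕ) (Q : Set Vert) : Prop :=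
  VC T (-n + j * K) (-n + j * K + K - 1) (-n) n Q

/-- Strips cut by `F`. -/
noncomputable def cuts (F : Finset Edge) (n K M r : ℕ) : Finset ℕ :=
  (Finset.range M).filter fun j => r < (F ∩ edgesIn (strip n K j)).card

lemma uncut {S : Set Edge} {n K M r : ℕ} (h : Good0 S n K M r) (F : Finset Edge) {j : ℕ}
    (hj : j < M) (hc : j ∉ cuts F n K M r) : ∃ Q, HS (S \ F) n K j Q := by
  have hc' : (F ∩ edgesIn (strip n K j)).card ≤ r := by
    by_contra hcon
    exact hc (Finset.mem_filter.2 ⟨Finset.mem_range.2 hj, not_le.1 hcon⟩)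
  have := h.strips j hj _ hc'
  refine LR_HC ?_
  obtain ⟨x, hx, y, hy, hxy⟩ := this
  refine ⟨x, hx, y, hy, conn_congr ?_ hxy⟩
  rintro e h1 h2 ⟨h3, h4⟩
  refine ⟨h3, fun h5 => h4 ?_⟩
  rw [Finset.mem_coe, Finset.mem_inter, mem_edgesIn]
  exact ⟨h5, h1, h2⟩

lemma strip_disj {n K i j : ℕ} {v : Vert} (hi : v ∈ strip n K i) (hj : v ∈ strip n K j) : i = j := by
  rw [strip, mem_rect] at hi hj
  by_contra hne
  have key : ∀ i j : ℕ, i < j → (-n + i * K + K : ℤ) ≤ -n + j * K := by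
    intro i j h
    have : (i + 1) * K ≤ j * K := Nat.mul_le_mul_right _ h
    have : ((i : ℤ) + 1) * K ≤ j * K := by exact_mod_cast this
    linarith
  rcases lt_or_gt_of_ne hne with h | h <;> have := key _ _ h <;> omega

lemma cut_count (F : Finset Edge) (n K M r : ℕ) :
    (cuts F n K M r).card * (r + 1) ≤ F.card := by
  classical
  have h1 : (cuts F n K M r).card * (r + 1) ≤
      ∑ j ∈ cuts F n K M r, (F ∩ edgesIn (strip n K j)).card := by
    rw [← smul_eq_mul]
    refine Finset.card_nsmul_le_sum _ _ _ fun j hj => ?_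
    exact (Finset.mem_filter.1 hj).2
  refine h1.trans ?_
  rw [← Finset.card_biUnion]
  · refine Finset.card_le_card ?_
    intro e he
    rw [Finset.mem_biUnion] at he
    obtain ⟨j, _, he⟩ := he
    exact (Finset.mem_inter.1 he).1
  · intro i _ j _ hij
    rw [Function.onFun, Finset.disjoint_left]
    intro e h1 h2
    rw [Finset.mem_inter, mem_edgesIn] at h1 h2
    exact hij (strip_disj h1.2.1 h2.2.1)

lemma conf {n K M : ℕ} {X : Set Vert} {J : Finset ℕ} (hn : 1 ≤ n) (hK : 1 ≤ K)
    (hM : 2 * n + 1 < M * K + K)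
    (hX : X ⊆ (rect (-n) n (-n) n : Set Vert)) (hc : Con univ X)
    (hJ : ∀ j < M, j ∉ J → ∃ Q, HS univ n K j Q ∧ Disjoint Q X) {u w : Vert} (hu : u ∈ X)
    (hw : w ∈ X) : w.2 < u.2 + ((J.card + 2) * K : ℕ) := by
  by_contra hcon
  push Not at hcon
  have hu' := hX hu
  have hw' := hX hw
  rw [Finset.mem_coe, mem_rect] at hu' hw'
  obtain ⟨a, ha⟩ := Int.eq_ofNat_of_zero_le (show 0 ≤ u.2 + n by omega)
  set j0 := (a + K - 1) / K with hj0
  have e1 := Nat.div_add_mod (a + K - 1) K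
  have e2 := Nat.mod_lt (a + K - 1) hK
  rw [← hj0] at e1
  have e3 : a ≤ j0 * K := by rw [mul_comm]; omega
  have e4 : j0 * K < a + K := by rw [mul_comm]; omega
  have e5 : (j0 + J.card + 1) * K < a + (J.card + 2) * K := by nlinarith
  have e6 : (j0 + J.card + 1) * K ≤ 2 * n := by omega
  have e7 : j0 + J.card < M := by
    by_contra h
    have h' : (M + 1) * K ≤ (j0 + J.card + 1) * K := Nat.mul_le_mul_right _ (by omega)
    have h'' : (M + 1) * K = M * K + K := by ring
    omega
  have hsub : Finset.Icc j0 (j0 + J.card) ⊆ J := by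
    intro j hj
    rw [Finset.mem_Icc] at hj
    by_contra hjJ
    obtain ⟨Q, hQ, hd⟩ := hJ j (by omega) hjJ
    have f1 : j0 * K ≤ j * K := Nat.mul_le_mul_right _ hj.1
    have f2 : (j + 1) * K ≤ (j0 + J.card + 1) * K := Nat.mul_le_mul_right _ (by omega)
    have f3 : (j + 1) * K = j * K + K := by ring
    have f4 : ((j * K : ℕ) : ℤ) = j * K := by push_cast; ring
    obtain ⟨v, h1, h2⟩ := meet_gen hQ (by omega) (by omega) hc (fun v hv => by
      have := hX hv
      rw [Finset.mem_coe, mem_rect] at this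
      omega) hu hw (by omega) (by omega)
    exact disjoint_left.1 hd h1 h2
  have := Finset.card_le_card hsub
  rw [Nat.card_Icc] at this
  omega

lemma card_box {X : Set Vert} {L L' : ℕ} (hf : X.Finite) (h1 : ∀ u ∈ X, ∀ w ∈ X, w.1 < u.1 + (L : ℤ))
    (h2 : ∀ u ∈ X, ∀ w ∈ X, w.2 < u.2 + (L' : ℤ)) : X.ncard ≤ L * L' := by
  rcases X.eq_empty_or_nonempty with rfl | hne
  · simp
  obtain ⟨u, hu, hu'⟩ := exists_min_image X (fun v => v.1) hf hne
  obtain ⟨w, hw, hw'⟩ := exists_min_image X (fun v => v.2) hf hne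
  have hs : X ⊆ (rect u.1 (u.1 + L - 1) w.2 (w.2 + L' - 1) : Set Vert) := by
    intro v hv
    rw [Finset.mem_coe, mem_rect]
    have := hu' v hv
    have := hw' v hv
    have := h1 u hu v hv
    have := h2 w hw v hv
    omega
  have := ncard_le_ncard hs (Finset.finite_toSet _)
  rw [ncard_coe_finset, rect, Finset.card_product, Int.card_Icc, Int.card_Icc] at this
  convert this using 2 <;> omega

lemma comp_small {S : Set Edge} {n K M r : ℕ} {X : Set Vert} (hn : 1 ≤ n) (hK : 1 ≤ K)
    (hM : 2 * n + 1 < M * K + K) (hg : Good0 S n K M r) (hg' : Good0 (swp.σ '' S) n K M r)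
    (hX : X ⊆ (rect (-n) n (-n) n : Set Vert)) (hc : Con univ X) (F : Finset Edge)
    (hH : ∀ j < M, ∀ Q, HS (S \ F) n K j Q → Disjoint Q X)
    (hV : ∀ j < M, ∀ Q, VS (S \ F) n K j Q → Disjoint Q X) :
    ∃ m m' : ℕ, m * (r + 1) ≤ F.card ∧ m' * (r + 1) ≤ F.card ∧
      X.ncard ≤ ((m' + 2) * K) * ((m + 2) * K) := by
  classical
  refine ⟨_, _, cut_count F n K M r, (cut_count (F.image swp.σ) n K M r).trans
    Finset.card_image_le, ?_⟩
  refine card_box ((Finset.finite_toSet _).subset hX) ?_ ?_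
  · intro u hu w hw
    have := conf (X := swp.τ ⁻¹' X) (J := cuts (F.image swp.σ) n K M r) (u := swp.τ u) (w := swp.τ w)
      hn hK hM ?_ ?_ ?_ (by rwa [mem_preimage, swp_ττ]) (by rwa [mem_preimage, swp_ττ])
    · exact this
    · intro v hv
      have := hX hv
      rw [Finset.mem_coe, mem_rect] at this ⊢
      rw [swp_τ] at this
      dsimp at this; omega
    · exact hc.swap.mono (subset_univ _)
    · intro j hj hjc
      obtain ⟨Q, hQ⟩ := uncut hg' _ hj hjc
      refine ⟨Q, hQ.mono (subset_univ _), ?_⟩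
      have hQ2 : HC (swp.σ '' (S \ F)) (-n) n (-n + j * K) (-n + j * K + K - 1) Q := by
        rw [image_sdiff swp.σ.injective, ← Finset.coe_image]
        exact hQ
      have := hV j hj _ (HC_swap' hQ2)
      rw [disjoint_left] at this ⊢
      intro v hv hvX
      exact this (a := swp.τ v) (by rwa [mem_preimage, swp_ττ]) hvX
  · intro u hu w hw
    refine conf hn hK hM hX hc ?_ hu hw
    intro j hj hjc
    obtain ⟨Q, hQ⟩ := uncut hg F hj hjc
    exact ⟨Q, hQ.mono (subset_univ _), hH j hj Q hQ⟩

lemma exists_VS {S : Set Edge} {n K M r : ℕ} (hg' : Good0 (swp.σ '' S) n K M r) (F : Finset Edge)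
    (h : F.card < (r + 1) * M) : ∃ j < M, ∃ Q, VS (S \ F) n K j Q := by
  classical
  have h1 := (cut_count (F.image swp.σ) n K M r).trans Finset.card_image_le
  have : ∃ j < M, j ∉ cuts (F.image swp.σ) n K M r := by
    by_contra hcon
    push Not at hcon
    have h2 : Finset.range M ⊆ cuts (F.image swp.σ) n K M r := fun j hj =>
      hcon j (Finset.mem_range.1 hj)
    have h3 := Finset.card_le_card h2
    rw [Finset.card_range] at h3
    have : (r + 1) * M ≤ F.card := by nlinarith
    omega
  obtain ⟨j, hj, hjc⟩ := this
  obtain ⟨Q, hQ⟩ := uncut hg' _ hj hjc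
  have hQ2 : HC (swp.σ '' (S \ F)) (-n) n (-n + j * K) (-n + j * K + K - 1) Q := by
    rw [image_sdiff swp.σ.injective, ← Finset.coe_image]
    exact hQ
  exact ⟨j, hj, _, HC_swap' hQ2⟩

lemma exists_HS {S : Set Edge} {n K M r : ℕ} (hg : Good0 S n K M r) (F : Finset Edge)
    (h : F.card < (r + 1) * M) : ∃ j < M, ∃ Q, HS (S \ F) n K j Q := by
  have h1 := cut_count F n K M r
  have : ∃ j < M, j ∉ cuts F n K M r := by
    by_contra hcon
    push Not at hcon
    have h2 : Finset.range M ⊆ cuts F n K M r := fun j hj =>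
      hcon j (Finset.mem_range.1 hj)
    have h3 := Finset.card_le_card h2
    rw [Finset.card_range] at h3
    have : (r + 1) * M ≤ F.card := by nlinarith
    omega
  obtain ⟨j, hj, hjc⟩ := this
  exact ⟨j, hj, uncut hg _ hj hjc⟩

end Perc

open MeasureTheory Set Filter

namespace Perc

lemma Con.conn_univ {T : Set Edge} {Q : Set Vert} (h : Con T Q) {u v : Vert} (hu : u ∈ Q)
    (hv : v ∈ Q) : conn T univ u v := (h u hu v hv).mono subset_rfl (subset_univ _)

lemma chain {S : Set Edge} {n K M r : ℕ} (hn : 1 ≤ n) (hg : Good0 S n K M r)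
    (hg' : Good0 (swp.σ '' S) n K M r) :
    ∃ Z Q, VC S (-n) n (-n - 1) (n + 1) Z ∧ HC S (-n - 1) (n + 1) (-n) n Q ∧
      (∀ y ∈ Z, {z | conn S univ y z}.Infinite) ∧ (∀ y ∈ Q, {z | conn S univ y z}.Infinite) := by
  have hQ : ∀ N : ℕ, ∃ Q, n ≤ N → HC S (-N - 1) (N + 1) (-N) N Q := by
    intro N
    by_cases h : n ≤ N
    · obtain ⟨Q, hQ⟩ := LR_HC (hg.wide N h)
      exact ⟨Q, fun _ => hQ⟩
    · exact ⟨∅, fun h' => absurd h' h⟩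
  have hZ : ∀ N : ℕ, ∃ Z, n ≤ N → VC S (-N) N (-N - 1) (N + 1) Z := by
    intro N
    by_cases h : n ≤ N
    · obtain ⟨Q, hQ⟩ := LR_HC (hg'.wide N h)
      exact ⟨_, fun _ => HC_swap' hQ⟩
    · exact ⟨∅, fun h' => absurd h' h⟩
  choose Q hQ using hQ
  choose Z hZ using hZ
  have hinf : ∀ y ∈ Z n, {z | conn S univ y z}.Infinite := by
    intro y hy
    have key : ∀ N, n ≤ N → ∀ z ∈ Z N, conn S univ y z := by
      intro N hN
      induction N, hN using Nat.le_induction with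
      | base => exact fun z hz => (hZ n le_rfl).con.conn_univ hy hz
      | succ N hN ih =>
        intro z hz
        have hN' : n ≤ N + 1 := by omega
        obtain ⟨v, h1, h2⟩ := meet (hQ N hN) (hZ N hN) (by omega) (by omega) (by omega) (by omega)
          (by omega) (by omega)
        obtain ⟨v', h3, h4⟩ := meet (hQ N hN) (hZ (N + 1) hN') (by omega) (by omega)
          (by push_cast; omega) (by push_cast; omega) (by push_cast; omega) (by push_cast; omega)
        exact ((ih v h2).trans ((hQ N hN).con.conn_univ h1 h3)).trans
          ((hZ _ hN').con.conn_univ h4 hz)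
    intro hfin
    obtain ⟨B, hB⟩ := (hfin.image (fun v : Vert => v.2)).bddAbove
    set N := max n B.toNat
    obtain ⟨t, ht, ht2⟩ := (hZ N (le_max_left _ _)).top
    have := hB ⟨t, key N (le_max_left _ _) t ht, rfl⟩
    dsimp only at this
    omega
  refine ⟨Z n, Q n, hZ n le_rfl, hQ n le_rfl, hinf, ?_⟩
  intro y hy
  obtain ⟨v, h1, h2⟩ := meet (hQ n le_rfl) (hZ n le_rfl) (by omega) (by omega) (by omega) (by omega)
          (by omega) (by omega)
  refine (hinf v h2).mono ?_
  intro z hz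
  exact ((hQ n le_rfl).con.conn_univ hy h1).trans hz

/-- Open edges. -/
def So (ω : Config) : Set Edge := {e | ω e = true}

lemma cluster_eq (ω : Config) (x : Vert) : cluster ω x = {z | conn (So ω) univ x z} := by
  ext z
  constructor
  · intro h
    refine ⟨mem_univ _, Relation.ReflTransGen.mono (fun a b h => ⟨h, mem_univ _, mem_univ _⟩) _ _ h⟩
  · intro h
    exact Relation.ReflTransGen.mono (fun a b h => h.1) _ _ h.2

lemma compIn_eq (ω : Config) (n : ℕ) {x : Vert} (hx : x ∈ Ctilde ω n) :
    compIn ω n x = {z | conn (So ω) (Ctilde ω n) x z} := by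
  ext z
  constructor
  · intro h
    exact ⟨hx, h.1⟩
  · intro h
    exact ⟨h.2, h.right⟩

lemma latBox_eq (n : ℕ) : latBox n = (rect (-n) n (-n) n : Set Vert) := by
  ext v
  rw [Finset.mem_coe, mem_rect, latBox, mem_ofPred_eq, abs_le, abs_le, and_assoc]

lemma Ctilde_sub (ω : Config) (n : ℕ) : Ctilde ω n ⊆ (rect (-n) n (-n) n : Set Vert) := by
  rw [← latBox_eq]; exact inter_subset_right

lemma HS_sub {S : Set Edge} {n K M r j : ℕ} {ω : Config} {Q : Set Vert} (hn : 1 ≤ n) (hK : 1 ≤ K)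
    (hM : M * K ≤ 2 * n + 1) (hj : j < M)
    (hg : Good0 (So ω) n K M r) (hg' : Good0 (swp.σ '' So ω) n K M r) (hS : S ⊆ So ω)
    (hQ : HS S n K j Q) : Q ⊆ Ctilde ω n := by
  have hQ := hQ.mono hS
  obtain ⟨Z, _, hZ, _, hi, _⟩ := chain hn hg hg'
  have f1 : (j + 1) * K ≤ M * K := Nat.mul_le_mul_right _ hj
  have f3 : (j + 1) * K = j * K + K := by ring
  have f4 : ((j * K : ℕ) : ℤ) = j * K := by push_cast; ring
  obtain ⟨v, h1, h2⟩ := meet hQ hZ (by omega) (by omega) (by omega) (by omega) (by omega) (by omega)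
  intro x hx
  refine ⟨?_, ?_⟩
  · rw [Cinf, mem_ofPred_eq, cluster_eq]
    refine (hi v h2).mono ?_
    intro z hz
    exact (hQ.con.conn_univ hx h1).trans hz
  · rw [latBox_eq]
    have := hQ.sub hx
    rw [Finset.mem_coe, mem_rect] at this ⊢
    omega

lemma VS_sub {S : Set Edge} {n K M r j : ℕ} {ω : Config} {Q : Set Vert} (hn : 1 ≤ n) (hK : 1 ≤ K)
    (hM : M * K ≤ 2 * n + 1) (hj : j < M)
    (hg : Good0 (So ω) n K M r) (hg' : Good0 (swp.σ '' So ω) n K M r) (hS : S ⊆ So ω)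
    (hQ : VS S n K j Q) : Q ⊆ Ctilde ω n := by
  have hQ := hQ.mono hS
  obtain ⟨_, Z, _, hZ, _, hi⟩ := chain hn hg hg'
  have f1 : (j + 1) * K ≤ M * K := Nat.mul_le_mul_right _ hj
  have f3 : (j + 1) * K = j * K + K := by ring
  have f4 : ((j * K : ℕ) : ℤ) = j * K := by push_cast; ring
  obtain ⟨v, h1, h2⟩ := meet hZ hQ (by omega) (by omega) (by omega) (by omega) (by omega) (by omega)
  intro x hx
  refine ⟨?_, ?_⟩
  · rw [Cinf, mem_ofPred_eq, cluster_eq]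
    refine (hi v h1).mono ?_
    intro z hz
    exact (hQ.con.conn_univ hx h2).trans hz
  · rw [latBox_eq]
    have := hQ.sub hx
    rw [Finset.mem_coe, mem_rect] at this ⊢
    omega

lemma HV_meet {T T' : Set Edge} {n K M i j : ℕ} {Q Z : Set Vert} (hn : 1 ≤ n) (hK : 1 ≤ K)
    (hM : M * K ≤ 2 * n + 1) (hi : i < M) (hj : j < M) (hQ : HS T n K i Q) (hZ : VS T' n K j Z) :
    ∃ v, v ∈ Q ∧ v ∈ Z := by
  have f1 : (j + 1) * K ≤ M * K := Nat.mul_le_mul_right _ hj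
  have f3 : (j + 1) * K = j * K + K := by ring
  have f4 : ((j * K : ℕ) : ℤ) = j * K := by push_cast; ring
  have g1 : (i + 1) * K ≤ M * K := Nat.mul_le_mul_right _ hi
  have g3 : (i + 1) * K = i * K + K := by ring
  have g4 : ((i * K : ℕ) : ℤ) = i * K := by push_cast; ring
  exact meet hQ hZ (by omega) (by omega) (by omega) (by omega) (by omega) (by omega)

/-- Bundled deterministic hypotheses. -/
structure Good (ω : Config) (n K M r : ℕ) : Prop where
  hn : 1 ≤ n
  hK : 1 ≤ K
  hM1 : 1 ≤ M
  hM : M * K ≤ 2 * n + 1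
  hM' : 2 * n + 1 < M * K + K
  hg : Good0 (So ω) n K M r
  hg' : Good0 (swp.σ '' So ω) n K M r

/-- The component containing all crossings. -/
lemma exists_big {ω : Config} {n K M r : ℕ} (g : Good ω n K M r) :
    ∃ x ∈ Ctilde ω n, ∀ S ⊆ So ω, ∀ j < M, ∀ Q, (HS S n K j Q ∨ VS S n K j Q) →
      Q ⊆ compIn ω n x := by
  obtain ⟨hn, hK, hM1, hM, hM', hg, hg'⟩ := g
  have hpos : (∅ : Finset Edge).card < (r + 1) * M := by
    rw [Finset.card_empty]; positivity
  obtain ⟨i, hi, Q0, hQ0⟩ := exists_HS hg ∅ hpos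
  obtain ⟨k, hk, Z0, hZ0⟩ := exists_VS hg' ∅ hpos
  rw [Finset.coe_empty, sdiff_empty] at hQ0 hZ0
  obtain ⟨x, hxQ, hxZ⟩ := HV_meet hn hK hM hi hk hQ0 hZ0
  have sQ0 := HS_sub hn hK hM hi hg hg' subset_rfl hQ0
  have sZ0 := VS_sub hn hK hM hk hg hg' subset_rfl hZ0
  refine ⟨x, sQ0 hxQ, ?_⟩
  rw [compIn_eq _ _ (sQ0 hxQ)]
  intro S hS j hj Q hQ z hz
  rcases hQ with hQ | hQ
  · have sQ := HS_sub hn hK hM hj hg hg' hS hQ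
    obtain ⟨v, h1, h2⟩ := HV_meet hn hK hM hj hk hQ hZ0
    exact ((hZ0.con x hxZ v h2).mono subset_rfl sZ0).trans ((hQ.con v h1 z hz).mono hS sQ)
  · have sQ := VS_sub hn hK hM hj hg hg' hS hQ
    obtain ⟨v, h1, h2⟩ := HV_meet hn hK hM hi hj hQ0 hQ
    exact ((hQ0.con x hxQ v h1).mono subset_rfl sQ0).trans ((hQ.con v h2 z hz).mono hS sQ)

lemma Ctilde_finite (ω : Config) (n : ℕ) : (Ctilde ω n).Finite :=
  (Finset.finite_toSet _).subset (Ctilde_sub ω n)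

lemma compIn_sub (ω : Config) (n : ℕ) (x : Vert) : compIn ω n x ⊆ Ctilde ω n := inter_subset_right

lemma compIn_finite (ω : Config) (n : ℕ) (x : Vert) : (compIn ω n x).Finite :=
  (Ctilde_finite ω n).subset (compIn_sub ω n x)

lemma con_compIn (ω : Config) (n : ℕ) {x : Vert} (hx : x ∈ Ctilde ω n) :
    Con (So ω) (compIn ω n x) := by
  rw [compIn_eq _ _ hx]
  exact con_comp _ _ _

/-- A path from the left of column `k` to the right of it uses an edge. -/
lemma exit_col {T : Set Edge} {Q : Set Vert} {x y : Vert} {k : ℤ} (h : conn T Q x y)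
    (hx : x.1 ≤ k) (hy : k < y.1) : ∃ v ∈ Q, v.1 = k ∧ (v, false) ∈ T := by
  rcases conn_exit h (D := {v | v.1 ≤ k}) hx with h1 | ⟨w, w', h1, ha, _, hw⟩
  · have := h1.right.2
    rw [mem_ofPred_eq] at this
    omega
  · have hwk : w.1 ≤ k := h1.right.2
    rw [mem_ofPred_eq] at hw
    refine ⟨w, h1.right.1, ?_⟩
    rcases adj_cases ha with ⟨e, h⟩ | ⟨e, h⟩ | ⟨e, h⟩ | ⟨e, h⟩
    · rw [h] at hw; dsimp only at hw
      exact ⟨by omega, e⟩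
    all_goals
      have h1 := congrArg Prod.fst h
      dsimp only at h1
      omega

/-- Density of the big component. -/
lemma big_dense {ω : Config} {n K M r : ℕ} (g : Good ω n K M r) {x : Vert}
    (hx : ∀ S ⊆ So ω, ∀ j < M, ∀ Q, (HS S n K j Q ∨ VS S n K j Q) → Q ⊆ compIn ω n x) :
    2 * n * M * (r + 1) ≤ (compIn ω n x).ncard := by
  classical
  have hfin := compIn_finite ω n x
  set C := hfin.toFinset with hC
  rw [ncard_eq_toFinset_card _ hfin, ← hC]
  have hcell : ∀ c ∈ Finset.Icc (-n : ℤ) (n - 1) ×ˢ Finset.range M,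
      r + 1 ≤ (C.filter fun v => v.1 = c.1 ∧ v ∈ strip n K c.2).card := by
    rintro ⟨k, j⟩ hc
    rw [Finset.mem_product, Finset.mem_Icc, Finset.mem_range] at hc
    obtain ⟨⟨hk1, hk2⟩, hj⟩ := hc
    dsimp only at hk1 hk2 hj ⊢
    by_contra hcon
    set B : Finset Edge := (C.filter fun v => v.1 = k ∧ v ∈ strip n K j).image fun v => (v, false)
    have hB : B.card ≤ r := Finset.card_image_le.trans (by omega)
    obtain ⟨Q, hQ⟩ := LR_HC (g.hg.strips j hj B hB)
    have hQC := hx _ sdiff_subset j hj Q (Or.inl hQ)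
    obtain ⟨a, ha, ha'⟩ := hQ.left
    obtain ⟨b, hb, hb'⟩ := hQ.right
    obtain ⟨v, hv, hvk, he⟩ := exit_col (k := k) (hQ.con a ha b hb) (by omega) (by omega)
    refine he.2 ?_
    rw [Finset.mem_coe]
    refine Finset.mem_image_of_mem _ (Finset.mem_filter.2 ⟨?_, hvk, ?_⟩)
    · rw [hC, Set.Finite.mem_toFinset]; exact hQC hv
    · exact hQ.sub hv
  have h1 := Finset.card_nsmul_le_sum _ _ _ hcell
  rw [← Finset.card_biUnion] at h1
  · have h2 := h1.trans (Finset.card_le_card (t := C) ?_)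
    · rw [Finset.card_product, Int.card_Icc, Finset.card_range, smul_eq_mul] at h2
      have : ((n : ℤ) - 1 + 1 - -n).toNat = 2 * n := by omega
      rwa [this] at h2
    · intro v hv
      rw [Finset.mem_biUnion] at hv
      obtain ⟨c, _, hv⟩ := hv
      exact (Finset.mem_filter.1 hv).1
  · intro c _ c' _ hne
    rw [Function.onFun, Finset.disjoint_left]
    intro v hv hv'
    rw [Finset.mem_filter] at hv hv'
    exact hne (Prod.ext (hv.2.1.symm.trans hv'.2.1) (strip_disj hv.2.2 hv'.2.2))

/-- Properties of the giant component. -/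
structure GG (ω : Config) (n K M r : ℕ) : Prop where
  ex : ∃ x ∈ Ctilde ω n, giant ω n = compIn ω n x
  cr : ∀ S ⊆ So ω, ∀ j < M, ∀ Q, (HS S n K j Q ∨ VS S n K j Q) → Q ⊆ giant ω n
  big : 2 * n * M * (r + 1) ≤ (giant ω n).ncard

lemma giant_good {ω : Config} {n K M r : ℕ} (g : Good ω n K M r)
    (hbig : 4 * K ^ 2 < 2 * n * M * (r + 1)) : GG ω n K M r := by
  obtain ⟨x, hx, hcr⟩ := exists_big g
  have hd := big_dense g hcr
  have hmax : ∃ z, z ∈ Ctilde ω n ∧ ∀ y ∈ Ctilde ω n, (compIn ω n y).ncard ≤ (compIn ω n z).ncard := by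
    obtain ⟨z, hz, hz'⟩ := exists_max_image (Ctilde ω n) (fun y => (compIn ω n y).ncard)
      (Ctilde_finite ω n) ⟨x, hx⟩
    exact ⟨z, hz, hz'⟩
  have heps := Classical.epsilon_spec hmax
  set z := Classical.epsilon fun x =>
    x ∈ Ctilde ω n ∧ ∀ y ∈ Ctilde ω n, (compIn ω n y).ncard ≤ (compIn ω n x).ncard with hz
  have hgz : giant ω n = compIn ω n z := rfl
  have hzC := heps.1
  have hzx : conn (So ω) (Ctilde ω n) x z := by
    by_contra hcon
    have hdis : ∀ v, v ∈ compIn ω n x → v ∈ compIn ω n z → False := by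
      intro v h1 h2
      rw [compIn_eq _ _ hx] at h1
      rw [compIn_eq _ _ hzC] at h2
      exact hcon (conn.trans h1 (conn.symm h2))
    obtain ⟨m, m', h1, h2, h3⟩ := comp_small (X := compIn ω n z) g.hn g.hK g.hM' g.hg g.hg'
      ((compIn_sub _ _ _).trans (Ctilde_sub ω n)) ((con_compIn ω n hzC).mono (subset_univ _)) ∅
      (by
        intro j hj Q hQ
        rw [disjoint_left]
        exact fun v hv hv' => hdis v (hcr _ sdiff_subset j hj Q (Or.inl hQ) hv) hv')
      (by
        intro j hj Q hQ
        rw [disjoint_left]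
        exact fun v hv hv' => hdis v (hcr _ sdiff_subset j hj Q (Or.inr hQ) hv) hv')
    rw [Finset.card_empty] at h1 h2
    have e1 : m = 0 := by
      rcases Nat.eq_zero_or_pos m with h | h
      · exact h
      · have : 0 < m * (r + 1) := by positivity
        omega
    have e2 : m' = 0 := by
      rcases Nat.eq_zero_or_pos m' with h | h
      · exact h
      · have : 0 < m' * (r + 1) := by positivity
        omega
    subst e1 e2
    have h4 := heps.2 x hx
    have : ((0 + 2) * K) * ((0 + 2) * K) = 4 * K ^ 2 := by ring
    omega
  have heq : compIn ω n z = compIn ω n x := by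
    rw [compIn_eq _ _ hzC, compIn_eq _ _ hx]
    ext v
    exact ⟨fun h => conn.trans hzx h, fun h => conn.trans hzx.symm h⟩
  refine ⟨⟨z, hzC, hgz⟩, ?_, ?_⟩
  · rw [hgz, heq]; exact hcr
  · rw [hgz, heq]; exact hd

end Perc

open MeasureTheory Set Filter

namespace Perc

lemma edgeBdry_finite {ω : Config} {G : Set Vert} (hG : G.Finite) (Y : Set Vert) :
    (edgeBdry ω G Y).Finite := by
  refine (hG.prod (finite_univ (α := Bool))).subset ?_
  rintro ⟨v, b⟩ h
  exact ⟨h.2.1, mem_univ _⟩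

lemma adj_bdry {ω : Config} {G X : Set Vert} {w w' : Vert} {T : Set Edge} (hT : T ⊆ So ω)
    (hd : ∀ e ∈ T, e ∉ edgeBdry ω G X)
    (h : adj T w w') (hw : w ∈ G) (hw' : w' ∈ G) (hX : w ∈ X) : w' ∈ X := by
  by_contra hcon
  obtain ⟨e, he, ⟨h1, h2⟩ | ⟨h1, h2⟩⟩ := h
  · refine hd e he ⟨hT he, ?_, ?_, Or.inl ⟨?_, ?_⟩⟩ <;> simpa only [h1, h2]
  · refine hd e he ⟨hT he, ?_, ?_, Or.inr ⟨?_, ?_⟩⟩ <;> simpa only [h1, h2]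

lemma side {ω : Config} {G X Q : Set Vert} (hc : Con (So ω \ edgeBdry ω G X) Q) (hQ : Q ⊆ G)
    {q : Vert} (hq : q ∈ Q) (hqX : q ∈ X) : Q ⊆ X := by
  intro z hz
  refine (hc q hq z hz).induct (Q := fun z => z ∈ X) (fun _ => hqX) ?_
  intro y z hy ih ha hzQ
  exact adj_bdry sdiff_subset (fun e he => he.2) ha (hQ hy.right) (hQ hzQ) ih

lemma bdry_compl {ω : Config} {G Y : Set Vert} (hY : Y ⊆ G) :
    edgeBdry ω G (G \ Y) = edgeBdry ω G Y := by
  ext e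
  simp only [edgeBdry, mem_ofPred_eq, Set.mem_sdiff]
  tauto

lemma bdry_split {ω : Config} {G Y : Set Vert} {y : Vert}
    (hG : G.Finite) :
    (edgeBdry ω G {z | conn (So ω) Y y z}).ncard +
      (edgeBdry ω G (Y \ {z | conn (So ω) Y y z})).ncard ≤ (edgeBdry ω G Y).ncard := by
  set X := {z | conn (So ω) Y y z} with hX
  have hXY : ∀ z ∈ X, z ∈ Y := fun z hz => conn.right hz
  have hcl : ∀ e : Edge, ω e = true → (e.1 ∈ X → edgeTip e ∈ Y → edgeTip e ∈ X) ∧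
      (edgeTip e ∈ X → e.1 ∈ Y → e.1 ∈ X) := by
    intro e he
    exact ⟨fun h1 h2 => conn.tail h1 (adj_edge he) h2,
      fun h1 h2 => conn.tail h1 (adj_edge (S := So ω) he).symm h2⟩
  rw [← ncard_union_eq _ (edgeBdry_finite hG _) (edgeBdry_finite hG _)]
  · refine ncard_le_ncard ?_ (edgeBdry_finite hG _)
    rintro e (he | he)
    · have := hcl e he.1
      have a1 := hXY e.1
      have a2 := hXY (edgeTip e)
      simp only [edgeBdry, mem_ofPred_eq] at he ⊢
      tauto
    · have := hcl e he.1
      have a1 := hXY e.1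
      have a2 := hXY (edgeTip e)
      simp only [edgeBdry, mem_ofPred_eq, Set.mem_sdiff] at he ⊢
      tauto
  · rw [disjoint_left]
    intro e he he'
    have := hcl e he.1
    have a1 := hXY e.1
    have a2 := hXY (edgeTip e)
    simp only [edgeBdry, mem_ofPred_eq, Set.mem_sdiff] at he he'
    tauto

lemma est {b B K m m' r X : ℕ} {δ : ℝ} (hδ : 0 < δ) (hr : δ * K ≤ r + 1) (h1 : m * (r + 1) ≤ b)
    (h2 : m' * (r + 1) ≤ b) (hX : X ≤ ((m' + 2) * K) * ((m + 2) * K)) (hb : 1 ≤ b) (hB : b ≤ B) :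
    (X : ℝ) ≤ b * (2 * B / δ ^ 2 + 8 * K ^ 2) := by
  have key : ∀ m : ℕ, m * (r + 1) ≤ b → ((m : ℝ) + 2) * K ≤ b / δ + 2 * K := by
    intro m hm
    have hm' : (m : ℝ) * (r + 1) ≤ b := by exact_mod_cast hm
    have : (m : ℝ) * K ≤ b / δ := by
      rw [le_div_iff₀ hδ]
      calc (m : ℝ) * K * δ = m * (δ * K) := by ring
        _ ≤ m * (r + 1) := by gcongr
        _ ≤ b := hm'
    linarith
  have hX' : (X : ℝ) ≤ ((m' + 2) * K) * ((m + 2) * K) := by exact_mod_cast hX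
  have hb' : (1 : ℝ) ≤ b := by exact_mod_cast hb
  have hB' : (b : ℝ) ≤ B := by exact_mod_cast hB
  have k1 := key m h1
  have k2 := key m' h2
  have h3 : (X : ℝ) ≤ (b / δ + 2 * K) * (b / δ + 2 * K) := by
    refine hX'.trans ?_
    gcongr
  set u := (b : ℝ) / δ with hu
  have h4 : (u + 2 * K) * (u + 2 * K) ≤ 2 * u ^ 2 + 8 * K ^ 2 := by
    nlinarith [sq_nonneg (u - 2 * K)]
  have h5 : u ^ 2 ≤ b * (B / δ ^ 2) := by
    rw [hu, div_pow, ← mul_div_assoc]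
    gcongr
    nlinarith
  have h6 : (K : ℝ) ^ 2 ≤ b * K ^ 2 := le_mul_of_one_le_left (by positivity) hb'
  have : (b : ℝ) * (2 * B / δ ^ 2 + 8 * K ^ 2) = 2 * (b * (B / δ ^ 2)) + 8 * (b * K ^ 2) := by ring
  rw [this]
  linarith

lemma sum_comp {ω : Config} {n K M r : ℕ} (g : Good ω n K M r) (gg : GG ω n K M r) {δ : ℝ}
    (hδ : 0 < δ) (hr : δ * K ≤ r + 1) {S : Set Edge} (hS : S ⊆ So ω) {i j : ℕ} (hi : i < M) (hj : j < M)
    {Q Z : Set Vert}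
    (hQ : HS S n K i Q) (hZ : VS S n K j Z) (B : ℕ) :
    ∀ k : ℕ, ∀ Y : Set Vert, Y.ncard ≤ k → Y ⊆ giant ω n → Disjoint Q Y → Disjoint Z Y →
      (edgeBdry ω (giant ω n) Y).ncard ≤ B →
      (Y.ncard : ℝ) ≤ (edgeBdry ω (giant ω n) Y).ncard * (2 * B / δ ^ 2 + 8 * K ^ 2) := by
  obtain ⟨x0, hx0, hgx⟩ := gg.ex
  have hGf : (giant ω n).Finite := by rw [hgx]; exact compIn_finite _ _ _
  have hGc : Con (So ω) (giant ω n) := by rw [hgx]; exact con_compIn _ _ hx0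
  have hGs : giant ω n ⊆ Ctilde ω n := by rw [hgx]; exact compIn_sub _ _ _
  have hA : (0 : ℝ) ≤ 2 * B / δ ^ 2 + 8 * K ^ 2 := by positivity
  intro k
  induction k with
  | zero =>
    intro Y hY _ _ _ _
    have : Y.ncard = 0 := by omega
    rw [this, Nat.cast_zero]
    positivity
  | succ k ih =>
    intro Y hYk hYG hQY hZY hYB
    have hYf : Y.Finite := hGf.subset hYG
    rcases Y.eq_empty_or_nonempty with rfl | ⟨y, hy⟩
    · rw [ncard_empty, Nat.cast_zero]; positivity
    have hsp := bdry_split (ω := ω) (Y := Y) (y := y) hGf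
    set X := {z | conn (So ω) Y y z} with hX
    have hXY : X ⊆ Y := fun z hz => conn.right hz
    have hXc : Con (So ω) X := con_comp _ _ _
    have hyX : y ∈ X := conn.refl hy
    have hXG := hXY.trans hYG
    have hXf := hYf.subset hXY
    have hd1 : (Y \ X).ncard + X.ncard = Y.ncard := ncard_sdiff_add_ncard_of_subset hXY hYf
    have hXpos : 0 < X.ncard := (ncard_pos hXf).2 ⟨y, hyX⟩
    have ih' := ih (Y \ X) (by omega) (sdiff_subset.trans hYG) (hQY.mono_right sdiff_subset)
      (hZY.mono_right sdiff_subset) (by omega)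
    have hbf := edgeBdry_finite (ω := ω) hGf X
    have hFc : ((hbf.toFinset : Finset Edge) : Set Edge) = edgeBdry ω (giant ω n) X :=
      hbf.coe_toFinset
    have hQX := hQY.mono_right hXY
    have hZX := hZY.mono_right hXY
    obtain ⟨q0, hq0, hq0'⟩ := hQ.left
    have hb : 1 ≤ (edgeBdry ω (giant ω n) X).ncard := by
      by_contra hcon
      have h0 : (edgeBdry ω (giant ω n) X).ncard = 0 := by omega
      rw [ncard_eq_zero hbf] at h0
      have := side (ω := ω) (G := giant ω n) (X := X) (Q := giant ω n)
        (by rw [h0, sdiff_empty]; exact hGc) subset_rfl (hXG hyX) hyX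
      exact disjoint_left.1 hQX hq0 (this (gg.cr S hS i hi Q (Or.inl hQ) hq0))
    obtain ⟨m, m', h1, h2, h3⟩ := comp_small (X := X) g.hn g.hK g.hM' g.hg g.hg'
      ((hXG.trans hGs).trans (Ctilde_sub ω n)) (hXc.mono (subset_univ _)) hbf.toFinset
      (by
        intro l hl Q' hQ'
        rw [hFc] at hQ'
        rw [disjoint_left]
        intro v hv hvX
        have hs := side hQ'.con (gg.cr _ sdiff_subset l hl Q' (Or.inl hQ')) hv hvX
        obtain ⟨w, hw1, hw2⟩ := HV_meet g.hn g.hK g.hM hl hj hQ' hZ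
        exact disjoint_left.1 hZX hw2 (hs hw1))
      (by
        intro l hl Q' hQ'
        rw [hFc] at hQ'
        rw [disjoint_left]
        intro v hv hvX
        have hs := side hQ'.con (gg.cr _ sdiff_subset l hl Q' (Or.inr hQ')) hv hvX
        obtain ⟨w, hw1, hw2⟩ := HV_meet g.hn g.hK g.hM hi hl hQ hQ'
        exact disjoint_left.1 hQX hw1 (hs hw2))
    rw [← ncard_eq_toFinset_card _ hbf] at h1 h2
    have hXest := est (B := B) hδ hr h1 h2 h3 hb (by omega)
    have hd2 : ((Y \ X).ncard : ℝ) + X.ncard = Y.ncard := by exact_mod_cast hd1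
    have hsp2 : ((edgeBdry ω (giant ω n) X).ncard : ℝ) + (edgeBdry ω (giant ω n) (Y \ X)).ncard ≤
      (edgeBdry ω (giant ω n) Y).ncard := by exact_mod_cast hsp
    have := mul_le_mul_of_nonneg_right hsp2 hA
    rw [add_mul] at this
    linarith

lemma phi_le {ω : Config} {n : ℕ} (hG : giant ω n ⊆ (rect (-n) n (-n) n : Set Vert))
    (hN : 2 * (2 * n + 1) < (giant ω n).ncard) :
    Phi ω n ≤ (2 * n + 1) / (((giant ω n).ncard : ℝ) / 2 - (2 * n + 1)) := by
  classical
  have hGf : (giant ω n).Finite := (Finset.finite_toSet _).subset hG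
  set G := giant ω n with hGdef
  set f : ℕ → Set Vert := fun i => G ∩ {v | v.1 ≤ -n - 1 + i} with hf
  have hffin : ∀ i, (f i).Finite := fun i => hGf.subset inter_subset_left
  have f0 : (f 0).ncard = 0 := by
    rw [ncard_eq_zero (hffin 0), eq_empty_iff_forall_notMem]
    rintro v ⟨h1, h2⟩
    have := hG h1
    rw [Finset.mem_coe, mem_rect] at this
    rw [mem_ofPred_eq] at h2
    push_cast at h2
    omega
  have f1 : f (2 * n + 1) = G := by
    refine inter_eq_left.2 fun v hv => ?_
    have := hG hv
    rw [Finset.mem_coe, mem_rect] at this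
    rw [mem_ofPred_eq]
    push_cast
    omega
  have hex : ∃ i, G.ncard < 2 * (f i).ncard := ⟨2 * n + 1, by rw [f1]; omega⟩
  obtain ⟨i, hi⟩ : ∃ i, Nat.find hex = i + 1 := by
    refine Nat.exists_eq_succ_of_ne_zero ?_
    intro h0
    have := Nat.find_spec hex
    rw [h0, f0] at this
    omega
  have hi1 := Nat.find_spec hex
  rw [hi] at hi1
  have hi2 : ¬ G.ncard < 2 * (f i).ncard := Nat.find_min hex (by omega)
  have hstep : (f (i + 1)).ncard ≤ (f i).ncard + (2 * n + 1) := by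
    have hsub : f (i + 1) ⊆ f i ∪ (rect (-n + i) (-n + i) (-n) n : Set Vert) := by
      rintro v ⟨h1, h2⟩
      have := hG h1
      rw [Finset.mem_coe, mem_rect] at this
      rw [mem_ofPred_eq] at h2
      push_cast at h2
      by_cases h : v.1 ≤ -n - 1 + i
      · exact Or.inl ⟨h1, h⟩
      · right
        rw [Finset.mem_coe, mem_rect]
        omega
    refine (ncard_le_ncard hsub ((hffin i).union (Finset.finite_toSet _))).trans ?_
    refine (ncard_union_le _ _).trans ?_
    rw [ncard_coe_finset, rect, Finset.card_product, Int.card_Icc, Int.card_Icc]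
    have e1 : (-(n : ℤ) + i + 1 - (-n + i)).toNat = 1 := by omega
    have e2 : ((n : ℤ) + 1 - -n).toNat = 2 * n + 1 := by omega
    rw [e1, e2, one_mul]
  have hbd : (edgeBdry ω G (f i)).ncard ≤ 2 * n + 1 := by
    have hsub : edgeBdry ω G (f i) ⊆
        (((Finset.Icc (-n : ℤ) n).image fun y => (((-n - 1 + i, y), false) : Edge)) : Finset Edge) := by
      rintro ⟨v, b⟩ ⟨_, h1, h2, h3⟩
      rw [Finset.mem_coe, Finset.mem_image]
      have hv := hG h1
      rw [Finset.mem_coe, mem_rect] at hv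
      dsimp only at hv
      simp only [hf, mem_inter_iff, h1, h2, true_and, mem_ofPred_eq] at h3
      refine ⟨v.2, Finset.mem_Icc.2 ⟨hv.2.2.1, hv.2.2.2⟩, ?_⟩
      cases b
      · rw [tip_false] at h3
        dsimp only at h3
        refine Prod.ext (Prod.ext ?_ rfl) rfl
        dsimp only
        omega
      · rw [tip_true] at h3
        dsimp only at h3
        omega
    refine (ncard_le_ncard hsub (Finset.finite_toSet _)).trans ?_
    rw [ncard_coe_finset]
    refine Finset.card_image_le.trans ?_
    rw [Int.card_Icc]
    omega
  have hpos : 0 < (f i).ncard := by omega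
  have hle : Phi ω n ≤ ((edgeBdry ω G (f i)).ncard : ℝ) / (f i).ncard := by
    refine csInf_le ⟨0, ?_⟩ ⟨f i, inter_subset_left, hpos, show 2 * (f i).ncard ≤ G.ncard by omega, rfl⟩
    rintro r ⟨H, _, _, _, rfl⟩
    positivity
  refine hle.trans ?_
  have h5 : (G.ncard : ℝ) < 2 * ((f i).ncard + (2 * n + 1)) := by
    exact_mod_cast lt_of_lt_of_le hi1 (by omega)
  have h6 : (2 * (2 * n + 1) : ℝ) < G.ncard := by exact_mod_cast hN
  have h7 : ((edgeBdry ω G (f i)).ncard : ℝ) ≤ 2 * n + 1 := by exact_mod_cast hbd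
  gcongr
  · linarith
  · linarith

lemma det {ω : Config} {n K M r : ℕ} (g : Good ω n K M r) {δ : ℝ}
    (hδ : 0 < δ) (hδ1 : δ ≤ 1) (hr : δ * K ≤ r + 1) (hMK : n ≤ M * K)
    (c1 : 4 * (K : ℝ) ^ 2 < 2 * δ * n ^ 2) (c2 : 2 * (n : ℝ) + 1 ≤ δ * n ^ 2 / 2)
    (c3 : 96 * (K : ℝ) ^ 2 ≤ δ * n) {H : Set Vert} (hH : H ∈ optimizers ω n) :
    δ ^ 4 / 144 * (n : ℝ) ^ 2 ≤ H.ncard := by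
  have hMK' : (n : ℝ) ≤ M * K := by exact_mod_cast hMK
  have hn1 : (1 : ℝ) ≤ n := by exact_mod_cast g.hn
  have hKM : δ * n ≤ (r + 1) * M := by
    calc δ * n ≤ δ * (M * K) := by gcongr
      _ = (δ * K) * M := by ring
      _ ≤ (r + 1) * M := by gcongr
  have hbig : 2 * δ * n ^ 2 ≤ (2 * n * M * (r + 1) : ℝ) := by
    have : 2 * δ * (n : ℝ) ^ 2 = 2 * n * (δ * n) := by ring
    rw [this]
    calc 2 * (n : ℝ) * (δ * n) ≤ 2 * n * ((r + 1) * M) := by gcongr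
      _ = _ := by ring
  have gg : GG ω n K M r := giant_good g (by
    have : (4 * K ^ 2 : ℝ) < 2 * n * M * (r + 1) := by linarith
    exact_mod_cast this)
  obtain ⟨x0, hx0, hgx⟩ := gg.ex
  have hGf : (giant ω n).Finite := by rw [hgx]; exact compIn_finite _ _ _
  have hGs : giant ω n ⊆ Ctilde ω n := by rw [hgx]; exact compIn_sub _ _ _
  have hN : (2 * n * M * (r + 1) : ℝ) ≤ (giant ω n).ncard := by exact_mod_cast gg.big
  have hphi : Phi ω n ≤ 6 / (δ * n) := by
    have h2 : (0 : ℝ) < δ * n ^ 2 := by positivity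
    refine (phi_le (hGs.trans (Ctilde_sub ω n)) ?_).trans ?_
    · have : (2 * (2 * n + 1) : ℝ) < (giant ω n).ncard := by linarith
      exact_mod_cast this
    · have h1 : δ * n ^ 2 / 2 ≤ ((giant ω n).ncard : ℝ) / 2 - (2 * n + 1) := by linarith
      rw [div_le_div_iff₀ (by linarith) (by positivity)]
      calc (2 * (n : ℝ) + 1) * (δ * n) ≤ (3 * n) * (δ * n) := by gcongr; linarith
        _ = 6 * (δ * n ^ 2 / 2) := by ring
        _ ≤ _ := by gcongr
  obtain ⟨hHG, hHpos, hHhalf, hHeq⟩ := hH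
  set b := (edgeBdry ω (giant ω n) H).ncard with hb
  have hHpos' : (0 : ℝ) < H.ncard := by exact_mod_cast hHpos
  have hratio : (b : ℝ) * (δ * n) ≤ 6 * H.ncard := by
    rw [← hHeq, div_le_div_iff₀ hHpos' (by positivity)] at hphi
    exact hphi
  have hp4 : δ ^ 4 ≤ δ ^ 2 := pow_le_pow_of_le_one hδ.le hδ1 (by norm_num)
  by_cases hcase : (r + 1) * M ≤ b
  · have : ((r + 1) * M : ℝ) ≤ b := by exact_mod_cast hcase
    have h1 : δ * n ≤ b := hKM.trans this
    have h2 : (δ * n) * (δ * n) ≤ b * (δ * n) := by gcongr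
    have h3 : δ ^ 4 * (n : ℝ) ^ 2 ≤ δ ^ 2 * n ^ 2 := by gcongr
    have h4 : 0 ≤ δ ^ 4 * (n : ℝ) ^ 2 := by positivity
    nlinarith
  · push Not at hcase
    have hbf := edgeBdry_finite (ω := ω) hGf H
    have hFc : ((hbf.toFinset : Finset Edge) : Set Edge) = edgeBdry ω (giant ω n) H :=
      hbf.coe_toFinset
    have hFcard : hbf.toFinset.card < (r + 1) * M := by
      rw [← ncard_eq_toFinset_card _ hbf]; exact hcase
    obtain ⟨i, hi, Q, hQ⟩ := exists_HS g.hg _ hFcard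
    obtain ⟨j, hj, Z, hZ⟩ := exists_VS g.hg' _ hFcard
    rw [hFc] at hQ hZ
    obtain ⟨v, hvQ, hvZ⟩ := HV_meet g.hn g.hK g.hM hi hj hQ hZ
    have hQG := gg.cr _ sdiff_subset i hi Q (Or.inl hQ)
    have hZG := gg.cr _ sdiff_subset j hj Z (Or.inr hZ)
    have hest : (H.ncard : ℝ) ≤ b * (2 * b / δ ^ 2 + 8 * K ^ 2) := by
      by_cases hvH : v ∈ H
      · have sQ := side hQ.con hQG hvQ hvH
        have sZ := side hZ.con hZG hvZ hvH
        have := sum_comp g gg hδ hr sdiff_subset hi hj hQ hZ b _ (giant ω n \ H) le_rfl sdiff_subset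
          (disjoint_left.2 fun a h1 h2 => h2.2 (sQ h1))
          (disjoint_left.2 fun a h1 h2 => h2.2 (sZ h1)) (by rw [bdry_compl hHG])
        rw [bdry_compl hHG, ← hb] at this
        have h1 := ncard_sdiff_add_ncard_of_subset hHG hGf
        have h2 : (H.ncard : ℝ) ≤ (giant ω n \ H).ncard := by
          have : H.ncard ≤ (giant ω n \ H).ncard := by omega
          exact_mod_cast this
        exact h2.trans this
      · exact sum_comp g gg hδ hr sdiff_subset hi hj hQ hZ b _ H le_rfl hHG
          (disjoint_left.2 fun a h1 h2 => hvH (side hQ.con hQG h1 h2 hvQ))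
          (disjoint_left.2 fun a h1 h2 => hvH (side hZ.con hZG h1 h2 hvZ)) le_rfl
    have hbpos : (0 : ℝ) < b := by
      rcases Nat.eq_zero_or_pos b with h | h
      · rw [h, Nat.cast_zero, zero_mul] at hest
        linarith
      · exact_mod_cast h
    have h1 : (b : ℝ) * (δ * n) ≤ b * (6 * (2 * b / δ ^ 2 + 8 * K ^ 2)) := by
      refine hratio.trans ?_
      linarith
    have h2 : δ * n ≤ 6 * (2 * b / δ ^ 2 + 8 * K ^ 2) := le_of_mul_le_mul_left h1 hbpos
    have h3 : δ * n / 2 ≤ 12 * b / δ ^ 2 := by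
      have : 6 * (2 * (b : ℝ) / δ ^ 2 + 8 * K ^ 2) = 12 * b / δ ^ 2 + 48 * K ^ 2 := by ring
      linarith
    rw [le_div_iff₀ (by positivity)] at h3
    have h4 : δ ^ 3 * n / 24 ≤ b := by nlinarith
    have h5 : δ ^ 3 * n / 24 * (δ * n) ≤ b * (δ * n) := by gcongr
    nlinarith

end Perc

open MeasureTheory Set Filter

namespace Perc

/-- Probability estimate for the failure of the good event. -/
lemma good0_fail {p C0 c0 ε : ℝ} {r K : ℕ} (hc0 : 0 < c0) (hC0 : 0 < C0) (hε : 0 ≤ ε) {n M : ℕ}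
    (hs : ∀ j < M, Pr p (robust r {S | LR S (-n) n (-n + j * K) (-n + j * K + K - 1)})ᶜ ≤ ε)
    (hw : ∀ N : ℕ, Pr p {S | LR S (-N - 1) (N + 1) (-N) N}ᶜ ≤ C0 * Real.exp (-c0 * N))
    (ν : Measure (Config)) (φ : Config → Set Edge)
    (hφ : ∀ A : Set (Set Edge), IsLoc A → ν {ω | φ ω ∈ A} ≤ ENNReal.ofReal (Pr p A)) :
    ν {ω | ¬ Good0 (φ ω) n K M r} ≤
      ENNReal.ofReal (M * ε + C0 / (1 - Real.exp (-c0)) * Real.exp (-c0 * n)) := by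
  have hx1 : Real.exp (-c0) < 1 := by rw [Real.exp_lt_one_iff]; linarith
  have hx0 := Real.exp_pos (-c0)
  set x := Real.exp (-c0) with hx
  have hsub : {ω | ¬ Good0 (φ ω) n K M r} ⊆
      (⋃ j ∈ Finset.range M, {ω | φ ω ∈
        (robust r {S | LR S (-n) n (-n + j * K) (-n + j * K + K - 1)})ᶜ}) ∪
      ⋃ N : ℕ, {ω | φ ω ∈ {S | LR S (-((n + N : ℕ) : ℤ) - 1) (((n + N : ℕ) : ℤ) + 1)
        (-((n + N : ℕ) : ℤ)) ((n + N : ℕ) : ℤ)}ᶜ} := by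
    intro ω hω
    by_contra hcon
    refine hω ⟨?_, ?_⟩
    · intro j hj
      by_contra h
      exact hcon (Or.inl (mem_biUnion (Finset.mem_coe.2 (Finset.mem_range.2 hj)) h))
    · intro N hN
      by_contra h
      refine hcon (Or.inr (mem_iUnion.2 ⟨N - n, ?_⟩))
      rw [mem_ofPred_eq, Nat.add_sub_cancel' hN]
      exact h
  refine (measure_mono hsub).trans ((measure_union_le _ _).trans ?_)
  have h1 : ν (⋃ j ∈ Finset.range M, {ω | φ ω ∈
        (robust r {S | LR S (-n) n (-n + j * K) (-n + j * K + K - 1)})ᶜ}) ≤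
      M * ENNReal.ofReal ε := by
    refine (measure_biUnion_finset_le _ _).trans ?_
    refine (Finset.sum_le_card_nsmul _ _ (ENNReal.ofReal ε) ?_).trans ?_
    · intro j hj
      refine (hφ _ ?_).trans (ENNReal.ofReal_le_ofReal (hs j (Finset.mem_range.1 hj)))
      obtain ⟨F, hF⟩ := isLoc_LR (-n) n (-n + j * K) (-n + j * K + K - 1)
      exact ⟨F, (hF.robust r).compl⟩
    · rw [Finset.card_range, nsmul_eq_mul]
  have h2 : ν (⋃ N : ℕ, {ω | φ ω ∈ {S | LR S (-((n + N : ℕ) : ℤ) - 1) (((n + N : ℕ) : ℤ) + 1)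
        (-((n + N : ℕ) : ℤ)) ((n + N : ℕ) : ℤ)}ᶜ}) ≤
      ENNReal.ofReal (C0 / (1 - x) * Real.exp (-c0 * n)) := by
    have hsum : C0 / (1 - x) * Real.exp (-c0 * n) = ∑' N : ℕ, (C0 * Real.exp (-c0 * n)) * x ^ N := by
      rw [tsum_mul_left, tsum_geometric_of_lt_one hx0.le hx1]
      ring
    rw [hsum, ENNReal.ofReal_tsum_of_nonneg (fun N => by positivity)
      ((summable_geometric_of_lt_one hx0.le hx1).mul_left _)]
    refine (measure_iUnion_le _).trans (ENNReal.tsum_le_tsum fun N => ?_)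
    refine (hφ _ (isLoc_LR _ _ _ _).compl).trans (ENNReal.ofReal_le_ofReal ?_)
    refine (hw (n + N)).trans (le_of_eq ?_)
    rw [hx, ← Real.exp_nat_mul, mul_assoc, ← Real.exp_add]
    congr 2
    push_cast
    ring
  have hd : 0 < 1 - x := by linarith
  rw [ENNReal.ofReal_add (by positivity) (by positivity), ENNReal.ofReal_mul (by positivity),
    ENNReal.ofReal_natCast]
  exact add_le_add h1 h2

/-- Crossing estimates. -/
lemma cross_est {p : ℝ} (hp : 1 / 2 < p) (hp1 : p < 1) :
    ∃ C c δ : ℝ, 0 < C ∧ 0 < c ∧ 0 < δ ∧ δ ≤ 1 ∧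
      (∀ n j K : ℕ, 1 ≤ K → Pr p (robust ⌊δ * K⌋₊
        {S | LR S (-n) n (-n + j * K) (-n + j * K + K - 1)})ᶜ ≤ C * n * Real.exp (-c * K)) ∧
      (∀ N : ℕ, Pr p {S | LR S (-N - 1) (N + 1) (-N) N}ᶜ ≤ C * Real.exp (-c * N)) := by
  have h0 : 0 ≤ p := by linarith
  set p' := (1 / 2 + p) / 2 with hp'
  have hp'1 : 1 / 2 < p' := by rw [hp']; linarith
  have hp'2 : p' < p := by rw [hp']; linarith
  obtain ⟨C0, c0, hC0, hc0, hdec⟩ := exp_decay (q := 1 - p') (by linarith) (by linarith)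
  set ρ := p' / p with hρ
  have hρ0 : 0 < ρ := by rw [hρ]; apply div_pos <;> linarith
  have hρ1 : ρ < 1 := by rw [hρ, div_lt_one (by linarith)]; exact hp'2
  have hpρ : p * ρ = p' := by rw [hρ]; field_simp
  set L := -Real.log (1 - ρ) with hL
  have hL0 : 0 < L := by
    rw [hL, neg_pos]; exact Real.log_neg (by linarith) (by linarith)
  set δ := min 1 (c0 / (2 * L)) with hδ
  have hδ0 : 0 < δ := lt_min one_pos (by positivity)
  have hδL : δ * L ≤ c0 / 2 := by
    calc δ * L ≤ c0 / (2 * L) * L := by gcongr; exact min_le_right _ _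
      _ = c0 / 2 := by field_simp
  refine ⟨max (2 * C0) (2 / c0 * Real.exp c0 * C0), c0 / 2, δ, ?_, by positivity, hδ0, min_le_left _ _, ?_, ?_⟩
  · exact lt_max_of_lt_left (by positivity)
  · intro n j K hK
    set r := ⌊δ * K⌋₊ with hr
    have hrK : (r : ℝ) ≤ δ * K := Nat.floor_le (by positivity)
    have h1 := Pr_robust h0 hp1.le hρ0.le hρ1.le (k := r)
      (isLoc_LR (-n) n (-n + j * K) (-n + j * K + K - 1)) (upper_LR _ _ _ _)
    rw [hpρ] at h1
    have h2 := LR_compl_le (p := p') (by linarith) (by linarith) (a := -n) (b := n)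
      (c := -n + j * K) (d := -n + j * K + K - 1) (by omega) (by omega)
    have e : (-n + j * K + K - 1 : ℤ) - (-n + j * K) + 1 = (K : ℤ) := by ring
    rw [e] at h2
    have h3 := hdec K
    have h4 : (1 - ρ) ^ r = Real.exp (-(L * r)) := by
      rw [hL, neg_mul, neg_neg, mul_comm, Real.exp_nat_mul, Real.exp_log (by linarith)]
    rw [h4] at h1
    have h5 : Pr p (robust r {S | LR S (-n) n (-n + j * K) (-n + j * K + K - 1)})ᶜ ≤
        Real.exp (L * r) * (2 * n * (C0 * Real.exp (-c0 * K))) := by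
      have h6 : Real.exp (-(L * r)) *
          Pr p (robust r {S | LR S (-n) n (-n + j * K) (-n + j * K + K - 1)})ᶜ ≤
          2 * n * (C0 * Real.exp (-c0 * K)) := by
        refine (h1.trans h2).trans ?_
        push_cast
        have : (n : ℝ) - -n = 2 * n := by ring
        rw [this]
        gcongr
      rw [Real.exp_neg, inv_mul_le_iff₀ (Real.exp_pos _)] at h6
      exact h6
    refine h5.trans ?_
    have h7 : Real.exp (L * r) ≤ Real.exp (c0 / 2 * K) := by
      rw [Real.exp_le_exp]
      calc L * r ≤ L * (δ * K) := by gcongr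
        _ = (δ * L) * K := by ring
        _ ≤ c0 / 2 * K := by gcongr
    calc Real.exp (L * r) * (2 * n * (C0 * Real.exp (-c0 * K)))
        ≤ Real.exp (c0 / 2 * K) * (2 * n * (C0 * Real.exp (-c0 * K))) := by gcongr
      _ = 2 * C0 * n * (Real.exp (c0 / 2 * K) * Real.exp (-c0 * K)) := by ring
      _ = 2 * C0 * n * Real.exp (-(c0 / 2) * K) := by
        rw [← Real.exp_add]; congr 2; ring
      _ ≤ _ := by gcongr; exact le_max_left _ _
  · intro N
    have h2 := LR_compl_le (p := p) h0 hp1.le (a := -N - 1) (b := N + 1)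
      (c := -N) (d := N) (by omega) (by omega)
    have e : (N : ℤ) - (-N) + 1 = ((2 * N + 1 : ℕ) : ℤ) := by push_cast; ring
    rw [e] at h2
    have h3 := hdec (2 * N + 1)
    have h4 := Pr_mono_p (p := 1 - p) (q := 1 - p') (by linarith) (by linarith) (by linarith)
      (isLoc_arm 0 ((2 * N + 1 : ℕ) : ℤ)) (upper_arm _ _)
    have h5 : (2 * N + 2 : ℝ) ≤ 2 / c0 * Real.exp c0 * Real.exp (c0 * N) := by
      rw [mul_assoc, ← Real.exp_add]
      have := Real.add_one_le_exp (c0 + c0 * N)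
      calc (2 * N + 2 : ℝ) = 2 / c0 * (c0 + c0 * N) := by field_simp; ring
        _ ≤ _ := by gcongr; linarith
    refine h2.trans ?_
    have e2 : (((N : ℤ) + 1 : ℤ) : ℝ) - ((-N - 1 : ℤ) : ℝ) = 2 * N + 2 := by push_cast; ring
    rw [e2]
    calc (2 * N + 2 : ℝ) * Pr (1 - p) (arm 0 ((2 * N + 1 : ℕ) : ℤ))
        ≤ (2 / c0 * Real.exp c0 * Real.exp (c0 * N)) * (C0 * Real.exp (-c0 * (2 * N + 1 : ℕ))) := by
          gcongr
          · exact Pr_nonneg (by linarith) (by linarith) _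
          · exact h4.trans h3
      _ ≤ (2 / c0 * Real.exp c0 * Real.exp (c0 * N)) * (C0 * Real.exp (-c0 * N - c0 / 2 * N)) := by
          gcongr
          push_cast
          have : 0 ≤ c0 * N := by positivity
          linarith
      _ = (2 / c0 * Real.exp c0 * C0) * (Real.exp (c0 * N) * Real.exp (-c0 * N - c0 / 2 * N)) := by ring
      _ = (2 / c0 * Real.exp c0 * C0) * Real.exp (-(c0 / 2) * N) := by
          rw [← Real.exp_add]; congr 2; ring
      _ ≤ _ := by gcongr; exact le_max_right _ _

/-- Conditions valid for large `n`. -/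
lemma large_n {δ : ℝ} (hδ : 0 < δ) : ∃ n0 : ℕ, ∀ n : ℕ, n0 ≤ n →
    2 * (n : ℝ) + 1 ≤ δ * n ^ 2 / 2 ∧ 96 * ((⌈(Real.log n) ^ 2⌉₊ + 1 : ℕ) : ℝ) ^ 2 ≤ δ * n := by
  have h1 := (Real.isLittleO_pow_log_id_atTop (n := 4)).def (c := δ / 384) (by positivity)
  have h2 := tendsto_natCast_atTop_atTop (R := ℝ) |>.eventually h1
  have h3 := tendsto_natCast_atTop_atTop (R := ℝ) |>.eventually
    (eventually_ge_atTop (max 1 (max (6 / δ) (1536 / δ))))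
  obtain ⟨n0, hn0⟩ := eventually_atTop.1 (h2.and h3)
  refine ⟨n0, fun n hn => ?_⟩
  obtain ⟨a, b⟩ := hn0 n hn
  have b1 : (1 : ℝ) ≤ n := (le_max_left _ _).trans b
  have b2 : 6 / δ ≤ n := ((le_max_left _ _).trans (le_max_right _ _)).trans b
  have b3 : 1536 / δ ≤ n := ((le_max_right _ _).trans (le_max_right _ _)).trans b
  rw [div_le_iff₀ hδ] at b2 b3
  constructor
  · nlinarith
  · simp only [id, Real.norm_eq_abs] at a
    have a2 := (le_abs_self _).trans a
    rw [abs_of_nonneg (by linarith)] at a2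
    set l := Real.log n
    have hc := (Nat.ceil_lt_add_one (sq_nonneg l)).le
    push_cast
    set k : ℝ := (⌈l ^ 2⌉₊ : ℝ)
    have hk : 0 ≤ k := Nat.cast_nonneg _
    have : (k + 1) ^ 2 ≤ (l ^ 2 + 2) ^ 2 :=
      pow_le_pow_left₀ (by positivity) (by linarith) 2
    have : (l ^ 2 + 2) ^ 2 ≤ 2 * l ^ 4 + 8 := by nlinarith [sq_nonneg (l ^ 2 - 2)]
    linarith

set_option maxHeartbeats 2000000 in
theorem main (p : ℝ) (hp : 1/2 < p) (hp1 : p < 1)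
    (P : MeasureTheory.Measure Config) (hP : IsBernoulli P p) :
    ∃ c₁ c₂ α : ℝ, 0 < c₁ ∧ 0 < c₂ ∧ 0 < α ∧ ∀ n : ℕ, 1 ≤ n →
      ENNReal.ofReal (1 - c₁ * Real.exp (-c₂ * (Real.log n) ^ 2)) ≤
        P {ω : Config | ∀ G ∈ optimizers ω n, α * (n : ℝ) ^ 2 ≤ (G.ncard : ℝ)} := by
  have h0 : 0 ≤ p := by linarith
  obtain ⟨C, c, δ, hC, hc, hδ, hδ1, hs, hw⟩ := cross_est hp hp1
  obtain ⟨n0, hn0⟩ := large_n hδ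
  have hprob : IsProbabilityMeasure P := hP.1
  have hx1 : Real.exp (-c) < 1 := by rw [Real.exp_lt_one_iff]; linarith
  have hx2 : 0 < 1 - Real.exp (-c) := by linarith
  set C3 := C / (1 - Real.exp (-c)) with hC3
  have hC3p : 0 < C3 := by positivity
  set c₂ := c / 4 with hc2
  set c₁ := 2 * (3 * C * Real.exp (2 / c) + C3) + Real.exp (c₂ * (Real.log n0) ^ 2) with hc1
  refine ⟨c₁, c₂, δ ^ 4 / 144, by positivity, by positivity, by positivity, ?_⟩
  intro n hn
  have hn' : (1 : ℝ) ≤ n := by exact_mod_cast hn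
  have hl0 : 0 ≤ Real.log n := Real.log_nonneg hn'
  by_cases hnn : n < n0
  · rw [ENNReal.ofReal_of_nonpos]
    · exact zero_le
    · have h1 : Real.log n ≤ Real.log n0 := Real.log_le_log (by linarith) (by exact_mod_cast hnn.le)
      have h2 : Real.exp (c₂ * (Real.log n) ^ 2) ≤ c₁ := by
        have : Real.exp (c₂ * (Real.log n) ^ 2) ≤ Real.exp (c₂ * (Real.log n0) ^ 2) := by
          gcongr
        have h4 : 0 ≤ 2 * (3 * C * Real.exp (2 / c) + C3) := by positivity
        linarith
      have h3 : 1 ≤ c₁ * Real.exp (-c₂ * (Real.log n) ^ 2) := by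
        calc (1 : ℝ) = Real.exp (c₂ * (Real.log n) ^ 2) * Real.exp (-c₂ * (Real.log n) ^ 2) := by
              rw [← Real.exp_add, neg_mul, add_neg_cancel, Real.exp_zero]
          _ ≤ _ := by gcongr
      linarith
  push Not at hnn
  obtain ⟨k2, k3⟩ := hn0 n hnn
  set K := ⌈(Real.log n) ^ 2⌉₊ + 1 with hK
  set M := (2 * n + 1) / K with hM
  set r := ⌊δ * K⌋₊ with hr
  have hK1 : 1 ≤ K := by omega
  have hKr : (1 : ℝ) ≤ K := by exact_mod_cast hK1
  have hKn : K ≤ n := by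
    have : (K : ℝ) ≤ n := by nlinarith
    exact_mod_cast this
  have hMK := Nat.div_add_mod (2 * n + 1) K
  have hmod := Nat.mod_lt (2 * n + 1) hK1
  rw [← hM, mul_comm] at hMK
  have hM1 : 1 ≤ M := by
    rw [hM, Nat.one_le_div_iff hK1]; omega
  have hMn : M ≤ 2 * n + 1 := Nat.div_le_self _ _
  have hKl : (Real.log n) ^ 2 ≤ K := by
    rw [hK]; push_cast
    linarith [Nat.le_ceil ((Real.log n) ^ 2)]
  -- probability bounds
  have hb1 := good0_fail (p := p) (ε := C * n * Real.exp (-c * K)) (r := r) (K := K) hc hC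
    (by positivity) (n := n) (M := M) (fun j _ => hs n j K hK1) hw P So (fun A hA => Pr_bern h0 hp1.le hP hA)
  have hb2 := good0_fail (p := p) (ε := C * n * Real.exp (-c * K)) (r := r) (K := K) hc hC
    (by positivity) (n := n) (M := M) (fun j _ => hs n j K hK1) hw P (fun ω => swp.σ '' So ω)
    (fun A hA => by
      rw [← Pr_image swp.σ hA]
      exact Pr_bern h0 hp1.le hP (hA.image swp.σ))
  set ε := (M : ℝ) * (C * n * Real.exp (-c * K)) + C / (1 - Real.exp (-c)) * Real.exp (-c * n) with hε
  have hε0 : 0 ≤ ε := by positivity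
  have hεle : 2 * ε ≤ c₁ * Real.exp (-c₂ * (Real.log n) ^ 2) := by
    set l := Real.log n with hl
    have hMr : (M : ℝ) ≤ 3 * n := by
      have : (M : ℝ) ≤ 2 * n + 1 := by exact_mod_cast hMn
      linarith
    have hnexp : (n : ℝ) = Real.exp l := by rw [hl, Real.exp_log (by linarith)]
    have e1 : (M : ℝ) * (C * n * Real.exp (-c * K)) ≤
        3 * C * Real.exp (2 / c) * Real.exp (-c₂ * l ^ 2) := by
      calc (M : ℝ) * (C * n * Real.exp (-c * K)) ≤ (3 * n) * (C * n * Real.exp (-c * l ^ 2)) := by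
            have : -c * (K : ℝ) ≤ -c * l ^ 2 := by nlinarith
            gcongr
        _ = 3 * C * (n * n * Real.exp (-c * l ^ 2)) := by ring
        _ = 3 * C * Real.exp (l + l + -c * l ^ 2) := by
            rw [hnexp, ← Real.exp_add, ← Real.exp_add]
        _ ≤ 3 * C * Real.exp (2 / c + -c₂ * l ^ 2) := by
            have : l + l + -c * l ^ 2 ≤ 2 / c + -c₂ * l ^ 2 := by
              have h5 : 2 * l ≤ c / 2 * l ^ 2 + 2 / c := by
                have h6 : c / 2 * l ^ 2 + 2 / c - 2 * l = (c * l - 2) ^ 2 / (2 * c) := by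
                  field_simp; ring
                have h7 : 0 ≤ (c * l - 2) ^ 2 / (2 * c) := by positivity
                linarith
              have h8 : 0 ≤ c * l ^ 2 := by positivity
              rw [hc2]
              linarith
            gcongr
        _ = _ := by rw [Real.exp_add]; ring
    have e2 : C / (1 - Real.exp (-c)) * Real.exp (-c * n) ≤ C3 * Real.exp (-c₂ * l ^ 2) := by
      have h5 : l ^ 2 ≤ 4 * n := by
        have h6 : l = 2 * Real.log (Real.sqrt n) := by
          rw [Real.log_sqrt (by linarith)]; ring
        have h7 : Real.log (Real.sqrt n) ≤ Real.sqrt n := by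
          have := Real.log_le_sub_one_of_pos (Real.sqrt_pos.2 (show (0 : ℝ) < n by linarith))
          linarith
        have h8 := Real.sq_sqrt (show (0 : ℝ) ≤ n by linarith)
        have h9 : l ≤ 2 * Real.sqrt n := by linarith
        nlinarith
      have : -c * (n : ℝ) ≤ -c₂ * l ^ 2 := by rw [hc2]; nlinarith
      gcongr
    have e3 : 0 ≤ Real.exp (c₂ * (Real.log n0) ^ 2) * Real.exp (-c₂ * l ^ 2) := by positivity
    rw [hc1, hε]
    nlinarith
  set A := {ω : Config | ∀ G ∈ optimizers ω n, δ ^ 4 / 144 * (n : ℝ) ^ 2 ≤ (G.ncard : ℝ)} with hA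
  have hAc : Aᶜ ⊆ {ω | ¬ Good0 (So ω) n K M r} ∪ {ω | ¬ Good0 (swp.σ '' So ω) n K M r} := by
    intro ω hω
    by_contra hcon
    rw [mem_union, not_or, mem_ofPred_eq, mem_ofPred_eq, not_not, not_not] at hcon
    refine hω ?_
    intro G hG
    refine det (K := K) (M := M) (r := r) ⟨hn, hK1, hM1, by omega, by omega, hcon.1, hcon.2⟩ hδ hδ1
      (Nat.lt_floor_add_one _).le (by omega) ?_ k2 k3 hG
    have : 0 < δ * n := by positivity
    nlinarith
  have hPA : P Aᶜ ≤ ENNReal.ofReal (c₁ * Real.exp (-c₂ * (Real.log n) ^ 2)) := by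
    refine (measure_mono hAc).trans ((measure_union_le _ _).trans ?_)
    refine (add_le_add hb1 hb2).trans ?_
    rw [← ENNReal.ofReal_add hε0 hε0]
    refine ENNReal.ofReal_le_ofReal ?_
    linarith
  rw [ENNReal.ofReal_sub _ (by positivity), ENNReal.ofReal_one, tsub_le_iff_right]
  calc (1 : ENNReal) = P univ := by rw [measure_univ]
    _ = P (A ∪ Aᶜ) := by rw [union_compl_self]
    _ ≤ P A + P Aᶜ := measure_union_le _ _
    _ ≤ _ := by gcongr

end Perc

/-- For `p ∈ (1/2, 1)` there are positive constants `c₁(p), c₂(p), α(p)` such that for all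
`n ≥ 1`, with probability at least `1 - c₁ exp(-c₂ log² n)`, every Cheeger optimizer
`G ∈ 𝒢ₙ` satisfies `|G| ≥ α n²`. -/
theorem cheeger_optimizers_volume_lower_bound (p : ℝ) (hp : 1 / 2 < p) (hp1 : p < 1)
    (P : MeasureTheory.Measure Config) (hP : IsBernoulli P p) :
    ∃ c₁ c₂ α : ℝ, 0 < c₁ ∧ 0 < c₂ ∧ 0 < α ∧
      ∀ n : ℕ, 1 ≤ n →
        ENNReal.ofReal (1 - c₁ * Real.exp (-c₂ * (Real.log n) ^ 2)) ≤
          P {ω : Config | ∀ G ∈ optimizers ω n, α * (n : ℝ) ^ 2 ≤ (G.ncard : ℝ)} := by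
  exact Perc.main p hp hp1 P hP
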